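/- Let K be a triangulated 2-disk in ℝ² (affine simplices) and f : ∂K → ℝ² a simplexwise-linear embedding whose image is a strictly convex polygon. Then f extends to a simplexwise-linear embedding of K into ℝ². -/

import Mathlib

/-! Basic notions for triangulated 2-disks with straight simplices in the plane. -/

/-- Vertex set of an ordered triangle. -/
def vset {ι : Type} [DecidableEq ι] (t : ι × ι × ι) : Finset ι := {t.1, t.2.1, t.2.2}

/-- The geometric (closed, filled) triangle spanned by an ordered triple of vertices. -/
def triSet {ι : Type} (pos : ι → ℝ × ℝ) (t : ι × ι × ι) : Set (ℝ × ℝ) :=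
  convexHull ℝ {pos t.1, pos t.2.1, pos t.2.2}

/-- A triangulated 2-disk with straight (affine) simplices in the plane: finitely many
nondegenerate affine triangles, any two of which intersect exactly in the convex hull of
their common vertices, whose union is homeomorphic to the closed 2-disk. -/
structure TriDisk (ι : Type) [Fintype ι] [DecidableEq ι] where
  pos : ι → ℝ × ℝ
  inj : Function.Injective pos
  tris : Finset (ι × ι × ι)
  nonempty : tris.Nonempty
  indep : ∀ t ∈ tris, AffineIndependent ℝ ![pos t.1, pos t.2.1, pos t.2.2]
  glue : ∀ s ∈ tris, ∀ t ∈ tris,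
    triSet pos s ∩ triSet pos t = convexHull ℝ (pos '' ((vset s ∩ vset t : Finset ι) : Set ι))
  disk : Nonempty ((⋃ t ∈ tris, triSet pos t) ≃ₜ
      (Metric.closedBall (0 : EuclideanSpace ℝ (Fin 2)) 1))

namespace TriDisk

variable {ι : Type} [Fintype ι] [DecidableEq ι]

/-- The underlying space of the triangulated disk. -/
def space (D : TriDisk ι) : Set (ℝ × ℝ) := ⋃ t ∈ D.tris, triSet D.pos t

/-- `a b` span an edge (1-simplex) of the triangulation. -/
def IsEdge (D : TriDisk ι) (a b : ι) : Prop :=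
  a ≠ b ∧ ∃ t ∈ D.tris, a ∈ vset t ∧ b ∈ vset t

/-- A spanning edge: both endpoints on the boundary circle, open edge in the interior. -/
def IsSpanningEdge (D : TriDisk ι) (a b : ι) : Prop :=
  D.IsEdge a b ∧ D.pos a ∈ frontier D.space ∧ D.pos b ∈ frontier D.space ∧
    openSegment ℝ (D.pos a) (D.pos b) ⊆ interior D.space

/-- `K` is simple if it has no spanning edge. -/
def Simple (D : TriDisk ι) : Prop := ∀ a b : ι, ¬ D.IsSpanningEdge a b

/-- Transverse to the verticals: every intersection with a vertical line is connected. -/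
def TrV (D : TriDisk ι) : Prop :=
  ∀ c : ℝ, IsPreconnected (D.space ∩ {p : ℝ × ℝ | p.1 = c})

/-- A boundary edge of the triangulation. -/
def IsBoundaryEdge (D : TriDisk ι) (a b : ι) : Prop :=
  D.IsEdge a b ∧ segment ℝ (D.pos a) (D.pos b) ⊆ frontier D.space

/-- A roof edge: a boundary edge no ascending vertical ray from which meets the interior. -/
def IsRoofEdge (D : TriDisk ι) (a b : ι) : Prop :=
  D.IsBoundaryEdge a b ∧
    ∀ p ∈ segment ℝ (D.pos a) (D.pos b), ∀ s : ℝ, 0 ≤ s →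
      (p.1, p.2 + s) ∉ interior D.space

/-- The roof of a TrV disk, as a subset of the boundary. -/
def roof (D : TriDisk ι) : Set (ℝ × ℝ) :=
  ⋃ (a : ι) (b : ι) (_ : D.IsRoofEdge a b), segment ℝ (D.pos a) (D.pos b)

/-- `F` is simplexwise linear on the boundary of `D`. -/
def SLOnBoundary (D : TriDisk ι) (F : ℝ × ℝ → ℝ × ℝ) : Prop :=
  ∀ a b : ι, D.IsBoundaryEdge a b →
    ∃ g : (ℝ × ℝ) →ᵃ[ℝ] (ℝ × ℝ), Set.EqOn F g (segment ℝ (D.pos a) (D.pos b))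

/-- `F` is simplexwise linear on the whole disk `D`. -/
def SLOn (D : TriDisk ι) (F : ℝ × ℝ → ℝ × ℝ) : Prop :=
  ∀ t ∈ D.tris, ∃ g : (ℝ × ℝ) →ᵃ[ℝ] (ℝ × ℝ), Set.EqOn F g (triSet D.pos t)

/-- `F` is vertical on `S`: it preserves first coordinates there. -/
def VerticalOn (F : ℝ × ℝ → ℝ × ℝ) (S : Set (ℝ × ℝ)) : Prop :=
  ∀ p ∈ S, (F p).1 = p.1

/-- The image of the boundary under `F` is a convex polygon, i.e. it is the boundary
of a compact convex set with nonempty interior. -/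
def ConvexImage (D : TriDisk ι) (F : ℝ × ℝ → ℝ × ℝ) : Prop :=
  ∃ C : Set (ℝ × ℝ), Convex ℝ C ∧ IsCompact C ∧ (interior C).Nonempty ∧
    F '' frontier D.space = frontier C

/-- A spanning edge `{a,b}` is `F`-obstructive: `F` maps (the closure of) one of the two
arcs of the boundary circle determined by its endpoints into a straight line. -/
def Obstructive (D : TriDisk ι) (F : ℝ × ℝ → ℝ × ℝ) (a b : ι) : Prop :=
  D.IsSpanningEdge a b ∧ ∃ x ∈ frontier D.space \ {D.pos a, D.pos b},
    Collinear ℝ (F '' closure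
      (connectedComponentIn (frontier D.space \ {D.pos a, D.pos b}) x))

end TriDisk

namespace EX

/-- Twice the signed area of the triangle `A B C`. -/
def orn (A B C : ℝ × ℝ) : ℝ := (B.1 - A.1) * (C.2 - A.2) - (B.2 - A.2) * (C.1 - A.1)

/-- Barycentric coordinate of `x` with respect to the vertex `C` of the triangle `A B C`. -/
noncomputable def bc (A B C x : ℝ × ℝ) : ℝ := orn A B x / orn A B C

theorem orn_rot (A B C : ℝ × ℝ) : orn B C A = orn A B C := by unfold orn; ring
theorem orn_swap (A B C : ℝ × ℝ) : orn B A C = - orn A B C := by unfold orn; ring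
theorem orn_self (A B : ℝ × ℝ) : orn A B B = 0 := by unfold orn; ring
theorem orn_self' (A B : ℝ × ℝ) : orn A B A = 0 := by unfold orn; ring
theorem orn_self'' (A B : ℝ × ℝ) : orn A A B = 0 := by unfold orn; ring

theorem orn_combo (A B P Q R : ℝ × ℝ) (α β γ : ℝ) (h : α + β + γ = 1) :
    orn A B (α • P + β • Q + γ • R) = α * orn A B P + β * orn A B Q + γ * orn A B R := by
  have : α = 1 - β - γ := by linarith
  subst this
  simp [orn]; ring

theorem orn_combo2 (A B P Q : ℝ × ℝ) (α β : ℝ) (h : α + β = 1) :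
    orn A B (α • P + β • Q) = α * orn A B P + β * orn A B Q := by
  have : α = 1 - β := by linarith
  subst this
  simp [orn]; ring

@[fun_prop]
theorem orn_cont (A B : ℝ × ℝ) : Continuous (fun x => orn A B x) := by
  unfold orn; fun_prop

@[fun_prop]
theorem bc_cont (A B C : ℝ × ℝ) : Continuous (fun x => bc A B C x) := by
  unfold bc; exact (orn_cont A B).div_const _

theorem bc_sum {A B C : ℝ × ℝ} (h : orn A B C ≠ 0) (x : ℝ × ℝ) :
    bc B C A x + bc C A B x + bc A B C x = 1 := by
  unfold bc
  rw [orn_rot A B C, show orn C A B = orn A B C by unfold orn; ring]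
  field_simp
  unfold orn; ring

theorem bc_repr {A B C : ℝ × ℝ} (h : orn A B C ≠ 0) (x : ℝ × ℝ) :
    x = bc B C A x • A + bc C A B x • B + bc A B C x • C := by
  unfold bc
  rw [orn_rot A B C, show orn C A B = orn A B C by unfold orn; ring]
  ext
  · simp; field_simp; unfold orn; ring
  · simp; field_simp; unfold orn; ring

theorem bc_combo {A B C : ℝ × ℝ} (h : orn A B C ≠ 0) {α β γ : ℝ} (hs : α + β + γ = 1) :
    bc A B C (α • A + β • B + γ • C) = γ := by
  unfold bc; rw [orn_combo _ _ _ _ _ _ _ _ hs, orn_self, orn_self']; field_simp; ring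

theorem mem_tri {A B C x : ℝ × ℝ} : x ∈ convexHull ℝ {A, B, C} ↔
    ∃ α β γ : ℝ, 0 ≤ α ∧ 0 ≤ β ∧ 0 ≤ γ ∧ α + β + γ = 1 ∧ x = α • A + β • B + γ • C := by
  rw [convexHull_insert (by simp), convexHull_pair]
  simp only [mem_convexJoin, Set.mem_singleton_iff, exists_eq_left]
  constructor
  · rintro ⟨y, ⟨a, b, ha, hb, hab, rfl⟩, ⟨c, d, hc, hd, hcd, rfl⟩⟩
    refine ⟨c, d * a, d * b, hc, by positivity, by positivity, ?_, ?_⟩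
    · rw [add_assoc, ← mul_add, hab, mul_one, hcd]
    · simp [smul_smul, smul_add, add_assoc]
  · rintro ⟨α, β, γ, hα, hβ, hγ, hs, rfl⟩
    by_cases h : β + γ = 0
    · have hb : β = 0 := by linarith
      have hc : γ = 0 := by linarith
      have ha : α = 1 := by linarith
      subst hb hc ha
      exact ⟨B, left_mem_segment ℝ B C, by simpa using left_mem_segment ℝ A B⟩
    · have hp : 0 < β + γ := lt_of_le_of_ne (by linarith) (Ne.symm h)
      refine ⟨(β / (β + γ)) • B + (γ / (β + γ)) • C, ⟨_, _, by positivity, by positivity, by field_simp, rfl⟩,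
        ⟨α, β + γ, hα, hp.le, by linarith, ?_⟩⟩
      rw [smul_add, smul_smul, smul_smul, mul_div_cancel₀ _ h, mul_div_cancel₀ _ h, add_assoc]

theorem mem_tri_iff {A B C x : ℝ × ℝ} (h : orn A B C ≠ 0) : x ∈ convexHull ℝ {A, B, C} ↔
    0 ≤ bc B C A x ∧ 0 ≤ bc C A B x ∧ 0 ≤ bc A B C x := by
  rw [mem_tri]
  constructor
  · rintro ⟨α, β, γ, hα, hβ, hγ, hs, rfl⟩
    have h1 : orn B C A ≠ 0 := by rwa [orn_rot]
    have h2 : orn C A B ≠ 0 := by rwa [orn_rot, orn_rot]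
    refine ⟨?_, ?_, by rwa [bc_combo h hs]⟩
    · rw [show α • A + β • B + γ • C = β • B + γ • C + α • A by abel, bc_combo h1 (by linarith)]
      exact hα
    · rw [show α • A + β • B + γ • C = γ • C + α • A + β • B by abel, bc_combo h2 (by linarith)]
      exact hβ
  · rintro ⟨h1, h2, h3⟩
    exact ⟨_, _, _, h1, h2, h3, bc_sum h x, bc_repr h x⟩

theorem isClosed_tri (A B C : ℝ × ℝ) : IsClosed (convexHull ℝ {A, B, C} : Set (ℝ × ℝ)) :=
  ((Set.toFinite {A, B, C}).isCompact_convexHull (𝕜 := ℝ)).isClosed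

/-- strictly interior points have the triangle as a neighbourhood -/
theorem tri_nhds {A B C x : ℝ × ℝ} (h : orn A B C ≠ 0) (h1 : 0 < bc B C A x)
    (h2 : 0 < bc C A B x) (h3 : 0 < bc A B C x) :
    (convexHull ℝ {A, B, C} : Set (ℝ × ℝ)) ∈ nhds x := by
  filter_upwards [(bc_cont B C A).continuousAt.eventually (lt_mem_nhds h1),
    (bc_cont C A B).continuousAt.eventually (lt_mem_nhds h2),
    (bc_cont A B C).continuousAt.eventually (lt_mem_nhds h3)] with y a b c
  exact (mem_tri_iff h).2 ⟨a.le, b.le, c.le⟩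

/-- local structure near a point of an open edge -/
theorem edge_nhds_half {A B C x : ℝ × ℝ} (h : orn A B C ≠ 0) (hx : x ∈ openSegment ℝ A B) :
    ∀ᶠ y in nhds x, 0 ≤ orn A B y * orn A B C → y ∈ convexHull ℝ {A, B, C} := by
  obtain ⟨a, b, ha, hb, hab, rfl⟩ := hx
  have h1 : orn B C A ≠ 0 := by rwa [orn_rot]
  have h2 : orn C A B ≠ 0 := by rwa [orn_rot, orn_rot]
  have e1 : bc B C A (a • A + b • B) = a := by
    have := bc_combo h1 (α := b) (β := 0) (γ := a) (by linarith)
    rwa [zero_smul, add_zero, add_comm] at this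
  have e2 : bc C A B (a • A + b • B) = b := by
    have := bc_combo h2 (α := 0) (β := a) (γ := b) (by linarith)
    rwa [zero_smul, zero_add] at this
  filter_upwards [(bc_cont B C A).continuousAt.eventually (lt_mem_nhds (e1 ▸ ha)),
    (bc_cont C A B).continuousAt.eventually (lt_mem_nhds (e2 ▸ hb))] with y a b c
  refine (mem_tri_iff h).2 ⟨a.le, b.le, ?_⟩
  unfold bc
  rcases lt_or_gt_of_ne h with h | h
  · exact div_nonneg_of_nonpos (by nlinarith) h.le
  · exact div_nonneg (by nlinarith) h.le

theorem edge_nhds {A B C D x : ℝ × ℝ} (h : orn A B C * orn A B D < 0) (hx : x ∈ openSegment ℝ A B) :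
    (convexHull ℝ {A, B, C} ∪ convexHull ℝ {A, B, D} : Set (ℝ × ℝ)) ∈ nhds x := by
  have hC : orn A B C ≠ 0 := by rintro h0; simp [h0] at h
  have hD : orn A B D ≠ 0 := by rintro h0; simp [h0] at h
  filter_upwards [edge_nhds_half hC hx, edge_nhds_half hD hx] with y h1 h2
  by_cases h3 : 0 ≤ orn A B y * orn A B C
  · exact Or.inl (h1 h3)
  · refine Or.inr (h2 ?_)
    push Not at h3
    by_contra h4
    push Not at h4
    have := mul_pos_of_neg_of_neg h3 h4
    nlinarith [mul_self_nonneg (orn A B y)]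

theorem orn_ne_of_indep {A B C : ℝ × ℝ} (h : AffineIndependent ℝ ![A, B, C]) : orn A B C ≠ 0 := by
  intro h0
  have key : ∀ x y z : ℝ, x + y + z = 0 → x • A + y • B + z • C = 0 → x = 0 ∧ y = 0 ∧ z = 0 := by
    intro x y z h1 h2
    have := (affineIndependent_iff.1 h) Finset.univ ![x, y, z]
      (by simpa [Fin.sum_univ_three] using h1) (by simpa [Fin.sum_univ_three] using h2)
    exact ⟨this 0 (by simp), this 1 (by simp), this 2 (by simp)⟩
  unfold orn at h0
  have k1 := key ((C.1 - A.1) - (B.1 - A.1)) (-(C.1 - A.1)) (B.1 - A.1) (by ring) (by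
    ext <;> simp
    · ring
    · linear_combination h0)
  have k2 := key ((C.2 - A.2) - (B.2 - A.2)) (-(C.2 - A.2)) (B.2 - A.2) (by ring) (by
    ext <;> simp
    · linear_combination -h0
    · ring)
  have hAB : A = B := by
    ext
    · linarith [k1.2.2]
    · linarith [k2.2.2]
  have := key 1 (-1) 0 (by ring) (by rw [hAB]; simp)
  norm_num at this

theorem exists_lin {p q : ℝ × ℝ} (h : p.1 * q.2 - p.2 * q.1 ≠ 0) (s t : ℝ) :
    ∃ α β : ℝ, α * p.1 + β * p.2 = s ∧ α * q.1 + β * q.2 = t := by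
  refine ⟨(s * q.2 - t * p.2) / (p.1 * q.2 - p.2 * q.1), (t * p.1 - s * q.1) / (p.1 * q.2 - p.2 * q.1), ?_, ?_⟩
  · rw [div_mul_eq_mul_div, div_mul_eq_mul_div, ← add_div, div_eq_iff h]; ring
  · rw [div_mul_eq_mul_div, div_mul_eq_mul_div, ← add_div, div_eq_iff h]; ring

end EX

namespace EX

variable {ι : Type} [Fintype ι] [DecidableEq ι]

/-- The geometric simplex spanned by a finite set of vertices. -/
def hl (D : TriDisk ι) (F : Finset ι) : Set (ℝ × ℝ) := convexHull ℝ (D.pos '' (F : Set ι))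

/-- `a b c` are the vertices (in any order) of a triangle of `D`. -/
def T (D : TriDisk ι) (a b c : ι) : Prop := ∃ t ∈ D.tris, vset t = {a, b, c}

/-- `a b` are the endpoints of an edge of `D`. -/
def E (D : TriDisk ι) (a b : ι) : Prop := ∃ c, T D a b c

variable {D : TriDisk ι}

theorem T.rot {a b c : ι} (h : T D a b c) : T D b c a := by
  obtain ⟨t, ht, h⟩ := h
  exact ⟨t, ht, by rw [h]; ext; simp; tauto⟩

theorem T.swap {a b c : ι} (h : T D a b c) : T D b a c := by
  obtain ⟨t, ht, h⟩ := h
  exact ⟨t, ht, by rw [h]; ext; simp; tauto⟩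

theorem T.e {a b c : ι} (h : T D a b c) : E D a b := ⟨c, h⟩
theorem E.symm {a b : ι} (h : E D a b) : E D b a := ⟨h.choose, h.choose_spec.swap⟩

theorem T_of_mem {t : ι × ι × ι} (ht : t ∈ D.tris) : T D t.1 t.2.1 t.2.2 := ⟨t, ht, rfl⟩

theorem hl_pair (a b : ι) : hl D {a, b} = segment ℝ (D.pos a) (D.pos b) := by
  unfold hl; rw [← convexHull_pair]; congr 1; simp [Set.image_pair]

theorem hl_triple (a b c : ι) : hl D {a, b, c} = convexHull ℝ {D.pos a, D.pos b, D.pos c} := by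
  unfold hl; congr 1; simp [Set.image_insert_eq]

theorem hl_single (a : ι) : hl D {a} = {D.pos a} := by
  unfold hl; simp

theorem hl_empty : hl D ∅ = ∅ := by
  unfold hl; simp

theorem triSet_eq (t : ι × ι × ι) : triSet D.pos t = hl D (vset t) := by
  unfold triSet vset; rw [hl_triple]

theorem T_orn {a b c : ι} (h : T D a b c) : orn (D.pos a) (D.pos b) (D.pos c) ≠ 0 := by
  obtain ⟨t, ht, h⟩ := h
  have h0 := orn_ne_of_indep (D.indep t ht)
  obtain ⟨i, j, k⟩ := t
  simp only [vset] at h h0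
  have hij : i ≠ j := by rintro rfl; exact h0 (orn_self'' _ _)
  have hik : i ≠ k := by rintro rfl; exact h0 (orn_self' _ _)
  have hjk : j ≠ k := by rintro rfl; exact h0 (orn_self _ _)
  have hi : i ∈ ({a, b, c} : Finset ι) := by rw [← h]; simp
  have hj : j ∈ ({a, b, c} : Finset ι) := by rw [← h]; simp
  have hk : k ∈ ({a, b, c} : Finset ι) := by rw [← h]; simp
  simp only [Finset.mem_insert, Finset.mem_singleton] at hi hj hk
  intro h1
  apply h0
  rcases hi with rfl | rfl | rfl <;> rcases hj with rfl | rfl | rfl <;>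
    rcases hk with rfl | rfl | rfl <;> first | contradiction | (unfold orn at *; linarith)

theorem T.ne {a b c : ι} (h : T D a b c) : a ≠ b := by
  rintro rfl; exact T_orn h (orn_self'' _ _)

theorem E.ne {a b : ι} (h : E D a b) : a ≠ b := h.choose_spec.ne

theorem isEdge_iff {a b : ι} : D.IsEdge a b ↔ E D a b := by
  constructor
  · rintro ⟨hab, t, ht, ha, hb⟩
    have := T_of_mem ht
    obtain ⟨i, j, k⟩ := t
    simp only [vset, Finset.mem_insert, Finset.mem_singleton] at ha hb
    simp only at this
    rcases ha with rfl | rfl | rfl <;> rcases hb with rfl | rfl | rfl <;> try contradiction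
    · exact ⟨_, this⟩
    · exact ⟨_, this.rot.rot.swap⟩
    · exact ⟨_, this.swap⟩
    · exact ⟨_, this.rot⟩
    · exact ⟨_, this.rot.rot⟩
    · exact ⟨_, this.rot.swap⟩
  · rintro ⟨c, h⟩
    refine ⟨h.ne, ?_⟩
    obtain ⟨t, ht, h⟩ := h
    exact ⟨t, ht, by simp [h], by simp [h]⟩

theorem ind_set {t : ι × ι × ι} (ht : t ∈ D.tris) :
    AffineIndependent ℝ ((↑) : (D.pos '' (vset t : Set ι)) → ℝ × ℝ) := by
  have h := (D.indep t ht).range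
  have e : Set.range ![D.pos t.1, D.pos t.2.1, D.pos t.2.2] = D.pos '' (vset t : Set ι) := by
    ext x; simp [vset, eq_comm]; tauto
  rw [e] at h
  exact h

theorem hl_inter_sub {t : ι × ι × ι} (ht : t ∈ D.tris) {F F' : Finset ι} (hF : F ⊆ vset t)
    (hF' : F' ⊆ vset t) : hl D F ∩ hl D F' = hl D (F ∩ F') := by
  unfold hl
  have := (ind_set ht)
  have e : D.pos '' (vset t : Set ι) = ((vset t).image D.pos : Finset (ℝ × ℝ)) := by simp
  rw [e] at this
  have := AffineIndependent.convexHull_inter (s := (vset t).image D.pos) (t₁ := F.image D.pos)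
    (t₂ := F'.image D.pos) this
    (Finset.image_subset_image hF) (Finset.image_subset_image hF')
  rw [Finset.coe_inter, Set.image_inter D.inj]
  rw [Finset.coe_image, Finset.coe_image] at this
  exact this.symm

theorem face_inter {s t : ι × ι × ι} (hs : s ∈ D.tris) (ht : t ∈ D.tris) {F F' : Finset ι}
    (hF : F ⊆ vset s) (hF' : F' ⊆ vset t) : hl D F ∩ hl D F' = hl D (F ∩ F') := by
  apply Set.Subset.antisymm
  · rintro x ⟨h1, h2⟩
    have hx : x ∈ hl D (vset s ∩ vset t) := by
      have := D.glue s hs t ht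
      rw [triSet_eq, triSet_eq] at this
      rw [hl, ← this]
      exact ⟨convexHull_mono (Set.image_mono (by exact_mod_cast hF)) h1,
        convexHull_mono (Set.image_mono (by exact_mod_cast hF')) h2⟩
    have a1 : x ∈ hl D (F ∩ (vset s ∩ vset t)) := by
      rw [← hl_inter_sub hs hF Finset.inter_subset_left]; exact ⟨h1, hx⟩
    have a2 : x ∈ hl D (F' ∩ (vset s ∩ vset t)) := by
      rw [← hl_inter_sub ht hF' Finset.inter_subset_right]; exact ⟨h2, hx⟩
    have : x ∈ hl D ((F ∩ (vset s ∩ vset t)) ∩ (F' ∩ (vset s ∩ vset t))) := by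
      rw [← hl_inter_sub hs (Finset.inter_subset_left.trans hF)
        (Finset.inter_subset_right.trans Finset.inter_subset_left)]
      exact ⟨a1, a2⟩
    refine convexHull_mono (Set.image_mono ?_) this
    intro i; simp; tauto
  · exact Set.subset_inter
      (convexHull_mono (Set.image_mono (by exact_mod_cast Finset.inter_subset_left)))
      (convexHull_mono (Set.image_mono (by exact_mod_cast Finset.inter_subset_right)))

/-- a face of the complex -/
def Fc (D : TriDisk ι) (F : Finset ι) : Prop := ∃ t ∈ D.tris, F ⊆ vset t

theorem Fc.inter {F F' : Finset ι} (h : Fc D F) (h' : Fc D F') :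
    hl D F ∩ hl D F' = hl D (F ∩ F') := by
  obtain ⟨s, hs, h⟩ := h
  obtain ⟨t, ht, h'⟩ := h'
  exact face_inter hs ht h h'

theorem T.fc {a b c : ι} (h : T D a b c) : Fc D {a, b, c} := by
  obtain ⟨t, ht, h⟩ := h; exact ⟨t, ht, h.ge⟩

theorem Fc.mono {F F' : Finset ι} (h : Fc D F) (h' : F' ⊆ F) : Fc D F' := by
  obtain ⟨t, ht, h⟩ := h; exact ⟨t, ht, h'.trans h⟩

theorem E.fc {a b : ι} (h : E D a b) : Fc D {a, b} := by
  obtain ⟨c, h⟩ := h; exact h.fc.mono (by intro x; simp; tauto)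

theorem mem_space {x : ℝ × ℝ} : x ∈ D.space ↔ ∃ a b c, T D a b c ∧ x ∈ hl D {a, b, c} := by
  unfold TriDisk.space
  simp only [Set.mem_iUnion, exists_prop]
  constructor
  · rintro ⟨t, ht, hx⟩
    exact ⟨_, _, _, T_of_mem ht, by rw [triSet_eq] at hx; exact hx⟩
  · rintro ⟨a, b, c, ⟨t, ht, h⟩, hx⟩
    exact ⟨t, ht, by rw [triSet_eq, h]; exact hx⟩

theorem hl_sub_space {a b c : ι} (h : T D a b c) : hl D {a, b, c} ⊆ D.space :=
  fun _ hx => mem_space.2 ⟨a, b, c, h, hx⟩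

theorem isClosed_hl (F : Finset ι) : IsClosed (hl D F) :=
  ((F.finite_toSet.image D.pos).isCompact_convexHull (𝕜 := ℝ)).isClosed

theorem isClosed_space : IsClosed D.space := by
  unfold TriDisk.space
  apply Set.Finite.isClosed_biUnion (Finset.finite_toSet _)
  intro t _
  rw [triSet_eq]; exact isClosed_hl _

theorem seg_sub_hl (a b c : ι) : segment ℝ (D.pos a) (D.pos b) ⊆ hl D {a, b, c} := by
  rw [← hl_pair]
  refine convexHull_mono (Set.image_mono ?_)
  intro x; simp; tauto

theorem pos_mem_hl {a : ι} {F : Finset ι} (h : a ∈ F) : D.pos a ∈ hl D F :=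
  subset_convexHull ℝ _ ⟨a, h, rfl⟩

/-- local finiteness: an interior point can be moved a bit in any direction inside a triangle -/
theorem move {x v : ℝ × ℝ} (hx : x ∈ interior D.space) :
    ∃ a b c, T D a b c ∧ x ∈ hl D {a, b, c} ∧ ∃ δ : ℝ, 0 < δ ∧ x + δ • v ∈ hl D {a, b, c} := by
  have hcl : IsClosed (⋃ t ∈ {t | t ∈ D.tris ∧ x ∉ hl D (vset t)}, hl D (vset t)) := by
    apply Set.Finite.isClosed_biUnion ((Finset.finite_toSet D.tris).subset (fun t ht => ht.1))
    intro t _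
    exact isClosed_hl _
  have hmem : ∀ᶠ y in nhds x, y ∈ D.space ∧
      y ∉ (⋃ t ∈ {t | t ∈ D.tris ∧ x ∉ hl D (vset t)}, hl D (vset t)) := by
    refine Filter.Eventually.and (mem_interior_iff_mem_nhds.1 hx) (hcl.isOpen_compl.mem_nhds ?_)
    simp
  have ht : Filter.Tendsto (fun δ : ℝ => x + δ • v) (nhdsWithin 0 (Set.Ioi 0)) (nhds x) := by
    have : ContinuousAt (fun δ : ℝ => x + δ • v) 0 := by fun_prop
    have h2 := this.tendsto
    simp only [zero_smul, add_zero] at h2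
    exact h2.mono_left nhdsWithin_le_nhds
  obtain ⟨δ, ⟨h1, h2⟩, h3⟩ := ((ht.eventually hmem).and self_mem_nhdsWithin).exists
  unfold TriDisk.space at h1
  simp only [Set.mem_iUnion, exists_prop] at h1
  obtain ⟨t, ht, h1⟩ := h1
  rw [triSet_eq] at h1
  refine ⟨_, _, _, T_of_mem ht, ?_, δ, h3, h1⟩
  by_contra hx
  apply h2
  simp only [Set.mem_iUnion]
  exact ⟨t, ⟨ht, hx⟩, h1⟩

theorem unique_side {a b c c' : ι} (h : T D a b c) (h' : T D a b c')
    (hs : 0 < orn (D.pos a) (D.pos b) (D.pos c) * orn (D.pos a) (D.pos b) (D.pos c')) : c = c' := by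
  by_contra hne
  have hm : midpoint ℝ (D.pos a) (D.pos b) ∈ openSegment ℝ (D.pos a) (D.pos b) :=
    ⟨1/2, 1/2, by norm_num, by norm_num, by norm_num, by
      rw [midpoint_eq_smul_add, smul_add]; norm_num⟩
  set m := midpoint ℝ (D.pos a) (D.pos b)
  have ht : Filter.Tendsto (fun δ : ℝ => (1 - δ) • m + δ • D.pos c) (nhdsWithin 0 (Set.Ioi 0)) (nhds m) := by
    have : ContinuousAt (fun δ : ℝ => (1 - δ) • m + δ • D.pos c) 0 := by fun_prop
    have h2 := this.tendsto
    simp only [zero_smul, add_zero, sub_zero, one_smul] at h2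
    exact h2.mono_left nhdsWithin_le_nhds
  obtain ⟨δ, ⟨h1, h2⟩, h3⟩ := ((ht.eventually ((edge_nhds_half (T_orn h) hm).and
    (edge_nhds_half (T_orn h') hm))).and self_mem_nhdsWithin).exists
  have hmo : orn (D.pos a) (D.pos b) m = 0 := by
    obtain ⟨x, y, _, _, hxy, he⟩ := hm
    rw [← he, orn_combo2 _ _ _ _ _ _ hxy, orn_self, orn_self']; ring
  have ho : orn (D.pos a) (D.pos b) ((1 - δ) • m + δ • D.pos c) =
      δ * orn (D.pos a) (D.pos b) (D.pos c) := by
    rw [orn_combo2 _ _ _ _ _ _ (by ring), hmo]; ring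
  have h3 : 0 < δ := h3
  have k1 := h1 (by rw [ho, mul_assoc]; exact mul_nonneg h3.le (mul_self_nonneg _))
  have k2 := h2 (by rw [ho, mul_assoc]; exact mul_nonneg h3.le hs.le)
  rw [← hl_triple] at k1 k2
  have k3 : (1 - δ) • m + δ • D.pos c ∈ hl D ({a, b, c} ∩ {a, b, c'}) := by
    rw [← h.fc.inter h'.fc]; exact ⟨k1, k2⟩
  have k4 : (1 - δ) • m + δ • D.pos c ∈ hl D {a, b} := by
    refine convexHull_mono (Set.image_mono ?_) k3
    intro i hi
    simp only [Finset.coe_inter, Finset.coe_insert, Finset.coe_singleton, Set.mem_inter_iff,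
      Set.mem_insert_iff, Set.mem_singleton_iff] at hi ⊢
    rcases hi with ⟨g1 | g1 | g1, g2⟩
    · exact Or.inl g1
    · exact Or.inr g1
    · rcases g2 with g2 | g2 | g2
      · exact Or.inl g2
      · exact Or.inr g2
      · exact absurd (g1.symm.trans g2) hne
  rw [hl_pair] at k4
  obtain ⟨x, y, _, _, hxy, he⟩ := k4
  rw [← he, orn_combo2 _ _ _ _ _ _ hxy, orn_self, orn_self'] at ho
  have : 0 = δ * orn (D.pos a) (D.pos b) (D.pos c) := by rw [← ho]; ring
  rcases mul_eq_zero.1 this.symm with h0 | h0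
  · linarith
  · exact T_orn h h0

/-- the other side of an edge carries no triangle iff it is a boundary edge -/
theorem boundary_of_onesided {a b c : ι} (h : T D a b c)
    (hno : ∀ d, T D a b d → ¬ orn (D.pos a) (D.pos b) (D.pos c) * orn (D.pos a) (D.pos b) (D.pos d) < 0) :
    D.IsBoundaryEdge a b := by
  refine ⟨isEdge_iff.2 h.e, ?_⟩
  have hne : D.pos a ≠ D.pos b := fun he => h.ne (D.inj he)
  have hopen : openSegment ℝ (D.pos a) (D.pos b) ⊆ frontier D.space := by
    intro m hm
    have hmK : m ∈ D.space := hl_sub_space h (seg_sub_hl a b c (openSegment_subset_segment _ _ _ hm))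
    rw [frontier_eq_closure_inter_closure, isClosed_space.closure_eq]
    refine ⟨hmK, ?_⟩
    rw [closure_compl]
    intro hinter
    obtain ⟨i, j, k, hT, hmt, δ, hδ, hmove⟩ := move (v := m - D.pos c) hinter
    have hmab : m ∈ hl D ({a, b} ∩ {i, j, k}) := by
      rw [← h.e.fc.inter hT.fc, hl_pair]
      exact ⟨openSegment_subset_segment _ _ _ hm, hmt⟩
    have hma : m ≠ D.pos a := by
      rintro rfl
      exact hne (left_mem_openSegment_iff.1 hm)
    have hmb : m ≠ D.pos b := by
      rintro rfl
      exact hne (right_mem_openSegment_iff.1 hm)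
    have ha : a ∈ ({i, j, k} : Finset ι) := by
      by_contra hna
      have : m ∈ hl D {b} := by
        refine convexHull_mono (Set.image_mono ?_) hmab
        intro l hl
        simp at hl ⊢
        rcases hl.1 with rfl | rfl
        · simp at hna; tauto
        · rfl
      rw [hl_single] at this; exact hmb this
    have hb : b ∈ ({i, j, k} : Finset ι) := by
      by_contra hna
      have : m ∈ hl D {a} := by
        refine convexHull_mono (Set.image_mono ?_) hmab
        intro l hl
        simp at hl ⊢
        rcases hl.1 with rfl | rfl
        · rfl
        · simp at hna; tauto
      rw [hl_single] at this; exact hma this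
    obtain ⟨d, hd, hset⟩ : ∃ d, T D a b d ∧ ({i, j, k} : Finset ι) = {a, b, d} := by
      have hab := h.ne
      simp only [Finset.mem_insert, Finset.mem_singleton] at ha hb
      rcases ha with rfl | rfl | rfl <;> rcases hb with rfl | rfl | rfl <;> try contradiction
      · exact ⟨_, hT, rfl⟩
      · exact ⟨_, hT.rot.rot.swap, by ext; simp; tauto⟩
      · exact ⟨_, hT.swap, by ext; simp; tauto⟩
      · exact ⟨_, hT.rot, by ext; simp; tauto⟩
      · exact ⟨_, hT.rot.rot, by ext; simp; tauto⟩
      · exact ⟨_, hT.rot.swap, by ext; simp; tauto⟩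
    apply hno d hd
    rw [hset, hl_triple, mem_tri] at hmove
    obtain ⟨α, β, γ, hα, hβ, hγ, hs, he⟩ := hmove
    have ho : orn (D.pos a) (D.pos b) (m + δ • (m - D.pos c)) =
        - (δ * orn (D.pos a) (D.pos b) (D.pos c)) := by
      obtain ⟨x, y, _, _, hxy, hm⟩ := hm
      have : m + δ • (m - D.pos c) = ((1 + δ) * x) • D.pos a + ((1 + δ) * y) • D.pos b + (-δ) • D.pos c := by
        rw [← hm]; module
      rw [this, orn_combo _ _ _ _ _ _ _ _ (by linear_combination (1 + δ) * hxy), orn_self, orn_self']; ring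
    rw [he, orn_combo _ _ _ _ _ _ _ _ hs, orn_self, orn_self'] at ho
    have h1 := T_orn h
    have hpos : 0 < orn (D.pos a) (D.pos b) (D.pos c) ^ 2 := by positivity
    by_contra h2
    push Not at h2
    have e : γ * (orn (D.pos a) (D.pos b) (D.pos c) * orn (D.pos a) (D.pos b) (D.pos d)) =
        - (δ * orn (D.pos a) (D.pos b) (D.pos c) ^ 2) := by
      linear_combination orn (D.pos a) (D.pos b) (D.pos c) * ho
    linarith [mul_nonneg hγ h2, mul_pos hδ hpos]
  have := closure_mono hopen
  rw [closure_openSegment, isClosed_frontier.closure_eq] at this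
  exact this

theorem interior_of_twosided {a b c d : ι} (h : T D a b c) (h' : T D a b d)
    (ho : orn (D.pos a) (D.pos b) (D.pos c) * orn (D.pos a) (D.pos b) (D.pos d) < 0) :
    openSegment ℝ (D.pos a) (D.pos b) ⊆ interior D.space := by
  intro m hm
  rw [mem_interior_iff_mem_nhds]
  refine Filter.mem_of_superset (edge_nhds ho hm) ?_
  rw [← hl_triple, ← hl_triple]
  exact Set.union_subset (hl_sub_space h) (hl_sub_space h')

theorem openSegment_nonempty' (x y : ℝ × ℝ) : (openSegment ℝ x y).Nonempty :=
  ⟨_, 1/2, 1/2, by norm_num, by norm_num, by norm_num, rfl⟩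

theorem not_boundary_of_twosided {a b c d : ι} (h : T D a b c) (h' : T D a b d)
    (ho : orn (D.pos a) (D.pos b) (D.pos c) * orn (D.pos a) (D.pos b) (D.pos d) < 0) :
    ¬ D.IsBoundaryEdge a b := by
  rintro ⟨_, hb⟩
  obtain ⟨m, hm⟩ := openSegment_nonempty' (D.pos a) (D.pos b)
  have h1 := interior_of_twosided h h' ho hm
  have h2 := hb (openSegment_subset_segment _ _ _ hm)
  exact h2.2 h1

theorem frontier_cases {x : ℝ × ℝ} (hx : x ∈ frontier D.space) :
    (∃ v, x = D.pos v ∧ ∃ w, E D v w) ∨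
    ∃ a b, D.IsBoundaryEdge a b ∧ x ∈ openSegment ℝ (D.pos a) (D.pos b) := by
  have hxK : x ∈ D.space := by
    rw [← isClosed_space.closure_eq]; exact hx.1
  obtain ⟨a, b, c, h, hxt⟩ := mem_space.1 hxK
  have edge : ∀ a b c, T D a b c → x ∈ openSegment ℝ (D.pos a) (D.pos b) →
      ∃ a b, D.IsBoundaryEdge a b ∧ x ∈ openSegment ℝ (D.pos a) (D.pos b) := by
    intro a b c h hxo
    refine ⟨a, b, boundary_of_onesided h ?_, hxo⟩
    intro d hd ho
    exact hx.2 (interior_of_twosided h hd ho hxo)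
  rw [hl_triple, mem_tri] at hxt
  obtain ⟨α, β, γ, hα, hβ, hγ, hs, rfl⟩ := hxt
  have seg : ∀ (A B C : ι) (p q r : ℝ), 0 < p → 0 < q → r = 0 → p + q + r = 1 →
      p • D.pos A + q • D.pos B + r • D.pos C ∈ openSegment ℝ (D.pos A) (D.pos B) := by
    rintro A B C p q r hp hq rfl hs
    exact ⟨p, q, hp, hq, by linarith, by simp⟩
  rcases hα.eq_or_lt with ha | ha <;> rcases hβ.eq_or_lt with hb | hb <;>
    rcases hγ.eq_or_lt with hc | hc
  · linarith
  · left; refine ⟨c, ?_, a, h.rot.rot.e⟩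
    rw [← ha, ← hb, show γ = 1 by linarith]; simp
  · left; refine ⟨b, ?_, c, h.rot.e⟩
    rw [← ha, ← hc, show β = 1 by linarith]; simp
  · right
    apply edge b c a h.rot
    rw [show α • D.pos a + β • D.pos b + γ • D.pos c = β • D.pos b + γ • D.pos c + α • D.pos a by abel]
    exact seg _ _ _ _ _ _ hb hc ha.symm (by linarith)
  · left; refine ⟨a, ?_, b, h.e⟩
    rw [← hb, ← hc, show α = 1 by linarith]; simp
  · right
    apply edge c a b h.rot.rot
    rw [show α • D.pos a + β • D.pos b + γ • D.pos c = γ • D.pos c + α • D.pos a + β • D.pos b by abel]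
    exact seg _ _ _ _ _ _ hc ha hb.symm (by linarith)
  · right
    exact edge a b c h (seg _ _ _ _ _ _ ha hb hc.symm hs)
  · exfalso
    apply hx.2
    rw [mem_interior_iff_mem_nhds]
    have h0 := T_orn h
    have h1 : orn (D.pos b) (D.pos c) (D.pos a) ≠ 0 := by rwa [orn_rot]
    have h2 : orn (D.pos c) (D.pos a) (D.pos b) ≠ 0 := by rwa [orn_rot, orn_rot]
    refine Filter.mem_of_superset (tri_nhds h0 ?_ ?_ ?_) ?_
    · rw [show α • D.pos a + β • D.pos b + γ • D.pos c = β • D.pos b + γ • D.pos c + α • D.pos a by abel,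
        bc_combo h1 (by linarith)]; exact ha
    · rw [show α • D.pos a + β • D.pos b + γ • D.pos c = γ • D.pos c + α • D.pos a + β • D.pos b by abel,
        bc_combo h2 (by linarith)]; exact hb
    · rw [bc_combo h0 hs]; exact hc
    · rw [← hl_triple]; exact hl_sub_space h

/-- a geometric vertex lying in a face is a vertex of that face -/
theorem mem_of_pos_mem {v w : ι} (hv : E D v w) {F : Finset ι} (hF : Fc D F) (h : D.pos v ∈ hl D F) :
    v ∈ F := by
  by_contra hn
  have h1 : Fc D {v} := hv.fc.mono (by simp)
  have : D.pos v ∈ hl D ({v} ∩ F) := by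
    rw [← h1.inter hF]; exact ⟨pos_mem_hl (by simp), h⟩
  rw [Finset.singleton_inter_of_notMem hn, hl_empty] at this
  exact this

theorem E_of_mem {a b c i j : ι} (h : T D a b c) (hi : i ∈ ({a, b, c} : Finset ι))
    (hj : j ∈ ({a, b, c} : Finset ι)) (hij : i ≠ j) : E D i j := by
  rw [← isEdge_iff]
  obtain ⟨t, ht, h⟩ := h
  exact ⟨hij, t, ht, h ▸ hi, h ▸ hj⟩

/-- interior vertices are positive combinations of their neighbours -/
theorem exists_weights (D : TriDisk ι) : ∃ lam : ι → ι → ℝ, ∀ v, D.pos v ∉ frontier D.space →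
    (∃ w, E D v w) → (∀ w, 0 ≤ lam v w) ∧ (∀ w, E D v w → 0 < lam v w) ∧ (∀ w, ¬ E D v w → lam v w = 0)
      ∧ ∑ w, lam v w • (D.pos w - D.pos v) = 0 := by
  classical
  have key : ∀ v, ∃ l : ι → ℝ, D.pos v ∉ frontier D.space →
    (∃ w, E D v w) → (∀ w, 0 ≤ l w) ∧ (∀ w, E D v w → 0 < l w) ∧ (∀ w, ¬ E D v w → l w = 0)
      ∧ ∑ w, l w • (D.pos w - D.pos v) = 0 := by
    intro v
    by_cases hv : D.pos v ∉ frontier D.space ∧ ∃ w, E D v w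
    swap
    · exact ⟨0, fun h1 h2 => absurd ⟨h1, h2⟩ hv⟩
    obtain ⟨hv, w0, hw0⟩ := hv
    have hinter : D.pos v ∈ interior D.space := by
      have hK : D.pos v ∈ D.space := by
        obtain ⟨c, hc⟩ := hw0
        exact hl_sub_space hc (pos_mem_hl (by simp))
      by_contra hn
      exact hv ⟨subset_closure hK, hn⟩
    have one : ∀ w, ∃ l : ι → ℝ, (∀ i, 0 ≤ l i) ∧ (∀ i, ¬ E D v i → l i = 0) ∧ (E D v w → 0 < l w) ∧
        ∑ i, l i • (D.pos i - D.pos v) = 0 := by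
      intro w
      by_cases hw : E D v w
      swap
      · exact ⟨0, by simp, by simp, fun h => absurd h hw, by simp⟩
      obtain ⟨a, b, c, hT, hm, δ, hδ, hmove⟩ := move (v := D.pos v - D.pos w) hinter
      have hvF := mem_of_pos_mem hw0 hT.fc hm
      rw [hl_triple, mem_tri] at hmove
      obtain ⟨α, β, γ, hα, hβ, hγ, hs, he⟩ := hmove
      set l : ι → ℝ := fun i => if i = v then 0 else (if i = a then α else 0) + (if i = b then β else 0)
        + (if i = c then γ else 0) + (if i = w then δ else 0) with hl
      have l0 : ∀ i, 0 ≤ l i := by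
        intro i; simp only [hl]; split_ifs <;> positivity
      refine ⟨l, l0, ?_, ?_, ?_⟩
      · intro i hi
        simp only [hl]
        by_cases hiv : i = v
        · simp [hiv]
        have hnm : i ∉ ({a, b, c} : Finset ι) := fun hmem => hi (E_of_mem hT hvF hmem (Ne.symm hiv))
        simp only [Finset.mem_insert, Finset.mem_singleton, not_or] at hnm
        have hiw : i ≠ w := by rintro rfl; exact hi hw
        simp [hnm, hiw]
      · intro _
        simp only [hl]
        rw [if_neg hw.ne.symm]
        simp only [if_true]
        split_ifs <;> positivity
      · have : ∀ i, l i • (D.pos i - D.pos v) = (if i = a then α • (D.pos a - D.pos v) else 0) +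
            (if i = b then β • (D.pos b - D.pos v) else 0) + (if i = c then γ • (D.pos c - D.pos v) else 0)
            + (if i = w then δ • (D.pos w - D.pos v) else 0) := by
          intro i
          by_cases hiv : i = v
          · subst hiv
            simp only [hl, if_true, zero_smul]
            split_ifs <;> simp_all
          · simp only [hl, if_neg hiv, add_smul, ite_smul, zero_smul]
            congr 1; congr 1; congr 1
            all_goals (split_ifs with h <;> simp [h])
        simp only [this, Finset.sum_add_distrib, Finset.sum_ite_eq', Finset.mem_univ, if_true]
        have h2 : α • D.pos a + β • D.pos b + γ • D.pos c - D.pos v - δ • (D.pos v - D.pos w) = 0 := by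
          rw [← he]; abel
        rw [← h2]
        have : D.pos v = (α + β + γ) • D.pos v := by rw [hs, one_smul]
        have h3 : α • D.pos a + β • D.pos b + γ • D.pos c - D.pos v - δ • (D.pos v - D.pos w)
          = α • D.pos a + β • D.pos b + γ • D.pos c - (α + β + γ) • D.pos v - δ • (D.pos v - D.pos w) := by
          rw [← this]
        rw [h3]
        module
    choose l l1 l2 l3 l4 using one
    refine ⟨fun i => ∑ w, l w i, fun _ _ => ⟨?_, ?_, ?_, ?_⟩⟩
    · exact fun i => Finset.sum_nonneg (fun w _ => l1 w i)
    · intro w hw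
      exact Finset.sum_pos' (fun k _ => l1 k w) ⟨w, Finset.mem_univ _, l3 w hw⟩
    · intro i hi
      exact Finset.sum_eq_zero (fun w _ => l2 w i hi)
    · simp only [Finset.sum_smul]
      rw [Finset.sum_comm]
      exact Finset.sum_eq_zero (fun w _ => l4 w)
  choose lam h using key
  exact ⟨lam, h⟩

end EX

namespace EX

/-- second coordinate of the point of the line `q q'` above `x` -/
noncomputable def itp (q q' : ℝ × ℝ) (x : ℝ) : ℝ := q.2 + (x - q.1) / (q'.1 - q.1) * (q'.2 - q.2)

open Classical in
/-- does the upward vertical ray from `y` cross the edge `q q'` (half-open convention)? -/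
noncomputable def up (q q' y : ℝ × ℝ) : ZMod 2 :=
  if ((q.1 ≤ y.1 ∧ y.1 < q'.1) ∨ (q'.1 ≤ y.1 ∧ y.1 < q.1)) ∧ y.2 < itp q q' y.1 then 1 else 0

open Classical in
/-- does the downward vertical ray from `q` cross the edge `y y'` (half-open convention)? -/
noncomputable def dn (y y' q : ℝ × ℝ) : ZMod 2 :=
  if ((y.1 < q.1 ∧ q.1 ≤ y'.1) ∨ (y'.1 < q.1 ∧ q.1 ≤ y.1)) ∧ itp y y' q.1 < q.2 then 1 else 0

theorem itp_symm {q q' : ℝ × ℝ} (h : q.1 ≠ q'.1) (x : ℝ) : itp q q' x = itp q' q x := by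
  unfold itp
  have h1 : q'.1 - q.1 ≠ 0 := sub_ne_zero.2 h.symm
  have h2 : q.1 - q'.1 ≠ 0 := sub_ne_zero.2 h
  field_simp
  ring

theorem itp_left (q q' : ℝ × ℝ) : itp q q' q.1 = q.2 := by simp [itp]

theorem itp_right {q q' : ℝ × ℝ} (h : q.1 ≠ q'.1) : itp q q' q'.1 = q'.2 := by
  rw [itp_symm h, itp_left]

theorem up_symm (q q' y : ℝ × ℝ) : up q q' y = up q' q y := by
  unfold up
  by_cases h : q.1 = q'.1
  · rw [if_neg, if_neg] <;> rintro ⟨h1 | h1, _⟩ <;> linarith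
  · rw [itp_symm h]; congr 1; apply propext; rw [or_comm]

theorem dn_symm (q q' y : ℝ × ℝ) : dn q q' y = dn q' q y := by
  unfold dn
  by_cases h : q.1 = q'.1
  · rw [if_neg, if_neg] <;> rintro ⟨h1 | h1, _⟩ <;> linarith
  · rw [itp_symm h]; congr 1; apply propext; rw [or_comm]

theorem itp_mem {q q' : ℝ × ℝ} (h : q.1 < q'.1) {x : ℝ} (h1 : q.1 ≤ x) (h2 : x ≤ q'.1) :
    (x, itp q q' x) ∈ segment ℝ q q' := by
  have h0 : 0 < q'.1 - q.1 := by linarith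
  refine ⟨(q'.1 - x) / (q'.1 - q.1), (x - q.1) / (q'.1 - q.1), div_nonneg (by linarith) h0.le,
    div_nonneg (by linarith) h0.le, by field_simp; ring, ?_⟩
  ext
  · simp; field_simp; ring
  · simp [itp]; field_simp; ring

theorem itp_affine (q q' : ℝ × ℝ) (x1 x2 t : ℝ) :
    itp q q' (x1 + t * (x2 - x1)) = itp q q' x1 + t * (itp q q' x2 - itp q q' x1) := by
  unfold itp; ring

theorem sep {q q' y y' : ℝ × ℝ} (hq : q.1 < q'.1) (hy : y.1 < y'.1)
    (hd : Disjoint (segment ℝ q q') (segment ℝ y y')) {x1 x2 : ℝ}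
    (a1 : q.1 ≤ x1) (a2 : x1 ≤ q'.1) (a3 : y.1 ≤ x1) (a4 : x1 ≤ y'.1)
    (b1 : q.1 ≤ x2) (b2 : x2 ≤ q'.1) (b3 : y.1 ≤ x2) (b4 : x2 ≤ y'.1)
    (h : itp y y' x1 < itp q q' x1) : itp y y' x2 < itp q q' x2 := by
  by_contra hn
  push Not at hn
  set d1 := itp q q' x1 - itp y y' x1 with hd1
  set d2 := itp y y' x2 - itp q q' x2 with hd2
  have p1 : 0 < d1 := by rw [hd1]; linarith
  have p2 : 0 ≤ d2 := by rw [hd2]; linarith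
  set t := d1 / (d1 + d2) with ht
  have t0 : 0 ≤ t := by positivity
  have t1 : t ≤ 1 := by rw [ht, div_le_one (by linarith)]; linarith
  have he : itp q q' (x1 + t * (x2 - x1)) = itp y y' (x1 + t * (x2 - x1)) := by
    rw [itp_affine, itp_affine]
    have : t * (d1 + d2) = d1 := by rw [ht]; field_simp
    rw [hd1, hd2] at this
    linarith
  refine Set.disjoint_left.1 hd (itp_mem hq (x := x1 + t * (x2 - x1)) ?_ ?_) ?_
  · nlinarith
  · nlinarith
  · rw [he]; exact itp_mem hy (by nlinarith) (by nlinarith)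

theorem vert_mem {q q' : ℝ × ℝ} (h : q.1 = q'.1) {z : ℝ} (h1 : q.2 ≤ z) (h2 : z ≤ q'.2) :
    (q.1, z) ∈ segment ℝ q q' := by
  by_cases h0 : q.2 = q'.2
  · have : q = q' := Prod.ext h h0
    subst this
    have : z = q.2 := by linarith
    rw [this]; exact left_mem_segment _ _ _
  · have h0 : 0 < q'.2 - q.2 := by
      rcases lt_or_gt_of_ne h0 with h3 | h3 <;> linarith
    refine ⟨(q'.2 - z) / (q'.2 - q.2), (z - q.2) / (q'.2 - q.2), div_nonneg (by linarith) h0.le,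
      div_nonneg (by linarith) h0.le, by field_simp; ring, ?_⟩
    ext
    · simp [← h]; field_simp; ring
    · simp; field_simp; ring

theorem par_aux {q q' y y' : ℝ × ℝ} (hq : q.1 ≤ q'.1) (hy : y.1 ≤ y'.1)
    (hd : Disjoint (segment ℝ q q') (segment ℝ y y')) :
    up q q' y + up q q' y' = dn y y' q + dn y y' q' := by
  classical
  rcases hq.eq_or_lt with hq | hq <;> rcases hy.eq_or_lt with hy | hy
  · unfold up dn
    rw [if_neg, if_neg, if_neg, if_neg] <;> rintro ⟨h1 | h1, _⟩ <;> linarith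
  · have e1 : up q q' y = 0 := by unfold up; rw [if_neg]; rintro ⟨h1 | h1, _⟩ <;> linarith
    have e2 : up q q' y' = 0 := by unfold up; rw [if_neg]; rintro ⟨h1 | h1, _⟩ <;> linarith
    have e3 : dn y y' q = dn y y' q' := by
      unfold dn
      rw [← hq]
      by_cases hr : ((y.1 < q.1 ∧ q.1 ≤ y'.1) ∨ (y'.1 < q.1 ∧ q.1 ≤ y.1))
      · have hr' : y.1 < q.1 ∧ q.1 ≤ y'.1 := by
          rcases hr with h | h
          · exact h
          · linarith
        have hm := itp_mem hy hr'.1.le hr'.2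
        have h1 : itp y y' q.1 < q.2 ↔ itp y y' q.1 < q'.2 := by
          constructor
          · intro h
            by_contra hn
            push Not at hn
            refine Set.disjoint_right.1 hd hm ?_
            rw [segment_symm, hq]
            exact vert_mem hq.symm (by rw [← hq]; exact hn) (by rw [← hq]; exact h.le)
          · intro h
            by_contra hn
            push Not at hn
            exact Set.disjoint_right.1 hd hm (vert_mem hq hn h.le)
        simp [hr, h1]
      · simp [hr]
    rw [e1, e2, e3]; exact (CharTwo.add_self_eq_zero _).symm
  · have e1 : dn y y' q = 0 := by unfold dn; rw [if_neg]; rintro ⟨h1 | h1, _⟩ <;> linarith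
    have e2 : dn y y' q' = 0 := by unfold dn; rw [if_neg]; rintro ⟨h1 | h1, _⟩ <;> linarith
    have e3 : up q q' y = up q q' y' := by
      unfold up
      rw [← hy]
      by_cases hr : ((q.1 ≤ y.1 ∧ y.1 < q'.1) ∨ (q'.1 ≤ y.1 ∧ y.1 < q.1))
      · have hr' : q.1 ≤ y.1 ∧ y.1 < q'.1 := by
          rcases hr with h | h
          · exact h
          · linarith
        have hm := itp_mem hq hr'.1 hr'.2.le
        have h1 : y.2 < itp q q' y.1 ↔ y'.2 < itp q q' y.1 := by
          constructor
          · intro h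
            by_contra hn
            push Not at hn
            exact Set.disjoint_left.1 hd hm (vert_mem hy h.le hn)
          · intro h
            by_contra hn
            push Not at hn
            refine Set.disjoint_left.1 hd hm ?_
            rw [segment_symm, hy]
            exact vert_mem hy.symm (by rw [← hy]; exact h.le) (by rw [← hy]; exact hn)
        simp [hr, h1]
      · simp [hr]
    rw [e1, e2, e3]; simpa using CharTwo.add_self_eq_zero _
  · have hP : ∀ x1 x2, q.1 ≤ x1 → x1 ≤ q'.1 → y.1 ≤ x1 → x1 ≤ y'.1 →
        q.1 ≤ x2 → x2 ≤ q'.1 → y.1 ≤ x2 → x2 ≤ y'.1 → itp y y' x1 < itp q q' x1 →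
        itp y y' x2 < itp q q' x2 := fun x1 x2 a1 a2 a3 a4 b1 b2 b3 b4 h =>
          sep hq hy hd a1 a2 a3 a4 b1 b2 b3 b4 h
    have u1 : up q q' y = if (q.1 ≤ y.1 ∧ y.1 < q'.1 ∧ itp y y' y.1 < itp q q' y.1) then 1 else 0 := by
      unfold up; rw [itp_left]; congr 1; apply propext; constructor
      · rintro ⟨h | h, h'⟩
        · exact ⟨h.1, h.2, h'⟩
        · linarith
      · rintro ⟨h1, h2, h3⟩; exact ⟨Or.inl ⟨h1, h2⟩, h3⟩
    have u2 : up q q' y' = if (q.1 ≤ y'.1 ∧ y'.1 < q'.1 ∧ itp y y' y'.1 < itp q q' y'.1) then 1 else 0 := by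
      unfold up; rw [itp_right hy.ne]; congr 1; apply propext; constructor
      · rintro ⟨h | h, h'⟩
        · exact ⟨h.1, h.2, h'⟩
        · linarith
      · rintro ⟨h1, h2, h3⟩; exact ⟨Or.inl ⟨h1, h2⟩, h3⟩
    have u3 : dn y y' q = if (y.1 < q.1 ∧ q.1 ≤ y'.1 ∧ itp y y' q.1 < itp q q' q.1) then 1 else 0 := by
      unfold dn; rw [itp_left q q']; congr 1; apply propext; constructor
      · rintro ⟨h | h, h'⟩
        · exact ⟨h.1, h.2, h'⟩
        · linarith
      · rintro ⟨h1, h2, h3⟩; exact ⟨Or.inl ⟨h1, h2⟩, h3⟩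
    have u4 : dn y y' q' = if (y.1 < q'.1 ∧ q'.1 ≤ y'.1 ∧ itp y y' q'.1 < itp q q' q'.1) then 1 else 0 := by
      unfold dn; rw [itp_right hq.ne]; congr 1; apply propext; constructor
      · rintro ⟨h | h, h'⟩
        · exact ⟨h.1, h.2, h'⟩
        · linarith
      · rintro ⟨h1, h2, h3⟩; exact ⟨Or.inl ⟨h1, h2⟩, h3⟩
    rw [u1, u2, u3, u4]
    have hP' : ∀ x1 x2, q.1 ≤ x1 → x1 ≤ q'.1 → y.1 ≤ x1 → x1 ≤ y'.1 →
        q.1 ≤ x2 → x2 ≤ q'.1 → y.1 ≤ x2 → x2 ≤ y'.1 → (itp y y' x1 < itp q q' x1 ↔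
        itp y y' x2 < itp q q' x2) := fun x1 x2 a1 a2 a3 a4 b1 b2 b3 b4 =>
          ⟨hP x1 x2 a1 a2 a3 a4 b1 b2 b3 b4, hP x2 x1 b1 b2 b3 b4 a1 a2 a3 a4⟩
    clear u1 u2 u3 u4 hP
    generalize hPd : (fun x => itp y y' x < itp q q' x) = P at hP'
    have hPd' : ∀ x, (itp y y' x < itp q q' x) = P x := fun x => by rw [← hPd]
    simp only [hPd'] at hP' ⊢
    clear hPd hPd' hd
    have dbl : (1 : ZMod 2) + 1 = 0 := by decide
    rcases lt_or_ge y.1 q.1 with o1 | o1 <;> rcases lt_or_ge y.1 q'.1 with o2 | o2 <;>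
    rcases lt_or_ge y'.1 q.1 with o3 | o3 <;> rcases lt_or_ge y'.1 q'.1 with o4 | o4 <;>
    first
    | (exfalso; linarith)
    | (simp only [o1, o2, o3, o4, not_lt_of_ge, not_le_of_gt, true_and, false_and, if_false, and_true,
        lt_irrefl, o1.le, o4.le, o3.le, o2.le]
       try simp only [le_antisymm_iff]
       grind)
    | grind

theorem par {q q' y y' : ℝ × ℝ} (hd : Disjoint (segment ℝ q q') (segment ℝ y y')) :
    up q q' y + up q q' y' = dn y y' q + dn y y' q' := by
  rcases le_total q.1 q'.1 with hq | hq <;> rcases le_total y.1 y'.1 with hy | hy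
  · exact par_aux hq hy hd
  · have := par_aux hq hy (by rwa [segment_symm ℝ y' y])
    rw [dn_symm y' y, dn_symm y' y] at this
    rw [add_comm, this]
  · have := par_aux hq hy (by rwa [segment_symm ℝ q' q])
    rw [up_symm q' q, up_symm q' q] at this
    rw [this, add_comm]
  · have := par_aux hq hy (by rwa [segment_symm ℝ q' q, segment_symm ℝ y' y])
    rw [up_symm q' q, up_symm q' q, dn_symm y' y, dn_symm y' y] at this
    rw [add_comm, this, add_comm]

theorem walkW {S : ℝ × ℝ → ℝ × ℝ → Prop} {b x : ℝ × ℝ} (h : Relation.ReflTransGen S b x) :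
    ∃ W : ℝ × ℝ → ZMod 2, ∀ y y', (∀ q q', S q q' → Disjoint (segment ℝ q q') (segment ℝ y y')) →
      W y + W y' = dn y y' b + dn y y' x := by
  induction h with
  | refl => exact ⟨0, fun y y' _ => by simpa using (CharTwo.add_self_eq_zero _).symm⟩
  | @tail x x' _ hs ih =>
    obtain ⟨W, hW⟩ := ih
    refine ⟨fun y => W y + up x x' y, fun y y' hd => ?_⟩
    have h1 := hW y y' hd
    have h2 := par (hd _ _ hs)
    have h3 : dn y y' x + dn y y' x = 0 := CharTwo.add_self_eq_zero _
    linear_combination h1 + h2 + h3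

theorem planar_contra {S P : ℝ × ℝ → ℝ × ℝ → Prop} {a b x c d m1 m2 : ℝ × ℝ}
    (hS : Relation.ReflTransGen S b x) (hP : Relation.ReflTransGen P c d)
    (h1 : ∀ p p', P p p' → (∀ q q', S q q' → Disjoint (segment ℝ q q') (segment ℝ p p')) ∧
      Disjoint (segment ℝ x a) (segment ℝ p p') ∧ Disjoint (segment ℝ a b) (segment ℝ p p'))
    (h2 : (∀ q q', S q q' → Disjoint (segment ℝ q q') (segment ℝ c m1)) ∧
      Disjoint (segment ℝ x a) (segment ℝ c m1) ∧ Disjoint (segment ℝ a b) (segment ℝ c m1))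
    (h3 : (∀ q q', S q q' → Disjoint (segment ℝ q q') (segment ℝ d m2)) ∧
      Disjoint (segment ℝ x a) (segment ℝ d m2) ∧ Disjoint (segment ℝ a b) (segment ℝ d m2))
    (h4 : (∀ q q', S q q' → Disjoint (segment ℝ q q') (segment ℝ m1 m2)) ∧
      Disjoint (segment ℝ x a) (segment ℝ m1 m2))
    (h5 : up a b m1 + up a b m2 = dn m1 m2 a + dn m1 m2 b + 1) : False := by
  obtain ⟨W, hW⟩ := walkW hS
  have two : ∀ z : ZMod 2, z + z = 0 := fun z => CharTwo.add_self_eq_zero _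
  have key : ∀ p p', ((∀ q q', S q q' → Disjoint (segment ℝ q q') (segment ℝ p p')) ∧
      Disjoint (segment ℝ x a) (segment ℝ p p') ∧ Disjoint (segment ℝ a b) (segment ℝ p p')) →
      W p + up x a p + up a b p = W p' + up x a p' + up a b p' := by
    rintro p p' ⟨k1, k2, k3⟩
    linear_combination hW _ _ k1 + par k2 + par k3 + two (dn p p' x) + two (dn p p' a)
      + two (dn p p' b) - two (W p') - two (up x a p') - two (up a b p')
  have hcd : W c + up x a c + up a b c = W d + up x a d + up a b d := by
    clear h2 h3
    induction hP with
    | refl => rfl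
    | tail _ hs ih => rw [ih, key _ _ (h1 _ _ hs)]
  have e1 := key _ _ h2
  have e2 := key _ _ h3
  have e3 := hW _ _ h4.1
  have e4 := par h4.2
  have : (1 : ZMod 2) = 0 := by
    linear_combination hcd - e1 + e2 - e3 - e4 - h5 - two (dn m1 m2 a) - two (dn m1 m2 b)
     - two (dn m1 m2 x) + two (W m2) + two (up x a m2) + two (up a b m2)
  exact absurd this (by decide)

set_option maxHeartbeats 1000000 in
theorem cross_exists {A B C D : ℝ × ℝ} (h : orn A B C * orn A B D < 0) :
    ∃ m1 m2 : ℝ × ℝ, m1 ∈ convexHull ℝ {A, B, C} ∧ m2 ∈ convexHull ℝ {A, B, D} ∧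
      0 < orn A B m1 * orn A B C ∧ 0 < orn A B m2 * orn A B D ∧
      segment ℝ m1 m2 ⊆ convexHull ℝ {A, B, C} ∪ convexHull ℝ {A, B, D} ∧
      A ∉ segment ℝ m1 m2 ∧ B ∉ segment ℝ m1 m2 ∧
      up A B m1 + up A B m2 = dn m1 m2 A + dn m1 m2 B + 1 := by
  have hC : orn A B C ≠ 0 := by rintro h0; simp [h0] at h
  have hD : orn A B D ≠ 0 := by rintro h0; simp [h0] at h
  set m : ℝ × ℝ := ((A.1 + B.1) / 2, (A.2 + B.2) / 2) with hm
  have hmo : m ∈ openSegment ℝ A B := ⟨1/2, 1/2, by norm_num, by norm_num, by norm_num, by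
    ext <;> simp [hm] <;> ring⟩
  have hn := (edge_nhds_half hC hmo).and ((edge_nhds_half hD hmo).and (edge_nhds h hmo))
  obtain ⟨ε, hε, hball⟩ := Metric.eventually_nhds_iff_ball.1 hn
  -- it suffices to find a good direction
  have main : ∀ v : ℝ × ℝ, ‖v‖ < ε → orn A B (m + v) ≠ 0 → orn A B (m - v) = - orn A B (m + v) →
      A ∉ segment ℝ (m + v) (m - v) → B ∉ segment ℝ (m + v) (m - v) →
      up A B (m + v) + up A B (m - v) = dn (m + v) (m - v) A + dn (m + v) (m - v) B + 1 →
      ∃ m1 m2 : ℝ × ℝ, m1 ∈ convexHull ℝ {A, B, C} ∧ m2 ∈ convexHull ℝ {A, B, D} ∧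
      0 < orn A B m1 * orn A B C ∧ 0 < orn A B m2 * orn A B D ∧
      segment ℝ m1 m2 ⊆ convexHull ℝ {A, B, C} ∪ convexHull ℝ {A, B, D} ∧
      A ∉ segment ℝ m1 m2 ∧ B ∉ segment ℝ m1 m2 ∧
      up A B m1 + up A B m2 = dn m1 m2 A + dn m1 m2 B + 1 := by
    intro v hv h0 h1 h2 h3 h4
    have b1 : m + v ∈ Metric.ball m ε := by simpa [dist_eq_norm] using hv
    have b2 : m - v ∈ Metric.ball m ε := by simpa [dist_eq_norm] using hv
    have hs : segment ℝ (m + v) (m - v) ⊆ convexHull ℝ {A, B, C} ∪ convexHull ℝ {A, B, D} :=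
      fun z hz => (hball z ((convex_ball m ε).segment_subset b1 b2 hz)).2.2
    rcases lt_or_gt_of_ne (mul_ne_zero h0 hC) with hp | hp
    · have p1 : 0 < orn A B (m - v) * orn A B C := by rw [h1]; linarith
      have p2 : 0 < orn A B (m + v) * orn A B D := by
        by_contra hh
        push Not at hh
        have : 0 < (orn A B (m + v) * orn A B C) * (orn A B C * orn A B D) := mul_pos_of_neg_of_neg hp h
        have e : (orn A B (m + v) * orn A B C) * (orn A B C * orn A B D) =
          (orn A B (m + v) * orn A B D) * (orn A B C)^2 := by ring
        rw [e] at this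
        nlinarith [sq_nonneg (orn A B C)]
      refine ⟨m - v, m + v, (hball _ b2).1 p1.le, (hball _ b1).2.1 p2.le, p1, p2, ?_, ?_, ?_, ?_⟩
      · rwa [segment_symm]
      · rwa [segment_symm]
      · rwa [segment_symm]
      · rw [add_comm, h4, dn_symm, dn_symm _ _ B]
    · have p2 : 0 < orn A B (m - v) * orn A B D := by
        rw [h1]
        by_contra hh
        push Not at hh
        have : (orn A B (m + v) * orn A B C) * (orn A B C * orn A B D) < 0 := mul_neg_of_pos_of_neg hp h
        have e : (orn A B (m + v) * orn A B C) * (orn A B C * orn A B D) =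
          (orn A B (m + v) * orn A B D) * (orn A B C)^2 := by ring
        rw [e] at this
        nlinarith [sq_nonneg (orn A B C)]
      exact ⟨m + v, m - v, (hball _ b1).1 hp.le, (hball _ b2).2.1 p2.le, hp, p2, hs, h2, h3, h4⟩
  have fst_seg : ∀ (v z : ℝ × ℝ), v.1 = 0 → z ∈ segment ℝ (m + v) (m - v) → z.1 = m.1 := by
    rintro v z hv ⟨s, t, _, _, hst, rfl⟩
    simp [hv, ← add_mul, hst]
  have snd_seg : ∀ (v z : ℝ × ℝ), v.2 = 0 → z ∈ segment ℝ (m + v) (m - v) → z.2 = m.2 := by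
    rintro v z hv ⟨s, t, _, _, hst, rfl⟩
    simp [hv, ← add_mul, hst]
  by_cases hx : A.1 = B.1
  · have hy : A.2 ≠ B.2 := by
      intro hy
      exact hC (by unfold orn; rw [hx, hy]; ring)
    refine main (ε / 2, 0) ?_ ?_ ?_ ?_ ?_ ?_
    · simp [Prod.norm_def, abs_of_pos hε]; linarith
    · simp only [orn, hm, hx, Prod.fst_add, Prod.snd_add]
      have : (B.2 - A.2) ≠ 0 := sub_ne_zero.2 hy.symm
      intro h0
      exact mul_ne_zero this hε.ne' (by linarith)
    · simp only [orn, hm, hx, Prod.fst_add, Prod.snd_add, Prod.fst_sub, Prod.snd_sub]; ring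
    · intro h0
      have := snd_seg _ _ rfl h0
      simp only [hm] at this
      exact hy (by linarith)
    · intro h0
      have := snd_seg _ _ rfl h0
      simp only [hm] at this
      exact hy (by linarith)
    · have u0 : ∀ y, up A B y = 0 := by
        intro y; unfold up; rw [if_neg]; rintro ⟨h1 | h1, _⟩ <;> linarith
      have e : ∀ x, itp (m + (ε / 2, 0)) (m - (ε / 2, 0)) x = m.2 := by
        intro x; simp [itp]
      have dd : ∀ q : ℝ × ℝ, q.1 = A.1 → dn (m + (ε / 2, 0)) (m - (ε / 2, 0)) q = 
          if m.2 < q.2 then 1 else 0 := by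
        intro q hq
        unfold dn
        rw [e]
        congr 1; apply propext
        constructor
        · exact fun h => h.2
        · intro h
          refine ⟨Or.inr ?_, h⟩
          simp only [hm, hq, hx, Prod.fst_add, Prod.fst_sub]
          constructor <;> linarith
      rw [u0, u0, dd A rfl, dd B hx.symm]
      rcases lt_or_gt_of_ne hy with h1 | h1
      · rw [if_neg, if_pos]
        · decide
        · simp only [hm]; linarith
        · simp only [hm]; linarith
      · rw [if_pos, if_neg]
        · decide
        · simp only [hm]; linarith
        · simp only [hm]; linarith
  · refine main (0, ε / 2) ?_ ?_ ?_ ?_ ?_ ?_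
    · simp [Prod.norm_def, abs_of_pos hε]; linarith
    · simp only [orn, hm, Prod.fst_add, Prod.snd_add]
      have : (B.1 - A.1) ≠ 0 := sub_ne_zero.2 (Ne.symm hx)
      intro h0
      exact mul_ne_zero this hε.ne' (by linarith)
    · simp only [orn, hm, Prod.fst_add, Prod.snd_add, Prod.fst_sub, Prod.snd_sub]; ring
    · intro h0
      have := fst_seg _ _ rfl h0
      simp only [hm] at this
      exact hx (by linarith)
    · intro h0
      have := fst_seg _ _ rfl h0
      simp only [hm] at this
      exact hx (by linarith)
    · have u0 : ∀ y, dn (m + (0, ε / 2)) (m - (0, ε / 2)) y = 0 := by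
        intro y; unfold dn; rw [if_neg]; rintro ⟨h1 | h1, _⟩ <;> (simp at h1; linarith)
      have e : itp A B m.1 = m.2 := by
        have : (B.1 - A.1) ≠ 0 := sub_ne_zero.2 (Ne.symm hx)
        simp only [itp, hm]; field_simp; ring
      have uu : ∀ q : ℝ × ℝ, q.1 = m.1 → up A B q = if q.2 < m.2 then 1 else 0 := by
        intro q hq
        unfold up
        rw [hq, e]
        congr 1; apply propext
        constructor
        · exact fun h => h.2
        · intro h
          refine ⟨?_, h⟩
          simp only [hm]
          rcases lt_or_gt_of_ne hx with h1 | h1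
          · left; constructor <;> linarith
          · right; constructor <;> linarith
      rw [u0, u0, uu _ (by simp), uu _ (by simp), if_neg, if_pos]
      · decide
      · simp [hε]
      · simp; linarith

end EX

namespace EX

variable {ι : Type} [Fintype ι] [DecidableEq ι]
variable {D : TriDisk ι}

/-- dot product in the plane -/
def dt (l p : ℝ × ℝ) : ℝ := l.1 * p.1 + l.2 * p.2

theorem dt_add (l p q : ℝ × ℝ) : dt l (p + q) = dt l p + dt l q := by simp [dt]; ring
theorem dt_sub (l p q : ℝ × ℝ) : dt l (p - q) = dt l p - dt l q := by simp [dt]; ring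
theorem dt_smul (l p : ℝ × ℝ) (c : ℝ) : dt l (c • p) = c * dt l p := by simp [dt]; ring
theorem dt_neg (l p : ℝ × ℝ) : dt (-l) p = - dt l p := by simp [dt]; ring
theorem dt_cont (l : ℝ × ℝ) : Continuous (dt l) := by unfold dt; fun_prop
theorem dt_self_pos {l : ℝ × ℝ} (h : l ≠ 0) : 0 < dt l l := by
  unfold dt
  by_contra hn
  push Not at hn
  apply h
  ext
  · simp; nlinarith [sq_nonneg l.1, sq_nonneg l.2]
  · simp; nlinarith [sq_nonneg l.1, sq_nonneg l.2]
theorem dt_sum {κ : Type} (s : Finset κ) (l : ℝ × ℝ) (g : κ → ℝ × ℝ) :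
    dt l (∑ i ∈ s, g i) = ∑ i ∈ s, dt l (g i) := by
  classical
  induction s using Finset.induction_on with
  | empty => simp [dt]
  | insert a s ha ih => rw [Finset.sum_insert ha, Finset.sum_insert ha, dt_add, ih]

theorem support {C : Set (ℝ × ℝ)} (hC : Convex ℝ C) (hi : (interior C).Nonempty) {y : ℝ × ℝ}
    (hy : y ∉ interior C) : ∃ l : ℝ × ℝ, l ≠ 0 ∧ ∀ b ∈ C, dt l y ≤ dt l b := by
  obtain ⟨g, hg⟩ := geometric_hahn_banach_point_open hC.interior isOpen_interior hy
  have hgd : ∀ p, g p = dt (g (1, 0), g (0, 1)) p := by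
    intro p
    have : p = p.1 • ((1 : ℝ), (0 : ℝ)) + p.2 • ((0 : ℝ), (1 : ℝ)) := by ext <;> simp
    conv_lhs => rw [this]
    rw [map_add, map_smul, map_smul]; simp [dt]; ring
  refine ⟨(g (1, 0), g (0, 1)), ?_, ?_⟩
  · intro h0
    obtain ⟨b, hb⟩ := hi
    have := hg b hb
    rw [hgd, hgd b, h0] at this
    simp [dt] at this
  · intro b hb
    have hcl : b ∈ closure (interior C) := by
      rw [hC.closure_interior_eq_closure_of_nonempty_interior hi]; exact subset_closure hb
    rw [← hgd, ← hgd]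
    have hsub : closure (interior C) ⊆ {b | g y ≤ g b} :=
      closure_minimal (fun b hb => (hg b hb).le) (isClosed_le continuous_const g.continuous)
    exact hsub hcl

/-- a point of `C` minimizing a nonzero functional is not interior -/
theorem not_interior_of_min {C : Set (ℝ × ℝ)} {l y : ℝ × ℝ} (hl : l ≠ 0)
    (h : ∀ b ∈ C, dt l y ≤ dt l b) : y ∉ interior C := by
  intro hy
  rw [mem_interior_iff_mem_nhds] at hy
  have ht : Filter.Tendsto (fun t : ℝ => y - t • l) (nhds 0) (nhds y) := by
    have : Continuous (fun t : ℝ => y - t • l) := by fun_prop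
    simpa using this.tendsto 0
  obtain ⟨t, ht1, ht2⟩ := ((Filter.Eventually.filter_mono nhdsWithin_le_nhds (ht.eventually hy)).and
    (self_mem_nhdsWithin : Set.Ioi (0 : ℝ) ∈ nhdsWithin 0 (Set.Ioi 0))).exists
  have := h _ ht1
  rw [dt_sub, dt_smul] at this
  have := mul_pos ht2 (dt_self_pos hl)
  linarith

theorem mid_not {C : Set (ℝ × ℝ)} {l x y z : ℝ × ℝ} (hl : l ≠ 0) (hy : y ∈ Set.extremePoints ℝ C)
    (hx : x ∈ C) (hz : z ∈ C) (h1 : dt l x = dt l y) (h2 : dt l y = dt l z)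
    (h3 : dt (-l.2, l.1) x < dt (-l.2, l.1) y) (h4 : dt (-l.2, l.1) y < dt (-l.2, l.1) z) : False := by
  have hp := dt_self_pos hl
  have inj : ∀ p q : ℝ × ℝ, dt l p = dt l q → dt (-l.2, l.1) p = dt (-l.2, l.1) q → p = q := by
    intro p q e1 e2
    simp only [dt] at e1 e2 hp
    have a1 : (l.1 * l.1 + l.2 * l.2) * (p.1 - q.1) = 0 := by linear_combination l.1 * e1 - l.2 * e2
    have a2 : (l.1 * l.1 + l.2 * l.2) * (p.2 - q.2) = 0 := by linear_combination l.2 * e1 + l.1 * e2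
    ext
    · have := (mul_eq_zero.1 a1).resolve_left hp.ne'; linarith
    · have := (mul_eq_zero.1 a2).resolve_left hp.ne'; linarith
  set m : ℝ × ℝ := (-l.2, l.1) with hm
  set s := (dt m y - dt m x) / (dt m z - dt m x) with hs
  have hd : 0 < dt m z - dt m x := by linarith
  have s0 : 0 < s := div_pos (by linarith) hd
  have s1 : s < 1 := by rw [hs, div_lt_one hd]; linarith
  have hsd : s * (dt m z - dt m x) = dt m y - dt m x := by rw [hs]; field_simp
  have hyo : y ∈ openSegment ℝ x z := by
    refine ⟨1 - s, s, by linarith, s0, by ring, ?_⟩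
    apply inj
    · rw [dt_add, dt_smul, dt_smul]; rw [h1, ← h2]; ring
    · rw [dt_add, dt_smul, dt_smul]; linear_combination hsd
  have := (mem_extremePoints.1 hy).2 x hx z hz hyo
  rw [this.1] at h3
  exact lt_irrefl _ h3

theorem ext3 {C : Set (ℝ × ℝ)} {l x y z : ℝ × ℝ} (hl : l ≠ 0) (hx : x ∈ Set.extremePoints ℝ C)
    (hy : y ∈ Set.extremePoints ℝ C) (hz : z ∈ Set.extremePoints ℝ C)
    (h1 : dt l x = dt l y) (h2 : dt l x = dt l z) (hxy : x ≠ y) (hxz : x ≠ z) (hyz : y ≠ z) : False := by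
  have hp := dt_self_pos hl
  have inj : ∀ p q : ℝ × ℝ, p ≠ q → dt l p = dt l q → dt (-l.2, l.1) p ≠ dt (-l.2, l.1) q := by
    intro p q hne e1 e2
    apply hne
    simp only [dt] at e1 e2 hp
    have a1 : (l.1 * l.1 + l.2 * l.2) * (p.1 - q.1) = 0 := by linear_combination l.1 * e1 - l.2 * e2
    have a2 : (l.1 * l.1 + l.2 * l.2) * (p.2 - q.2) = 0 := by linear_combination l.2 * e1 + l.1 * e2
    ext
    · have := (mul_eq_zero.1 a1).resolve_left hp.ne'; linarith
    · have := (mul_eq_zero.1 a2).resolve_left hp.ne'; linarith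
  have i1 := inj _ _ hxy h1
  have i2 := inj _ _ hxz h2
  have i3 := inj _ _ hyz (h1.symm.trans h2)
  have key := fun {x y z : ℝ × ℝ} => @mid_not C l x y z hl
  rcases lt_or_gt_of_ne i1 with j1 | j1 <;> rcases lt_or_gt_of_ne i2 with j2 | j2 <;>
    rcases lt_or_gt_of_ne i3 with j3 | j3
  · exact key hy hx.1 hz.1 (by linarith) (by linarith) j1 j3
  · exact key hz hx.1 hy.1 (by linarith) (by linarith) j2 j3
  · linarith
  · exact key hx hz.1 hy.1 (by linarith) (by linarith) j2 j1
  · exact key hx hy.1 hz.1 (by linarith) (by linarith) j1 j2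
  · linarith
  · exact key hz hy.1 hx.1 (by linarith) (by linarith) j3 j2
  · exact key hy hz.1 hx.1 (by linarith) (by linarith) j3 j1

theorem sub_of_avoid {U C : Set (ℝ × ℝ)} (hU : IsPreconnected U) (hC : IsClosed C)
    (h : ∀ y ∈ U, y ∉ frontier C) (hm : (U ∩ C).Nonempty) : U ⊆ C := by
  intro y hy
  by_contra hyC
  have hin : ∀ z ∈ U, z ∈ C → z ∈ interior C := by
    intro z hz hzC
    by_contra hn
    exact h z hz ⟨subset_closure hzC, hn⟩
  obtain ⟨p, hp1, hp2⟩ := hm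
  obtain ⟨z, hz, hz1, hz2⟩ := hU (interior C) Cᶜ isOpen_interior hC.isOpen_compl
    (fun z hz => by
      by_cases hzC : z ∈ C
      · exact Or.inl (hin z hz hzC)
      · exact Or.inr hzC) ⟨p, hp1, hin p hp1 hp2⟩ ⟨y, hy, hyC⟩
  exact hz2 (interior_subset hz1)

/-- the hypotheses of the theorem -/
structure Hyp (D : TriDisk ι) (f : ℝ × ℝ → ℝ × ℝ) (C : Set (ℝ × ℝ)) : Prop where
  sl : D.SLOnBoundary f
  inj : Set.InjOn f (frontier D.space)
  conv : Convex ℝ C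
  cpt : IsCompact C
  int : (interior C).Nonempty
  img : f '' frontier D.space = frontier C
  ext : ∀ i : ι, D.pos i ∈ frontier D.space → f (D.pos i) ∈ Set.extremePoints ℝ C

/-- boundary vertices -/
def bd (D : TriDisk ι) (v : ι) : Prop := D.pos v ∈ frontier D.space

variable {f : ℝ × ℝ → ℝ × ℝ} {C : Set (ℝ × ℝ)}

theorem bdl {a b : ι} (h : D.IsBoundaryEdge a b) : bd D a := h.2 (left_mem_segment _ _ _)
theorem bdr {a b : ι} (h : D.IsBoundaryEdge a b) : bd D b := h.2 (right_mem_segment _ _ _)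
theorem be_symm {a b : ι} (h : D.IsBoundaryEdge a b) : D.IsBoundaryEdge b a :=
  ⟨isEdge_iff.2 (isEdge_iff.1 h.1).symm, by rw [segment_symm]; exact h.2⟩
theorem be_E {a b : ι} (h : D.IsBoundaryEdge a b) : E D a b := isEdge_iff.1 h.1

namespace Hyp

theorem f_inj (H : Hyp D f C) {a b : ι} (ha : bd D a) (hb : bd D b) (h : a ≠ b) :
    f (D.pos a) ≠ f (D.pos b) := fun he => h (D.inj (H.inj ha hb he))

theorem combo (H : Hyp D f C) {a b : ι} (h : D.IsBoundaryEdge a b) {s t : ℝ} (hs : 0 ≤ s) (ht : 0 ≤ t)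
    (hst : s + t = 1) :
    f (s • D.pos a + t • D.pos b) = s • f (D.pos a) + t • f (D.pos b) := by
  obtain ⟨g, hg⟩ := H.sl a b h
  rw [hg ⟨s, t, hs, ht, hst, rfl⟩, hg (left_mem_segment _ _ _), hg (right_mem_segment _ _ _)]
  exact Convex.combo_affine_apply hst

theorem front_sub (H : Hyp D f C) : frontier C ⊆ C := H.cpt.isClosed.frontier_subset

theorem mem_front (H : Hyp D f C) {v : ι} (hv : bd D v) : f (D.pos v) ∈ frontier C := by
  rw [← H.img]; exact ⟨_, hv, rfl⟩

theorem mem (H : Hyp D f C) {v : ι} (hv : bd D v) : f (D.pos v) ∈ C := (H.ext v hv).1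

/-- classification of the points of the frontier of `C` -/
theorem cases (H : Hyp D f C) {y : ℝ × ℝ} (hy : y ∈ frontier C) :
    (∃ v, bd D v ∧ y = f (D.pos v)) ∨ ∃ a b, D.IsBoundaryEdge a b ∧
      y ∈ openSegment ℝ (f (D.pos a)) (f (D.pos b)) := by
  rw [← H.img] at hy
  obtain ⟨x, hx, rfl⟩ := hy
  rcases frontier_cases hx with ⟨v, rfl, _⟩ | ⟨a, b, hab, hx'⟩
  · exact Or.inl ⟨v, hx, rfl⟩
  · refine Or.inr ⟨a, b, hab, ?_⟩
    obtain ⟨s, t, hs, ht, hst, rfl⟩ := hx'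
    exact ⟨s, t, hs, ht, hst, (H.combo hab hs.le ht.le hst).symm⟩

theorem used (H : Hyp D f C) {v : ι} (hv : bd D v) : ∃ w, E D v w := by
  rcases frontier_cases hv with ⟨w, h, h'⟩ | ⟨a, b, hab, hx'⟩
  · rw [D.inj h]; exact h'
  · exfalso
    obtain ⟨s, t, hs, ht, hst, h⟩ := hx'
    have h1 := H.combo hab hs.le ht.le hst
    have h2 := (mem_extremePoints.1 (H.ext v hv)).2 _ (H.mem (bdl hab)) _ (H.mem (bdr hab))
      ⟨s, t, hs, ht, hst, by rw [← h1, h]⟩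
    exact H.f_inj (bdl hab) (bdr hab) (be_E hab).ne (h2.1.trans h2.2.symm)

theorem descend (H : Hyp D f C) {r : ι} (hr : bd D r) {l p : ℝ × ℝ} (hp : p ∈ C)
    (hlt : dt l p < dt l (f (D.pos r))) :
    ∃ r', D.IsBoundaryEdge r r' ∧ dt l (f (D.pos r')) < dt l (f (D.pos r)) := by
  classical
  by_contra hno
  push Not at hno
  set v := f (D.pos r) with hv
  have hve := H.ext r hr
  set Z : Set (ℝ × ℝ) := (⋃ e ∈ {e : ι × ι | D.IsBoundaryEdge e.1 e.2 ∧ e.1 ≠ r ∧ e.2 ≠ r},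
    segment ℝ (f (D.pos e.1)) (f (D.pos e.2))) ∪ (fun i => f (D.pos i)) '' {i | bd D i ∧ i ≠ r} with hZ
  have segclosed : ∀ x y : ℝ × ℝ, IsClosed (segment ℝ x y) := by
    intro x y
    rw [← convexHull_pair]
    exact ((Set.toFinite {x, y}).isCompact_convexHull (𝕜 := ℝ)).isClosed
  have hZc : IsClosed Z := by
    apply IsClosed.union
    · exact Set.Finite.isClosed_biUnion (Set.toFinite _) (fun e _ => segclosed _ _)
    · exact (Set.toFinite _).isClosed
  have hvZ : v ∉ Z := by
    rintro (h | ⟨i, ⟨hi, hir⟩, he⟩)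
    · simp only [Set.mem_iUnion] at h
      obtain ⟨⟨a, b⟩, ⟨hab, ha, hb⟩, h⟩ := h
      have := (mem_extremePoints_iff_left.1 hve).2
      rw [← insert_endpoints_openSegment] at h
      rcases h with h | h | h
      · exact H.f_inj hr (bdl hab) ha.symm h
      · exact H.f_inj hr (bdr hab) hb.symm h
      · have h2 := (mem_extremePoints.1 hve).2 _ (H.mem (bdl hab)) _ (H.mem (bdr hab)) h
        exact H.f_inj (bdl hab) (bdr hab) (be_E hab).ne (h2.1.trans h2.2.symm)
    · exact H.f_inj hi hr hir he
  obtain ⟨ε, hε, hball⟩ := Metric.isOpen_iff.1 hZc.isOpen_compl v hvZ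
  set U : Set (ℝ × ℝ) := Metric.ball v ε ∩ {y | dt l y < dt l v} with hU
  have hUconv : Convex ℝ U := by
    refine (convex_ball v ε).inter ?_
    intro x hx y hy s t hs ht hst
    simp only [Set.mem_setOf_eq] at hx hy ⊢
    rw [dt_add, dt_smul, dt_smul]
    rcases hs.eq_or_lt with h0 | h0
    · have : t = 1 := by linarith
      rw [← h0, this]; linarith
    · have k1 := mul_lt_mul_of_pos_left hx h0
      have k2 := mul_le_mul_of_nonneg_left hy.le ht
      have k3 : s * dt l v + t * dt l v = dt l v := by rw [← add_mul, hst, one_mul]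
      linarith
  have hUf : ∀ y ∈ U, y ∉ frontier C := by
    rintro y ⟨hy1, hy2⟩ hy
    have hyZ : y ∉ Z := hball hy1
    simp only [Set.mem_setOf_eq] at hy2
    rcases H.cases hy with ⟨w, hw, rfl⟩ | ⟨a, b, hab, hy'⟩
    · by_cases hwr : w = r
      · subst hwr; exact lt_irrefl _ hy2
      · exact hyZ (Or.inr ⟨w, ⟨hw, hwr⟩, rfl⟩)
    · have aux : ∀ r', D.IsBoundaryEdge r r' → y ∈ openSegment ℝ v (f (D.pos r')) → False := by
        rintro r' hr' ⟨s, t, hs, ht, hst, rfl⟩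
        rw [dt_add, dt_smul, dt_smul] at hy2
        have := hno r' hr'
        have e : s = 1 - t := by linarith
        rw [e] at hy2
        nlinarith
      by_cases ha : a = r
      · subst ha; exact aux b hab hy'
      by_cases hb : b = r
      · subst hb; exact aux a (be_symm hab) (by rwa [openSegment_symm])
      exact hyZ (Or.inl (Set.mem_biUnion (x := (a, b)) ⟨hab, ha, hb⟩ (openSegment_subset_segment _ _ _ hy')))
  have hmeet : (U ∩ C).Nonempty := by
    have ht : Filter.Tendsto (fun t : ℝ => (1 - t) • v + t • p) (nhdsWithin 0 (Set.Ioi 0)) (nhds v) := by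
      have : Continuous (fun t : ℝ => (1 - t) • v + t • p) := by fun_prop
      have h0 := this.tendsto 0
      simp only [sub_zero, one_smul, zero_smul, add_zero] at h0
      exact h0.mono_left nhdsWithin_le_nhds
    have e1 := ht.eventually (Metric.ball_mem_nhds v hε)
    have e2 : ∀ᶠ t : ℝ in nhdsWithin 0 (Set.Ioi 0), 0 < t := self_mem_nhdsWithin
    have e3 : ∀ᶠ t : ℝ in nhdsWithin 0 (Set.Ioi 0), t < 1 :=
      Filter.Eventually.filter_mono nhdsWithin_le_nhds (gt_mem_nhds one_pos)
    obtain ⟨t, h1, h2, h3⟩ := (e1.and (e2.and e3)).exists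
    refine ⟨_, ⟨h1, ?_⟩, H.conv (H.mem hr) hp (by linarith) h2.le (by ring)⟩
    simp only [Set.mem_setOf_eq, dt_add, dt_smul]
    nlinarith
  have hUC : U ⊆ C := by
    intro y hy
    by_contra hyC
    exact hyC (sub_of_avoid hUconv.isPreconnected H.cpt.isClosed hUf hmeet hy)
  have hl : l ≠ 0 := by
    rintro rfl; simp [dt] at hlt
  have hclose : ∀ w : ℝ × ℝ, dt l w = 0 → ‖w‖ < ε → v + w ∈ C := by
    intro w hw0 hw
    have ht : Filter.Tendsto (fun t : ℝ => v + w - t • l) (nhdsWithin 0 (Set.Ioi 0)) (nhds (v + w)) := by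
      have : Continuous (fun t : ℝ => v + w - t • l) := by fun_prop
      have h0 := this.tendsto 0
      simp only [sub_zero, zero_smul] at h0
      exact h0.mono_left nhdsWithin_le_nhds
    refine H.cpt.isClosed.mem_of_tendsto ht ?_
    have hb : v + w ∈ Metric.ball v ε := by simpa [dist_eq_norm] using hw
    filter_upwards [ht.eventually (Metric.isOpen_ball.mem_nhds hb), self_mem_nhdsWithin] with t h1 h2
    refine hUC ⟨h1, ?_⟩
    simp only [Set.mem_setOf_eq, dt_add, dt_sub, dt_smul, hw0]
    have := mul_pos h2 (dt_self_pos hl)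
    linarith
  set w0 : ℝ × ℝ := (-l.2, l.1) with hw0
  have hw0n : 0 < ‖w0‖ := by
    rw [norm_pos_iff]
    intro h
    apply hl
    have h1 := congrArg Prod.fst h
    have h2 := congrArg Prod.snd h
    simp [hw0] at h1 h2
    ext <;> simp [h1, h2]
  have hn : ‖(ε / (2 * ‖w0‖)) • w0‖ < ε := by
    rw [norm_smul, Real.norm_of_nonneg (by positivity)]
    field_simp; linarith
  have hd : dt l ((ε / (2 * ‖w0‖)) • w0) = 0 := by
    rw [dt_smul]; simp [hw0, dt]; right; ring
  have c1 := hclose _ hd hn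
  have c2 := hclose (-((ε / (2 * ‖w0‖)) • w0)) (by rw [← neg_one_smul ℝ, dt_smul, hd]; ring) (by rwa [norm_neg])
  have := (mem_extremePoints.1 hve).2 _ c1 _ c2 ⟨1/2, 1/2, by norm_num, by norm_num, by norm_num, by
    rw [← smul_add]; ext <;> simp <;> ring⟩
  have h3 : (ε / (2 * ‖w0‖)) • w0 = 0 := add_eq_left.1 this.1
  rw [smul_eq_zero] at h3
  rcases h3 with h3 | h3
  · have : 0 < ε / (2 * ‖w0‖) := by positivity
    linarith
  · rw [h3] at hw0n; simp at hw0n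

theorem face_edge (H : Hyp D f C) {a b : ι} (ha : bd D a) (hb : bd D b) (hab : a ≠ b) {l : ℝ × ℝ}
    (hl : l ≠ 0) (h1 : ∀ p ∈ C, dt l (f (D.pos a)) ≤ dt l p)
    (h2 : ∀ p ∈ C, dt l (f (D.pos b)) ≤ dt l p) : D.IsBoundaryEdge a b := by
  have he : dt l (f (D.pos a)) = dt l (f (D.pos b)) := le_antisymm (h1 _ (H.mem hb)) (h2 _ (H.mem ha))
  set m : ℝ × ℝ := (1/2 : ℝ) • f (D.pos a) + (1/2 : ℝ) • f (D.pos b) with hm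
  have hmo : m ∈ openSegment ℝ (f (D.pos a)) (f (D.pos b)) :=
    ⟨1/2, 1/2, by norm_num, by norm_num, by norm_num, rfl⟩
  have hmC : m ∈ C := H.conv (H.mem ha) (H.mem hb) (by norm_num) (by norm_num) (by norm_num)
  have hdm : dt l m = dt l (f (D.pos a)) := by rw [hm, dt_add, dt_smul, dt_smul, he]; ring
  have hmf : m ∈ frontier C := by
    refine ⟨subset_closure hmC, not_interior_of_min hl ?_⟩
    intro b hb; rw [hdm]; exact h1 b hb
  rcases H.cases hmf with ⟨v, hv, hmv⟩ | ⟨p, q, hpq, hx⟩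
  · exfalso
    have := (mem_extremePoints.1 (H.ext v hv)).2 _ (H.mem ha) _ (H.mem hb) (hmv ▸ hmo)
    exact H.f_inj ha hb hab (this.1.trans this.2.symm)
  · obtain ⟨s, t, hs, ht, hst, hx⟩ := hx
    have k1 := h1 _ (H.mem (bdl hpq))
    have k2 := h1 _ (H.mem (bdr hpq))
    have k3 : s * dt l (f (D.pos p)) + t * dt l (f (D.pos q)) = dt l (f (D.pos a)) := by
      rw [← hdm, ← hx, dt_add, dt_smul, dt_smul]
    have e : s * dt l (f (D.pos a)) + t * dt l (f (D.pos a)) = dt l (f (D.pos a)) := by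
      rw [← add_mul, hst, one_mul]
    have e1 := mul_le_mul_of_nonneg_left k1 hs.le
    have e2 := mul_le_mul_of_nonneg_left k2 ht.le
    have k4 : dt l (f (D.pos p)) = dt l (f (D.pos a)) := by
      refine le_antisymm ?_ k1
      by_contra hn; push Not at hn
      have := mul_lt_mul_of_pos_left hn hs
      linarith
    have k5 : dt l (f (D.pos q)) = dt l (f (D.pos a)) := by
      refine le_antisymm ?_ k2
      by_contra hn; push Not at hn
      have := mul_lt_mul_of_pos_left hn ht
      linarith
    have aux : ∀ p, bd D p → dt l (f (D.pos p)) = dt l (f (D.pos a)) → p = a ∨ p = b := by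
      intro p hp hpe
      by_contra hn
      push Not at hn
      exact ext3 hl (H.ext p hp) (H.ext a ha) (H.ext b hb) hpe (hpe.trans he) (H.f_inj hp ha hn.1)
        (H.f_inj hp hb hn.2) (H.f_inj ha hb hab)
    have hne := (be_E hpq).ne
    rcases aux p (bdl hpq) k4 with rfl | rfl <;> rcases aux q (bdr hpq) k5 with rfl | rfl
    · exact absurd rfl hne
    · exact hpq
    · exact be_symm hpq
    · exact absurd rfl hne

theorem edge_support (H : Hyp D f C) {a b : ι} (h : D.IsBoundaryEdge a b) :
    ∃ l : ℝ × ℝ, l ≠ 0 ∧ dt l (f (D.pos a)) = dt l (f (D.pos b)) ∧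
      ∀ p ∈ C, dt l (f (D.pos a)) ≤ dt l p := by
  have h0 := H.combo h (s := 1/2) (t := 1/2) (by norm_num) (by norm_num) (by norm_num)
  have hm : f ((1/2 : ℝ) • D.pos a + (1/2 : ℝ) • D.pos b) ∈ frontier C := by
    rw [← H.img]
    exact ⟨_, h.2 ⟨1/2, 1/2, by norm_num, by norm_num, by norm_num, rfl⟩, rfl⟩
  obtain ⟨l, hl, hmin⟩ := support H.conv H.int hm.2
  have h1 := hmin _ (H.mem (bdl h))
  have h2 := hmin _ (H.mem (bdr h))
  rw [h0, dt_add, dt_smul, dt_smul] at h1 h2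
  refine ⟨l, hl, by linarith, fun p hp => ?_⟩
  have h3 := hmin _ hp
  rw [h0, dt_add, dt_smul, dt_smul] at h3
  linarith

end Hyp
end EX

namespace EX

variable {ι : Type} [Fintype ι] [DecidableEq ι]
variable {D : TriDisk ι} {f : ℝ × ℝ → ℝ × ℝ} {C : Set (ℝ × ℝ)} {lam : ι → ι → ℝ}

/-- vertices of triangles -/
def usd (D : TriDisk ι) (v : ι) : Prop := ∃ w, E D v w

/-- good weights -/
def Wt (D : TriDisk ι) (lam : ι → ι → ℝ) : Prop := ∀ v, ¬ bd D v → usd D v →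
  (∀ w, 0 ≤ lam v w) ∧ (∀ w, E D v w → 0 < lam v w) ∧ (∀ w, ¬ E D v w → lam v w = 0)
      ∧ ∑ w, lam v w • (D.pos w - D.pos v) = 0

/-- discrete harmonic functions -/
def harm (D : TriDisk ι) (lam : ι → ι → ℝ) (u : ι → ℝ) : Prop :=
  ∀ v, ¬ bd D v → usd D v → ∑ w, lam v w * (u w - u v) = 0

theorem harm_pos (hW : Wt D lam) (l : ℝ × ℝ) : harm D lam (fun v => dt l (D.pos v)) := by
  intro v hv hu
  have h := congrArg (dt l) (hW v hv hu).2.2.2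
  rw [dt_sum] at h
  simp only [dt_smul, dt_sub] at h
  rw [h]; simp [dt]

theorem harm_add {u u' : ι → ℝ} (h : harm D lam u) (h' : harm D lam u') (c k : ℝ) :
    harm D lam (fun v => c * u v + k * u' v) := by
  intro v hv hu
  have h1 := h v hv hu
  have h2 := h' v hv hu
  have : ∑ w, lam v w * (c * u w + k * u' w - (c * u v + k * u' v)) =
    c * ∑ w, lam v w * (u w - u v) + k * ∑ w, lam v w * (u' w - u' v) := by
    rw [Finset.mul_sum, Finset.mul_sum, ← Finset.sum_add_distrib]
    apply Finset.sum_congr rfl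
    intros; ring
  rw [this, h1, h2]; ring

theorem harm_const (c : ℝ) : harm D lam (fun _ => c) := by
  intro v hv hu; simp

theorem harm_neg {u : ι → ℝ} (h : harm D lam u) : harm D lam (fun v => - u v) := by
  have := harm_add h h (-1) 0
  simpa using this

theorem harm_shift {u : ι → ℝ} (h : harm D lam u) (c : ℝ) : harm D lam (fun v => u v - c) := by
  have := harm_add h (harm_const c) 1 (-1)
  simpa [sub_eq_add_neg] using this

theorem harm_eq (hW : Wt D lam) {u : ι → ℝ} (h : harm D lam u) {v : ι} (hv : ¬ bd D v) (hu : usd D v)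
    (hge : ∀ w, E D v w → u v ≤ u w) : ∀ w, E D v w → u w = u v := by
  obtain ⟨h1, h2, h3, _⟩ := hW v hv hu
  have hs := h v hv hu
  rw [Finset.sum_eq_zero_iff_of_nonneg] at hs
  · intro w hw
    have := hs w (Finset.mem_univ _)
    rcases mul_eq_zero.1 this with h | h
    · exact absurd h (h2 w hw).ne'
    · linarith
  · intro w _
    by_cases hw : E D v w
    · exact mul_nonneg (h1 w) (by linarith [hge w hw])
    · simp [h3 w hw]

theorem dir (hW : Wt D lam) {v : ι} (hv : ¬ bd D v) (hu : usd D v) {l : ℝ × ℝ} (hl : l ≠ 0) :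
    ∃ w, E D v w ∧ dt l (D.pos v) < dt l (D.pos w) := by
  by_contra hn
  push Not at hn
  have h := harm_eq hW (harm_neg (harm_pos hW l)) hv hu (fun w hw => by linarith [hn w hw])
  obtain ⟨w, c, ht⟩ := hu
  have e1 := h w ⟨c, ht⟩
  have e2 := h c ⟨w, ht.rot.rot.swap⟩
  apply T_orn ht
  have hp := dt_self_pos hl
  simp only [dt] at e1 e2 hp
  unfold orn
  have k1 : l.1 * ((D.pos w).1 - (D.pos v).1) + l.2 * ((D.pos w).2 - (D.pos v).2) = 0 := by linarith
  have k2 : l.1 * ((D.pos c).1 - (D.pos v).1) + l.2 * ((D.pos c).2 - (D.pos v).2) = 0 := by linarith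
  have k3 : (l.1 * l.1 + l.2 * l.2) * (((D.pos w).1 - (D.pos v).1) * ((D.pos c).2 - (D.pos v).2) -
    ((D.pos w).2 - (D.pos v).2) * ((D.pos c).1 - (D.pos v).1)) = 0 := by
    linear_combination (l.1 * ((D.pos c).2 - (D.pos v).2) - l.2 * ((D.pos c).1 - (D.pos v).1)) * k1
      + (-l.1 * ((D.pos w).2 - (D.pos v).2) + l.2 * ((D.pos w).1 - (D.pos v).1)) * k2
  exact (mul_eq_zero.1 k3).resolve_left hp.ne'

theorem E.usdl {a b : ι} (h : E D a b) : usd D a := ⟨b, h⟩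
theorem E.usdr {a b : ι} (h : E D a b) : usd D b := ⟨a, h.symm⟩

theorem no_closed_set (hW : Wt D lam) (S : Set ι) (hne : S.Nonempty)
    (h1 : ∀ v ∈ S, ¬ bd D v ∧ usd D v) (h2 : ∀ v ∈ S, ∀ w, E D v w → w ∈ S) : False := by
  obtain ⟨v, hv, hmax⟩ := Set.exists_max_image S (fun v => dt (1, 0) (D.pos v)) (Set.toFinite _) hne
  obtain ⟨w, hw, hlt⟩ := dir hW (h1 v hv).1 (h1 v hv).2 (l := (1, 0)) (by simp)
  exact absurd (hmax w (h2 v hv w hw)) (not_le.2 hlt)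

theorem reach (hW : Wt D lam) {u : ι → ℝ} (h : harm D lam u) {v : ι} (hu : usd D v) (hv : u v < 0) :
    ∃ r, bd D r ∧ u r < 0 ∧ Relation.ReflTransGen (fun a b => E D a b ∧ u a < 0 ∧ u b < 0) v r := by
  by_contra hno
  push Not at hno
  set R := (fun a b => E D a b ∧ u a < 0 ∧ u b < 0)
  set S : Set ι := {w | Relation.ReflTransGen R v w} with hS
  have hSneg : ∀ w ∈ S, u w < 0 ∧ usd D w := by
    intro w hw
    rcases Relation.ReflTransGen.cases_tail hw with h | ⟨c, _, h⟩
    · rw [h]; exact ⟨hv, hu⟩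
    · exact ⟨h.2.2, h.1.usdr⟩
  obtain ⟨m, hm, hmin⟩ := Set.exists_min_image S u (Set.toFinite _) ⟨v, Relation.ReflTransGen.refl⟩
  have hSin : ∀ w ∈ S, ¬ bd D w := fun w hw hb => hno w hb (hSneg w hw).1 hw
  refine no_closed_set hW {w ∈ S | u w = u m} ⟨m, hm, rfl⟩ (fun w hw => ⟨hSin w hw.1, (hSneg w hw.1).2⟩) ?_
  rintro w ⟨hw, hwm⟩ x hx
  have hcase : ∀ y, E D w y → u y < 0 → y ∈ S := fun y hy hy0 =>
    Relation.ReflTransGen.tail hw ⟨hy, (hSneg w hw).1, hy0⟩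
  have hall := harm_eq hW h (hSin w hw) (hSneg w hw).2 (fun y hy => by
    rcases lt_or_ge (u y) 0 with h0 | h0
    · rw [hwm]; exact hmin y (hcase y hy h0)
    · linarith [(hSneg w hw).1])
  have he := hall x hx
  exact ⟨hcase x hx (by rw [he]; exact (hSneg w hw).1), he.trans hwm⟩

theorem exists_harm (hW : Wt D lam) (g : ι → ℝ) : ∃ u, harm D lam u ∧ ∀ v, bd D v → u v = g v := by
  classical
  let Φ : (ι → ℝ) →ₗ[ℝ] (ι → ℝ) :=
    { toFun := fun u v => if bd D v ∨ ¬ usd D v then u v else ∑ w, lam v w * (u w - u v)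
      map_add' := by
        intro u u'
        ext v
        by_cases hv : bd D v ∨ ¬ usd D v
        · simp [hv]
        · simp only [hv, if_false, Pi.add_apply]
          rw [← Finset.sum_add_distrib]
          exact Finset.sum_congr rfl (fun _ _ => by ring)
      map_smul' := by
        intro c u
        ext v
        by_cases hv : bd D v ∨ ¬ usd D v
        · simp [hv]
        · simp only [hv, if_false, Pi.smul_apply, smul_eq_mul, RingHom.id_apply]
          rw [Finset.mul_sum]
          exact Finset.sum_congr rfl (fun _ _ => by ring) }
  have hΦ : ∀ u v, Φ u v = if bd D v ∨ ¬ usd D v then u v else ∑ w, lam v w * (u w - u v) :=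
    fun _ _ => rfl
  have hinj : Function.Injective Φ := by
    rw [← LinearMap.ker_eq_bot, LinearMap.ker_eq_bot']
    intro u hu
    have hh : harm D lam u := by
      intro v hv hus
      have := congrFun hu v
      rw [hΦ, if_neg (by tauto)] at this
      exact this
    have hb : ∀ v, bd D v ∨ ¬ usd D v → u v = 0 := by
      intro v hv
      have := congrFun hu v
      rw [hΦ, if_pos hv] at this
      exact this
    ext v
    by_contra h0
    have hus : usd D v := by
      by_contra hn; exact h0 (hb v (Or.inr hn))
    rcases lt_or_gt_of_ne h0 with h1 | h1
    · obtain ⟨r, hr, hr0, _⟩ := reach hW hh hus h1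
      rw [hb r (Or.inl hr)] at hr0; exact lt_irrefl _ hr0
    · obtain ⟨r, hr, hr0, _⟩ := reach hW (harm_neg hh) hus (by simpa using h1)
      simp [hb r (Or.inl hr)] at hr0
  obtain ⟨u, hu⟩ := (LinearMap.injective_iff_surjective.1 hinj) (fun v => if bd D v then g v else 0)
  refine ⟨u, ?_, ?_⟩
  · intro v hv hus
    have := congrFun hu v
    rw [hΦ, if_neg (by tauto)] at this
    simpa [hv] using this
  · intro v hv
    have := congrFun hu v
    rw [hΦ, if_pos (Or.inl hv)] at this
    simpa [hv] using this

/-- `h` is the harmonic extension of the boundary data -/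
structure Sol (D : TriDisk ι) (lam : ι → ι → ℝ) (f : ℝ × ℝ → ℝ × ℝ) (h : ι → ℝ × ℝ) : Prop where
  bdry : ∀ v, bd D v → h v = f (D.pos v)
  hm : ∀ l, harm D lam (fun v => dt l (h v))

theorem exists_sol (hW : Wt D lam) (f : ℝ × ℝ → ℝ × ℝ) : ∃ h, Sol D lam f h := by
  obtain ⟨u1, h1, b1⟩ := exists_harm hW (fun v => (f (D.pos v)).1)
  obtain ⟨u2, h2, b2⟩ := exists_harm hW (fun v => (f (D.pos v)).2)
  exact ⟨fun v => (u1 v, u2 v), fun v hv => Prod.ext (b1 v hv) (b2 v hv),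
    fun l => harm_add h1 h2 l.1 l.2⟩

variable {h : ι → ℝ × ℝ}

theorem mpc (H : Hyp D f C) (hW : Wt D lam) (hs : Sol D lam f h) {l : ℝ × ℝ} {c : ℝ}
    (hc : ∀ p ∈ C, c ≤ dt l p) {v : ι} (hu : usd D v) : c ≤ dt l (h v) := by
  by_contra hn
  push Not at hn
  obtain ⟨r, hr, hr0, _⟩ := reach hW (harm_shift (hs.hm l) c) hu (by simpa using hn)
  rw [hs.bdry r hr] at hr0
  linarith [hc _ (H.mem hr)]

theorem mpc_strict (H : Hyp D f C) (hW : Wt D lam) (hs : Sol D lam f h) {l : ℝ × ℝ} {c : ℝ} (hl : l ≠ 0)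
    (hc : ∀ p ∈ C, c ≤ dt l p) {v : ι} (hu : usd D v) (hv : ¬ bd D v) : c < dt l (h v) := by
  refine lt_of_le_of_ne (mpc H hW hs hc hu) (fun hvc => ?_)
  set S : Set ι := {w | usd D w ∧ dt l (h w) = c} with hS
  have hvS : v ∈ S := ⟨hu, hvc.symm⟩
  have hcl : ∀ w ∈ S, ¬ bd D w → ∀ x, E D w x → x ∈ S := by
    intro w hw hwb x hx
    refine ⟨hx.usdr, ?_⟩
    rw [← hw.2]
    refine harm_eq hW (hs.hm l) hwb hw.1 (fun y hy => ?_) x hx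
    have := mpc H hW hs hc hy.usdr
    have h2 := hw.2
    linarith
  have hl' : ∃ l' : ℝ × ℝ, l' ≠ 0 ∧ ∃ κ, ∀ r ∈ S, bd D r → dt l' (D.pos r) = κ := by
    by_cases h1 : ∃ r1 ∈ S, bd D r1
    · obtain ⟨r1, hr1, hb1⟩ := h1
      by_cases h2 : ∃ r2 ∈ S, bd D r2 ∧ r2 ≠ r1
      · obtain ⟨r2, hr2, hb2, hne⟩ := h2
        refine ⟨(-((D.pos r2).2 - (D.pos r1).2), (D.pos r2).1 - (D.pos r1).1), ?_,
          dt (-((D.pos r2).2 - (D.pos r1).2), (D.pos r2).1 - (D.pos r1).1) (D.pos r1), ?_⟩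
        · intro h0
          apply hne
          apply D.inj
          have e1 := congrArg Prod.fst h0
          have e2 := congrArg Prod.snd h0
          simp only [Prod.fst_zero, Prod.snd_zero] at e1 e2
          ext <;> linarith
        · intro r hr hb
          by_cases e1 : r = r1
          · rw [e1]
          by_cases e2 : r = r2
          · rw [e2]; simp only [dt]; ring
          exfalso
          have q := hr.2
          have q1 := hr1.2
          have q2 := hr2.2
          rw [hs.bdry _ hb] at q
          rw [hs.bdry _ hb1] at q1
          rw [hs.bdry _ hb2] at q2
          exact ext3 hl (H.ext r hb) (H.ext r1 hb1) (H.ext r2 hb2) (q.trans q1.symm) (q.trans q2.symm)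
            (H.f_inj hb hb1 e1) (H.f_inj hb hb2 e2) (H.f_inj hb1 hb2 hne.symm)
      · push Not at h2
        exact ⟨(1, 0), by simp, dt (1, 0) (D.pos r1), fun r hr hb => by rw [h2 r hr hb]⟩
    · push Not at h1
      exact ⟨(1, 0), by simp, 0, fun r hr hb => absurd hb (h1 r hr)⟩
  obtain ⟨l', hl0, κ, hκ⟩ := hl'
  have main : ∀ l' : ℝ × ℝ, l' ≠ 0 → ∀ κ, (∀ r ∈ S, bd D r → dt l' (D.pos r) = κ) →
      κ ≤ dt l' (D.pos v) → False := by
    intro l' hl0 κ hκ hge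
    obtain ⟨w, hw, hmax⟩ := Set.exists_max_image S (fun v => dt l' (D.pos v)) (Set.toFinite _) ⟨v, hvS⟩
    have key : ∀ w ∈ S, ¬ bd D w → (∀ b ∈ S, dt l' (D.pos b) ≤ dt l' (D.pos w)) → False := by
      intro w hw hwb hm
      obtain ⟨x, hx, hlt⟩ := dir hW hwb hw.1 hl0
      exact absurd (hm x (hcl w hw hwb x hx)) (not_le.2 hlt)
    by_cases hwb : bd D w
    · refine key v hvS hv (fun b hb => (hmax b hb).trans ?_)
      show dt l' (D.pos w) ≤ _
      rw [hκ w hw hwb]; exact hge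
    · exact key w hw hwb hmax
  rcases le_total κ (dt l' (D.pos v)) with h1 | h1
  · exact main l' hl0 κ hκ h1
  · exact main (-l') (neg_ne_zero.2 hl0) (-κ) (fun r hr hb => by rw [dt_neg, hκ r hr hb])
      (by rw [dt_neg]; linarith)

/-- a functional separating the vertices -/
theorem exists_generic (D : TriDisk ι) : ∃ l : ℝ × ℝ, l ≠ 0 ∧ ∀ i j, i ≠ j → dt l (D.pos i) ≠ dt l (D.pos j) := by
  have hfin : (⋃ p : ι × ι, {t : ℝ | p.1 ≠ p.2 ∧ dt (1, t) (D.pos p.1) = dt (1, t) (D.pos p.2)}).Finite := by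
    apply Set.finite_iUnion
    rintro ⟨i, j⟩
    apply Set.Subsingleton.finite
    rintro s ⟨hij, hs⟩ t ⟨_, ht⟩
    simp only [dt] at hs ht hij
    by_contra hst
    have e : (s - t) * ((D.pos i).2 - (D.pos j).2) = 0 := by linarith
    have e2 := (mul_eq_zero.1 e).resolve_left (sub_ne_zero.2 hst)
    apply hij
    apply D.inj
    have e3 : (D.pos i).2 = (D.pos j).2 := by linarith
    rw [e3] at hs
    exact Prod.ext (by linarith) e3
  obtain ⟨t, ht⟩ := hfin.infinite_compl.nonempty
  refine ⟨(1, t), by simp, fun i j hij he => ht ?_⟩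
  exact Set.mem_iUnion.2 ⟨(i, j), hij, he⟩

theorem no_closed_tris (D : TriDisk ι) (P : ι → ι → ι → Prop) (hT : ∀ a b c, P a b c → T D a b c)
    (hrot : ∀ a b c, P a b c → P b c a) (hswap : ∀ a b c, P a b c → P b a c)
    (hne : ∃ a b c, P a b c)
    (hcl : ∀ a b c, P a b c → ∃ d, P a b d ∧
      orn (D.pos a) (D.pos b) (D.pos c) * orn (D.pos a) (D.pos b) (D.pos d) < 0) : False := by
  obtain ⟨l, hl, hgen⟩ := exists_generic D
  obtain ⟨a, b, c, habc⟩ := hne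
  obtain ⟨v, ⟨w0, c0, hv⟩, hmax⟩ := Set.exists_max_image {v | ∃ w c, P v w c} (fun v => dt l (D.pos v))
    (Set.toFinite _) ⟨a, b, c, habc⟩
  obtain ⟨w, ⟨c, hw⟩, hwmax⟩ := Set.exists_max_image {w | ∃ c, P v w c}
    (fun w => dt (-l.2, l.1) (D.pos w - D.pos v) / (dt l (D.pos v) - dt l (D.pos w))) (Set.toFinite _)
    ⟨w0, c0, hv⟩
  obtain ⟨d, hd, hneg⟩ := hcl _ _ _ hw
  have hpos : ∀ x, (∃ c, P v x c) → 0 < dt l (D.pos v) - dt l (D.pos x) := by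
    rintro x ⟨c, hx⟩
    have h1 : dt l (D.pos x) ≤ dt l (D.pos v) := hmax x ⟨v, c, hswap _ _ _ hx⟩
    have h2 := hgen x v (hT _ _ _ hx).ne.symm
    rcases lt_or_eq_of_le h1 with h3 | h3
    · linarith
    · exact absurd h3 h2
  have key : ∀ c, P v w c → 0 ≤ orn (D.pos v) (D.pos w) (D.pos c) := by
    intro c hc
    have hcW : ∃ x, P v c x := ⟨w, hswap _ _ _ (hrot _ _ _ (hrot _ _ _ hc))⟩
    have h1 := hwmax c hcW
    have p1 := hpos w ⟨_, hc⟩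
    have p2 := hpos c hcW
    rw [div_le_div_iff₀ p2 p1] at h1
    have hp := dt_self_pos hl
    simp only [dt, Prod.fst_sub, Prod.snd_sub] at h1 hp
    unfold orn
    by_contra hn
    push Not at hn
    have := mul_neg_of_pos_of_neg hp hn
    nlinarith
  have := mul_nonneg (key c hw) (key d hd)
  linarith

end EX

namespace EX

variable {ι : Type} [Fintype ι] [DecidableEq ι]
variable {D : TriDisk ι} {f : ℝ × ℝ → ℝ × ℝ} {C : Set (ℝ × ℝ)} {lam : ι → ι → ℝ} {h : ι → ℝ × ℝ}

/-- the negative set of a perturbation is connected -/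
theorem neg_conn (H : Hyp D f C) (hW : Wt D lam) (hs : Sol D lam f h) {l : ℝ × ℝ} {c0 : ℝ} (hl : l ≠ 0)
    {us : ι → ℝ} (hus : harm D lam us) (h1 : ∀ v, dt l (h v) < c0 → us v < 0)
    (h2 : ∀ v, us v < 0 → dt l (h v) ≤ c0) {x y : ι} (ux : usd D x) (uy : usd D y)
    (hx : us x < 0) (hy : us y < 0) :
    Relation.ReflTransGen (fun a b => E D a b ∧ us a < 0 ∧ us b < 0) x y := by
  set R := (fun a b => E D a b ∧ us a < 0 ∧ us b < 0) with hR
  have hsym : ∀ a b, Relation.ReflTransGen R a b → Relation.ReflTransGen R b a := by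
    intro a b hab
    induction hab with
    | refl => exact .refl
    | tail _ hs ih => exact Relation.ReflTransGen.head ⟨hs.1.symm, hs.2.2, hs.2.1⟩ ih
  have step : ∀ v, usd D v → us v < 0 → ∃ r, bd D r ∧ us r < 0 ∧
      (∀ p ∈ C, dt l (f (D.pos r)) ≤ dt l p) ∧ Relation.ReflTransGen R v r := by
    intro v uv hv
    obtain ⟨r0, hr0, hr0n, hr0c⟩ := reach hW hus uv hv
    obtain ⟨r, ⟨hrb, hrn, hrc⟩, hmin⟩ := Set.exists_min_image
      {r | bd D r ∧ us r < 0 ∧ Relation.ReflTransGen R v r} (fun r => dt l (f (D.pos r)))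
      (Set.toFinite _) ⟨r0, hr0, hr0n, hr0c⟩
    refine ⟨r, hrb, hrn, ?_, hrc⟩
    by_contra hno
    push Not at hno
    obtain ⟨p, hp, hlt⟩ := hno
    obtain ⟨r', hr', hlt'⟩ := H.descend hrb hp hlt
    have e1 := h2 r hrn
    rw [hs.bdry r hrb] at e1
    have hn : us r' < 0 := h1 r' (by rw [hs.bdry r' (bdr hr')]; linarith)
    have := hmin r' ⟨bdr hr', hn, hrc.tail ⟨be_E hr', hrn, hn⟩⟩
    linarith
  obtain ⟨r, hr, hrn, hrm, hrc⟩ := step x ux hx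
  obtain ⟨r', hr', hrn', hrm', hrc'⟩ := step y uy hy
  refine hrc.trans (Relation.ReflTransGen.trans ?_ (hsym _ _ hrc'))
  by_cases he : r = r'
  · rw [he]
  · exact Relation.ReflTransGen.single ⟨be_E (H.face_edge hr hr' he hl hrm hrm'), hrn, hrn'⟩

theorem seg_disj {i j k m : ι} (h : E D i j) (h' : E D k m) (h1 : i ≠ k) (h2 : i ≠ m) (h3 : j ≠ k)
    (h4 : j ≠ m) : Disjoint (segment ℝ (D.pos i) (D.pos j)) (segment ℝ (D.pos k) (D.pos m)) := by
  rw [← hl_pair, ← hl_pair, Set.disjoint_iff_inter_eq_empty, h.fc.inter h'.fc]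
  have : ({i, j} : Finset ι) ∩ {k, m} = ∅ := by
    ext z; simp only [Finset.mem_inter, Finset.mem_insert, Finset.mem_singleton]
    simp only [Finset.notMem_empty, iff_false]
    rintro ⟨rfl | rfl, rfl | rfl⟩ <;> simp_all
  rw [this, hl_empty]

theorem orn_seg_zero {A B z : ℝ × ℝ} (hz : z ∈ segment ℝ A B) : orn A B z = 0 := by
  obtain ⟨s, t, _, _, hst, rfl⟩ := hz
  rw [orn_combo2 _ _ _ _ _ _ hst, orn_self, orn_self']; simp

/-- a segment in the triangle `abc`, on the strict side, misses edges not containing `c` -/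
theorem seg_disj2 {a b c i j : ι} (ht : T D a b c) (he : E D i j) (hi : i ≠ c) (hj : j ≠ c) {m : ℝ × ℝ}
    (hm : m ∈ hl D {a, b, c})
    (hp : 0 < orn (D.pos a) (D.pos b) m * orn (D.pos a) (D.pos b) (D.pos c)) :
    Disjoint (segment ℝ (D.pos i) (D.pos j)) (segment ℝ (D.pos c) m) := by
  rw [Set.disjoint_left]
  intro z hz1 hz2
  have hz3 : z ∈ hl D {a, b, c} :=
    (convex_convexHull ℝ _).segment_subset (pos_mem_hl (by simp)) hm hz2
  rw [← hl_pair] at hz1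
  have hz4 : z ∈ hl D ({i, j} ∩ {a, b, c}) := by rw [← he.fc.inter ht.fc]; exact ⟨hz1, hz3⟩
  have hz5 : z ∈ segment ℝ (D.pos a) (D.pos b) := by
    rw [← hl_pair]
    refine convexHull_mono (Set.image_mono ?_) hz4
    intro k
    simp only [Finset.coe_inter, Finset.coe_insert, Finset.coe_singleton, Set.mem_inter_iff,
      Set.mem_insert_iff, Set.mem_singleton_iff]
    rintro ⟨rfl | rfl, h3 | h3 | h3⟩ <;> simp_all
  have h0 := orn_seg_zero hz5
  have hc := T_orn ht
  obtain ⟨s, t, hs, ht, hst, rfl⟩ := hz2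
  rw [orn_combo2 _ _ _ _ _ _ hst] at h0
  have h1 : s * (orn (D.pos a) (D.pos b) (D.pos c))^2 + t * (orn (D.pos a) (D.pos b) m *
    orn (D.pos a) (D.pos b) (D.pos c)) = 0 := by linear_combination (orn (D.pos a) (D.pos b) (D.pos c)) * h0
  have h2 : 0 < (orn (D.pos a) (D.pos b) (D.pos c))^2 := by positivity
  have h3 := mul_nonneg hs h2.le
  have h4 := mul_nonneg ht hp.le
  have h5 : s = 0 := by
    rcases mul_eq_zero.1 (by linarith : s * (orn (D.pos a) (D.pos b) (D.pos c))^2 = 0) with h | h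
    · exact h
    · exact absurd h h2.ne'
  have h6 : t = 0 := by
    rcases mul_eq_zero.1 (by linarith : t * (orn (D.pos a) (D.pos b) m *
      orn (D.pos a) (D.pos b) (D.pos c)) = 0) with h | h
    · exact h
    · exact absurd h hp.ne'
  linarith

/-- an edge meeting a triangle only in the vertex `k` -/
theorem seg_single {a b c i j k : ι} (ht : T D a b c) (he : E D i j)
    (hk : ∀ z, (z = i ∨ z = j) → (z = a ∨ z = b ∨ z = c) → z = k) {z : ℝ × ℝ}
    (hz : z ∈ segment ℝ (D.pos i) (D.pos j)) (hz' : z ∈ hl D {a, b, c}) : z = D.pos k := by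
  rw [← hl_pair] at hz
  have hz4 : z ∈ hl D ({i, j} ∩ {a, b, c}) := by rw [← he.fc.inter ht.fc]; exact ⟨hz, hz'⟩
  have : z ∈ hl D {k} := by
    refine convexHull_mono (Set.image_mono ?_) hz4
    intro x
    simp only [Finset.coe_inter, Finset.coe_insert, Finset.coe_singleton, Set.mem_inter_iff,
      Set.mem_insert_iff, Set.mem_singleton_iff]
    rintro ⟨h1, h2⟩
    exact hk x h1 h2
  rwa [hl_single] at this

theorem exists_small (u g : ι → ℝ) : ∃ s : ℝ, 0 < s ∧ ∀ v, (u v < 0 → u v + s * g v < 0) ∧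
    (0 < u v → 0 < u v + s * g v) := by
  have hall : ∀ᶠ s : ℝ in nhdsWithin 0 (Set.Ioi 0), ∀ v, (u v < 0 → u v + s * g v < 0) ∧
    (0 < u v → 0 < u v + s * g v) := by
    rw [Filter.eventually_all]
    intro v
    have ht : Filter.Tendsto (fun s : ℝ => u v + s * g v) (nhdsWithin 0 (Set.Ioi 0)) (nhds (u v)) := by
      have : Continuous (fun s : ℝ => u v + s * g v) := by fun_prop
      have h0 := this.tendsto 0
      simp only [zero_mul, add_zero] at h0
      exact h0.mono_left nhdsWithin_le_nhds
    rcases lt_trichotomy (u v) 0 with h | h | h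
    · filter_upwards [ht.eventually (gt_mem_nhds h)] with s hs
      exact ⟨fun _ => hs, fun h' => by linarith⟩
    · filter_upwards with s
      exact ⟨fun _ => by linarith, fun h' => by linarith⟩
    · filter_upwards [ht.eventually (lt_mem_nhds h)] with s hs
      exact ⟨fun _ => by linarith, fun h' => hs⟩
  obtain ⟨s, h1, h2⟩ := (hall.and self_mem_nhdsWithin).exists
  exact ⟨s, h2, h1⟩

theorem lemmaM (H : Hyp D f C) (hW : Wt D lam) (hs : Sol D lam f h) {l : ℝ × ℝ} {c0 : ℝ}
    {a b c d : ι} (hc : T D a b c) (hd : T D a b d)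
    (ho : orn (D.pos a) (D.pos b) (D.pos c) * orn (D.pos a) (D.pos b) (D.pos d) < 0)
    (ua : dt l (h a) = c0) (ub : dt l (h b) = c0) (uc : c0 ≤ dt l (h c)) (ud : c0 < dt l (h d))
    (hcr : ∃ p ∈ C, dt l p < c0) : False := by
  have hl : l ≠ 0 := by
    rintro rfl
    simp only [dt, Prod.fst_zero, Prod.snd_zero] at ua ud
    linarith
  -- the neighbour on the negative side
  obtain ⟨x, hax, hx⟩ : ∃ x, E D a x ∧ dt l (h x) < c0 := by
    by_cases hb : bd D a
    · obtain ⟨p, hp, hlt⟩ := hcr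
      have ua' := ua
      rw [hs.bdry a hb] at ua'
      obtain ⟨x, hx, hlt'⟩ := H.descend hb hp (by linarith)
      exact ⟨x, be_E hx, by rw [hs.bdry x (bdr hx)]; linarith⟩
    · by_contra hn
      push Not at hn
      have := harm_eq hW (hs.hm l) hb hc.e.usdl (fun w hw => by rw [ua]; exact hn w hw) d
        hd.rot.rot.swap.e
      linarith
  have hdet : (D.pos b - D.pos a).1 * (D.pos c - D.pos a).2 -
      (D.pos b - D.pos a).2 * (D.pos c - D.pos a).1 ≠ 0 := T_orn hc
  obtain ⟨α, β, g1, g2⟩ := exists_lin hdet (-1) 1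
  have g1' : dt (α, β) (D.pos b) - dt (α, β) (D.pos a) = -1 := by
    rw [← dt_sub]; exact g1
  have g2' : dt (α, β) (D.pos c) - dt (α, β) (D.pos a) = 1 := by
    rw [← dt_sub]; exact g2
  obtain ⟨s, hs0, hsm⟩ := exists_small (fun v => dt l (h v) - c0)
    (fun v => dt (α, β) (D.pos v) - dt (α, β) (D.pos a))
  set us : ι → ℝ := fun v => (dt l (h v) - c0) + s * (dt (α, β) (D.pos v) - dt (α, β) (D.pos a)) with husdef
  have hus : harm D lam us := by
    have := harm_add (harm_shift (hs.hm l) c0) (harm_shift (harm_pos hW (α, β)) (dt (α, β) (D.pos a))) 1 s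
    simpa using this
  have k1 : ∀ v, dt l (h v) < c0 → us v < 0 := fun v hv => (hsm v).1 (by simpa using hv)
  have k2 : ∀ v, c0 < dt l (h v) → 0 < us v := fun v hv => (hsm v).2 (by simpa using hv)
  have usa : us a = 0 := by simp [husdef, ua]
  have usb : us b < 0 := by simp only [husdef, ub, g1']; linarith
  have usc : 0 < us c := by simp only [husdef, g2']; linarith
  have usd' : 0 < us d := k2 d ud
  have usx : us x < 0 := k1 x hx
  have hS := neg_conn H hW hs hl hus k1 (fun v hv => by
    by_contra hn; push Not at hn; linarith [k2 v hn]) hc.e.usdr hax.usdr usb usx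
  have hP := neg_conn H hW hs (l := -l) (c0 := -c0) (us := fun v => - us v) (neg_ne_zero.2 hl)
    (harm_neg hus) (fun v hv => by
      rw [dt_neg] at hv; have := k2 v (by linarith); linarith) (fun v hv => by
      rw [dt_neg]; by_contra hn; push Not at hn; linarith [k1 v (by linarith)])
    (x := c) (y := d) hc.rot.e.usdr hd.rot.e.usdr (by linarith) (by linarith)
  have ne_of : ∀ {i j : ι}, us i < us j → i ≠ j := by
    rintro i j hij rfl; exact lt_irrefl _ hij
  obtain ⟨m1, m2, hm1, hm2, hp1, hp2, hsub, hA, hB, hpar⟩ := cross_exists ho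
  rw [← hl_triple] at hm1 hm2 hsub
  rw [← hl_triple] at hsub
  refine planar_contra (S := fun p q => ∃ i j, p = D.pos i ∧ q = D.pos j ∧ E D i j ∧ us i < 0 ∧ us j < 0)
    (P := fun p q => ∃ i j, p = D.pos i ∧ q = D.pos j ∧ E D i j ∧ 0 < us i ∧ 0 < us j)
    (Relation.ReflTransGen.lift D.pos (fun i j hij => ⟨i, j, rfl, rfl, hij⟩) _ _ hS)
    (Relation.ReflTransGen.lift D.pos (fun i j hij => ⟨i, j, rfl, rfl, hij.1, by
      have := hij.2.1; linarith, by have := hij.2.2; linarith⟩) _ _ hP)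
    ?_ ?_ ?_ ?_ hpar
  · rintro _ _ ⟨i, j, rfl, rfl, hij, hi, hj⟩
    refine ⟨?_, ?_, ?_⟩
    · rintro _ _ ⟨k, m, rfl, rfl, hkm, hk, hm⟩
      exact seg_disj hkm hij (ne_of (by linarith)) (ne_of (by linarith)) (ne_of (by linarith)) (ne_of (by linarith))
    · exact seg_disj hax.symm hij (ne_of (by linarith)) (ne_of (by linarith)) (ne_of (by linarith)) (ne_of (by linarith))
    · exact seg_disj hc.e hij (ne_of (by linarith)) (ne_of (by linarith)) (ne_of (by linarith)) (ne_of (by linarith))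
  · refine ⟨?_, ?_, ?_⟩
    · rintro _ _ ⟨k, m, rfl, rfl, hkm, hk, hm⟩
      exact seg_disj2 hc hkm (ne_of (by linarith)) (ne_of (by linarith)) hm1 hp1
    · exact seg_disj2 hc hax.symm (ne_of (by linarith)) (ne_of (by linarith)) hm1 hp1
    · exact seg_disj2 hc hc.e (ne_of (by linarith)) (ne_of (by linarith)) hm1 hp1
  · refine ⟨?_, ?_, ?_⟩
    · rintro _ _ ⟨k, m, rfl, rfl, hkm, hk, hm⟩
      exact seg_disj2 hd hkm (ne_of (by linarith)) (ne_of (by linarith)) hm2 hp2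
    · exact seg_disj2 hd hax.symm (ne_of (by linarith)) (ne_of (by linarith)) hm2 hp2
    · exact seg_disj2 hd hc.e (ne_of (by linarith)) (ne_of (by linarith)) hm2 hp2
  · refine ⟨?_, ?_⟩
    · rintro _ _ ⟨k, m, rfl, rfl, hkm, hk, hm⟩
      rw [Set.disjoint_left]
      intro z hz1 hz2
      have : z = D.pos b := by
        rcases hsub hz2 with h3 | h3
        · refine seg_single hc hkm ?_ hz1 h3
          rintro z (rfl | rfl) (h4 | h4 | h4) <;> first | exact h4 | (subst h4; linarith)
        · refine seg_single hd hkm ?_ hz1 h3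
          rintro z (rfl | rfl) (h4 | h4 | h4) <;> first | exact h4 | (subst h4; linarith)
      rw [this] at hz2
      exact hB hz2
    · rw [Set.disjoint_left]
      intro z hz1 hz2
      have hxb : x ≠ b := by
        rintro rfl; linarith
      have : z = D.pos a := by
        rcases hsub hz2 with h3 | h3
        · refine seg_single hc hax.symm ?_ hz1 h3
          rintro z (rfl | rfl) (h4 | h4 | h4) <;>
            first | rfl | exact h4 | exact absurd h4 hxb | (subst h4; linarith)
        · refine seg_single hd hax.symm ?_ hz1 h3
          rintro z (rfl | rfl) (h4 | h4 | h4) <;>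
            first | rfl | exact h4 | exact absurd h4 hxb | (subst h4; linarith)
      rw [this] at hz2
      exact hA hz2

theorem prop_lin {l l2 w : ℝ × ℝ} (hl : l ≠ 0) (hw : w ≠ 0) (h1 : dt l w = 0) (h2 : dt l2 w = 0) :
    ∃ k : ℝ, l2 = k • l := by
  have hp := dt_self_pos hl
  have hpw := dt_self_pos hw
  simp only [dt] at h1 h2 hp hpw
  have hcr : l.1 * l2.2 - l.2 * l2.1 = 0 := by
    have : (w.1 * w.1 + w.2 * w.2) * (l.1 * l2.2 - l.2 * l2.1) = 0 := by
      linear_combination (w.1 * l2.2 - w.2 * l2.1) * h1 + (w.2 * l.1 - w.1 * l.2) * h2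
    exact (mul_eq_zero.1 this).resolve_left hpw.ne'
  refine ⟨(l.1 * l2.1 + l.2 * l2.2) / (l.1 * l.1 + l.2 * l.2), ?_⟩
  ext
  · simp only [Prod.smul_fst, smul_eq_mul]; rw [div_mul_eq_mul_div, eq_div_iff hp.ne']; linear_combination -l.2 * hcr
  · simp only [Prod.smul_snd, smul_eq_mul]; rw [div_mul_eq_mul_div, eq_div_iff hp.ne']; linear_combination l.1 * hcr

/-- perpendicular functional -/
def prp (A B : ℝ × ℝ) : ℝ × ℝ := (-(B.2 - A.2), B.1 - A.1)

theorem dt_prp (A B p : ℝ × ℝ) : dt (prp A B) p - dt (prp A B) A = orn A B p := by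
  simp [dt, prp, orn]; ring

theorem prp_ne {A B : ℝ × ℝ} (h : A ≠ B) : prp A B ≠ 0 := by
  intro h0
  apply h
  have e1 := congrArg Prod.fst h0
  have e2 := congrArg Prod.snd h0
  simp only [prp, Prod.fst_zero, Prod.snd_zero] at e1 e2
  ext <;> linarith

/-- three vertices of a triangle are not mapped into a supporting line -/
theorem no_face (H : Hyp D f C) (hW : Wt D lam) (hs : Sol D lam f h) {l : ℝ × ℝ} {c0 : ℝ} (hl : l ≠ 0)
    (hmin : ∀ p ∈ C, c0 ≤ dt l p) {a b c : ι} (ht : T D a b c) (ua : dt l (h a) = c0)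
    (ub : dt l (h b) = c0) (uc : dt l (h c) = c0) : False := by
  have key : ∀ v, usd D v → dt l (h v) = c0 → bd D v := by
    intro v hv he
    by_contra hb
    have := mpc_strict H hW hs hl hmin hv hb
    linarith
  have ba := key a ht.e.usdl ua
  have bb := key b ht.e.usdr ub
  have bc := key c ht.rot.e.usdr uc
  rw [hs.bdry a ba] at ua
  rw [hs.bdry b bb] at ub
  rw [hs.bdry c bc] at uc
  exact ext3 hl (H.ext a ba) (H.ext b bb) (H.ext c bc) (by linarith) (by linarith)
    (H.f_inj ba bb ht.ne) (H.f_inj ba bc ht.rot.rot.ne.symm) (H.f_inj bb bc ht.rot.ne)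

theorem nondeg (H : Hyp D f C) (hW : Wt D lam) (hs : Sol D lam f h) {a b c : ι} (ht : T D a b c) :
    orn (h a) (h b) (h c) ≠ 0 := by
  intro h0
  obtain ⟨l, hl, e1, e2⟩ : ∃ l : ℝ × ℝ, l ≠ 0 ∧ dt l (h b) = dt l (h a) ∧ dt l (h c) = dt l (h a) := by
    by_cases hab : h a = h b
    · by_cases hac : h a = h c
      · exact ⟨(1, 0), by simp, by rw [hab], by rw [hac]⟩
      · refine ⟨prp (h a) (h c), prp_ne hac, by rw [hab], ?_⟩
        have := dt_prp (h a) (h c) (h c)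
        rw [orn_self] at this; linarith
    · refine ⟨prp (h a) (h b), prp_ne hab, ?_, ?_⟩
      · have := dt_prp (h a) (h b) (h b)
        rw [orn_self] at this; linarith
      · have := dt_prp (h a) (h b) (h c)
        rw [h0] at this; linarith
  set c0 := dt l (h a) with hc0
  have cr1 : ∃ p ∈ C, dt l p < c0 := by
    by_contra hn
    push Not at hn
    exact no_face H hW hs hl hn ht rfl e1 e2
  have cr2 : ∃ p ∈ C, c0 < dt l p := by
    by_contra hn
    push Not at hn
    exact no_face H hW hs (neg_ne_zero.2 hl) (c0 := -c0) (fun p hp => by rw [dt_neg]; linarith [hn p hp]) ht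
      (by rw [dt_neg]) (by rw [dt_neg, e1]) (by rw [dt_neg, e2])
  refine no_closed_tris D (fun a b c => T D a b c ∧ dt l (h a) = c0 ∧ dt l (h b) = c0 ∧ dt l (h c) = c0)
    (fun a b c h => h.1) (fun a b c h => ⟨h.1.rot, h.2.2.1, h.2.2.2, h.2.1⟩)
    (fun a b c h => ⟨h.1.swap, h.2.2.1, h.2.1, h.2.2.2⟩) ⟨a, b, c, ht, rfl, e1, e2⟩ ?_
  rintro a b c ⟨ht, ua, ub, uc⟩
  by_cases hd : ∃ d, T D a b d ∧
      orn (D.pos a) (D.pos b) (D.pos c) * orn (D.pos a) (D.pos b) (D.pos d) < 0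
  · obtain ⟨d, hd, ho⟩ := hd
    rcases lt_trichotomy (dt l (h d)) c0 with h1 | h1 | h1
    · exfalso
      obtain ⟨p, hp, hlt⟩ := cr2
      exact lemmaM H hW hs (l := -l) (c0 := -c0) ht hd ho (by rw [dt_neg, ua]) (by rw [dt_neg, ub])
        (by rw [dt_neg, uc]) (by rw [dt_neg]; linarith) ⟨p, hp, by rw [dt_neg]; linarith⟩
    · exact ⟨d, ⟨hd, ua, ub, h1⟩, ho⟩
    · exact (lemmaM H hW hs ht hd ho ua ub uc.ge h1 cr1).elim
  · exfalso
    push Not at hd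
    have hbe := boundary_of_onesided ht (fun d h => not_lt.2 (hd d h))
    obtain ⟨l2, hl2, e, hmin⟩ := H.edge_support hbe
    rw [hs.bdry a (bdl hbe)] at ua
    rw [hs.bdry b (bdr hbe)] at ub
    obtain ⟨k, rfl⟩ := prop_lin (l2 := l2) hl (sub_ne_zero.2 (H.f_inj (bdl hbe) (bdr hbe) ht.ne))
      (by rw [dt_sub]; linarith) (by rw [dt_sub]; linarith)
    have hk : ∀ p, dt (k • l) p = k * dt l p := by intro p; simp [dt]; ring
    obtain ⟨p, hp, hlt⟩ := cr1
    obtain ⟨q, hq, hgt⟩ := cr2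
    have m1 := hmin p hp
    have m2 := hmin q hq
    rw [hk, hk, ua] at m1 m2
    apply hl2
    have : k = 0 := by
      apply le_antisymm
      · by_contra hh; push Not at hh; nlinarith
      · by_contra hh; push Not at hh; nlinarith
    rw [this, zero_smul]

theorem int_edge (H : Hyp D f C) (hW : Wt D lam) (hs : Sol D lam f h) {a b c d : ι} (hc : T D a b c)
    (hd : T D a b d) (ho : orn (D.pos a) (D.pos b) (D.pos c) * orn (D.pos a) (D.pos b) (D.pos d) < 0) :
    orn (h a) (h b) (h c) * orn (h a) (h b) (h d) < 0 := by
  have nc := nondeg H hW hs hc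
  have nd := nondeg H hW hs hd
  have hab : h a ≠ h b := by
    intro he; rw [he] at nc; exact nc (orn_self'' _ _)
  have main : ∀ l : ℝ × ℝ, l ≠ 0 → dt l (h b) = dt l (h a) → dt l (h a) < dt l (h c) →
      dt l (h a) < dt l (h d) → False := by
    intro l hl e1 e2 e3
    refine lemmaM H hW hs hc hd ho rfl e1 e2.le e3 ?_
    by_contra hn
    push Not at hn
    have key : ∀ v, usd D v → dt l (h v) = dt l (h a) → bd D v := by
      intro v hv he
      by_contra hb
      have := mpc_strict H hW hs hl hn hv hb
      linarith
    have ba := key a hc.e.usdl rfl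
    have bb := key b hc.e.usdr e1
    refine not_boundary_of_twosided hc hd ho (H.face_edge ba bb hc.ne hl ?_ ?_)
    · rw [← hs.bdry a ba]; exact hn
    · rw [← hs.bdry b bb, e1]; exact hn
  have k := dt_prp (h a) (h b)
  have kb := k (h b)
  rw [orn_self] at kb
  by_contra hn
  push Not at hn
  rcases lt_or_gt_of_ne nc with n1 | n1
  · have n2 : orn (h a) (h b) (h d) < 0 := by
      rcases lt_or_gt_of_ne nd with n2 | n2
      · exact n2
      · have := mul_neg_of_neg_of_pos n1 n2; linarith
    have k1 := k (h c)
    have k2 := k (h d)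
    exact main (-prp (h a) (h b)) (neg_ne_zero.2 (prp_ne hab)) (by rw [dt_neg, dt_neg]; linarith)
      (by rw [dt_neg, dt_neg]; linarith) (by rw [dt_neg, dt_neg]; linarith)
  · have n2 : 0 < orn (h a) (h b) (h d) := by
      rcases lt_or_gt_of_ne nd with n2 | n2
      · have := mul_neg_of_pos_of_neg n1 n2; linarith
      · exact n2
    have k1 := k (h c)
    have k2 := k (h d)
    exact main (prp (h a) (h b)) (prp_ne hab) (by linarith) (by linarith) (by linarith)

theorem bdry_edge (H : Hyp D f C) (hW : Wt D lam) (hs : Sol D lam f h) {a b c : ι} (hc : T D a b c)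
    (hb : D.IsBoundaryEdge a b) :
    (∀ p ∈ C, 0 ≤ orn (h a) (h b) (h c) * orn (h a) (h b) p) ∧
    ∀ p ∈ interior C, 0 < orn (h a) (h b) (h c) * orn (h a) (h b) p := by
  have nc := nondeg H hW hs hc
  have hab : h a ≠ h b := by
    intro he; rw [he] at nc; exact nc (orn_self'' _ _)
  obtain ⟨l, hl, e, hmin⟩ := H.edge_support hb
  rw [← hs.bdry a (bdl hb)] at e hmin
  rw [← hs.bdry b (bdr hb)] at e
  have hle := mpc H hW hs hmin hc.rot.e.usdr
  have hlt : dt l (h a) < dt l (h c) := by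
    refine lt_of_le_of_ne hle (fun he => ?_)
    exact no_face H hW hs hl hmin hc rfl e.symm he.symm
  have k := dt_prp (h a) (h b)
  have kb := k (h b)
  rw [orn_self] at kb
  obtain ⟨q, hq⟩ := prop_lin (l2 := prp (h a) (h b)) hl (sub_ne_zero.2 hab)
      (by rw [dt_sub]; linarith) (by rw [dt_sub]; linarith)
  have hk : ∀ p, orn (h a) (h b) p = q * (dt l p - dt l (h a)) := by
    intro p; rw [← k, hq]; simp [dt]; ring
  have q0 : q ≠ 0 := by
    intro h0; rw [hk, h0] at nc; simp at nc
  have q2 : 0 < q ^ 2 := by positivity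
  have hex : ∀ p, orn (h a) (h b) (h c) * orn (h a) (h b) p =
      q ^ 2 * (dt l (h c) - dt l (h a)) * (dt l p - dt l (h a)) := by
    intro p; rw [hk, hk p]; ring
  refine ⟨fun p hp => ?_, fun p hp => ?_⟩
  · rw [hex]
    exact mul_nonneg (mul_nonneg q2.le (by linarith)) (by linarith [hmin p hp])
  · rw [hex]
    refine mul_pos (mul_pos q2 (by linarith)) ?_
    have h1 := hmin p (interior_subset hp)
    rcases lt_or_eq_of_le h1 with h2 | h2
    · linarith
    · exact absurd hp (not_interior_of_min hl (fun b hb => by rw [← h2]; exact hmin b hb))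

end EX

namespace EX

/-- signed crossing of the upward ray, in terms of signs -/
noncomputable def W (s t o : ℝ) : ℤ :=
  (if s < 0 ∧ 0 < t ∧ o < 0 then 1 else 0) - (if t < 0 ∧ 0 < s ∧ 0 < o then 1 else 0)

theorem sgn_count {a b c o1 o2 o3 S : ℝ} (ha : a ≠ 0) (hb : b ≠ 0) (hc : c ≠ 0) (h1 : o1 ≠ 0) (h2 : o2 ≠ 0)
    (h3 : o3 ≠ 0) (hS : S ≠ 0) (hsum : S = o1 + o2 + o3) (hrel : o2 * a + o3 * b + o1 * c = 0) :
    (if S < 0 then W a b o1 else - W a b o1) + (if S < 0 then W b c o2 else - W b c o2) +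
      (if S < 0 then W c a o3 else - W c a o3) = if 0 < o1 * S ∧ 0 < o2 * S ∧ 0 < o3 * S then 1 else 0 := by
  have p1 : ¬ (0 < o2 * a ∧ 0 < o3 * b ∧ 0 < o1 * c) := by rintro ⟨_, _, _⟩; linarith
  have p2 : ¬ (o2 * a < 0 ∧ o3 * b < 0 ∧ o1 * c < 0) := by rintro ⟨_, _, _⟩; linarith
  have p3 : ¬ (o1 < 0 ∧ o2 < 0 ∧ o3 < 0 ∧ 0 < S) := by rintro ⟨_, _, _, _⟩; linarith
  have p4 : ¬ (0 < o1 ∧ 0 < o2 ∧ 0 < o3 ∧ S < 0) := by rintro ⟨_, _, _, _⟩; linarith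
  simp only [mul_pos_iff, mul_neg_iff] at p1 p2 ⊢
  clear hrel hsum
  unfold W
  rcases lt_or_gt_of_ne ha with ha | ha <;> rcases lt_or_gt_of_ne hb with hb | hb <;>
  rcases lt_or_gt_of_ne hc with hc | hc <;> rcases lt_or_gt_of_ne h1 with h1 | h1 <;>
  rcases lt_or_gt_of_ne h2 with h2 | h2 <;> rcases lt_or_gt_of_ne h3 with h3 | h3 <;>
  rcases lt_or_gt_of_ne hS with hS | hS <;>
  simp only [ha, hb, hc, h1, h2, h3, hS, ha.not_gt, hb.not_gt, hc.not_gt, h1.not_gt, h2.not_gt, h3.not_gt,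
    hS.not_gt, and_true, true_and, and_false, false_and, or_true, or_false, not_true_eq_false, if_true, if_false,
    true_or, false_or, and_self, or_self] at p1 p2 p3 p4 ⊢ <;> rfl

/-- contribution of the edge `A B` of the triangle `A B C` to the number of triangles over `y` -/
noncomputable def phi (A B C y : ℝ × ℝ) : ℤ :=
  if orn A B C < 0 then W (A.1 - y.1) (B.1 - y.1) (orn A B y) else - W (A.1 - y.1) (B.1 - y.1) (orn A B y)

/-- open triangle -/
def inT (A B C y : ℝ × ℝ) : Prop :=
  0 < orn A B y * orn A B C ∧ 0 < orn B C y * orn A B C ∧ 0 < orn C A y * orn A B C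

open Classical in
theorem tri_count {A B C y : ℝ × ℝ} (hS : orn A B C ≠ 0) (hA : A.1 ≠ y.1) (hB : B.1 ≠ y.1) (hC : C.1 ≠ y.1)
    (h1 : orn A B y ≠ 0) (h2 : orn B C y ≠ 0) (h3 : orn C A y ≠ 0) :
    phi A B C y + phi B C A y + phi C A B y = if inT A B C y then 1 else 0 := by
  have e1 : orn B C A = orn A B C := orn_rot _ _ _
  have e2 : orn C A B = orn A B C := by rw [orn_rot, orn_rot]
  have := sgn_count (a := A.1 - y.1) (b := B.1 - y.1) (c := C.1 - y.1) (S := orn A B C)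
    (sub_ne_zero.2 hA) (sub_ne_zero.2 hB) (sub_ne_zero.2 hC) h1 h2 h3 hS (by unfold orn; ring) (by unfold orn; ring)
  unfold phi inT
  rw [e1, e2, this]
  congr

theorem phi_cancel {A B C D y : ℝ × ℝ} (h : orn A B C * orn A B D < 0) : phi A B C y + phi A B D y = 0 := by
  unfold phi
  rcases mul_neg_iff.1 h with ⟨h1, h2⟩ | ⟨h1, h2⟩
  · rw [if_neg h1.not_gt, if_pos h2]; ring
  · rw [if_neg h2.not_gt, if_pos h1]; ring

theorem phi_symm (A B C y : ℝ × ℝ) (h : orn A B C ≠ 0) : phi A B C y = phi B A C y := by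
  unfold phi
  rw [orn_swap A B C, orn_swap A B y]
  rcases lt_or_gt_of_ne h with h | h
  · rw [if_pos h, if_neg (by linarith)]; unfold W; simp only [neg_pos, Left.neg_neg_iff]; ring
  · rw [if_neg h.not_gt, if_pos (by linarith)]; unfold W; simp only [neg_pos, Left.neg_neg_iff]; ring

/-- positive contribution, left to right -/
def good (A B C y : ℝ × ℝ) : Prop := A.1 < y.1 ∧ y.1 < B.1 ∧ orn A B y < 0 ∧ orn A B C < 0

open Classical in
theorem phi_le {A B C y : ℝ × ℝ} (h : orn A B C ≠ 0) :
    phi A B C y ≤ (if good A B C y then 1 else 0) + (if good B A C y then 1 else 0) := by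
  unfold phi good
  rw [orn_swap A B C, orn_swap A B y]
  unfold W
  rcases lt_or_gt_of_ne h with h | h
  · simp only [h, if_true, sub_neg, sub_pos, and_true]
    split_ifs <;> grind
  · simp only [h.not_gt, if_false, sub_neg, sub_pos, and_false, Left.neg_neg_iff, h, and_true]
    split_ifs <;> grind

theorem exists_avoid {κ : Type} (s : Finset κ) (l : κ → ℝ × ℝ) (c : κ → ℝ) (hl : ∀ i ∈ s, l i ≠ 0) :
    ∀ U : Set (ℝ × ℝ), IsOpen U → U.Nonempty → ∃ y ∈ U, ∀ i ∈ s, dt (l i) y ≠ c i := by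
  classical
  induction s using Finset.induction_on with
  | empty => rintro U _ ⟨y, hy⟩; exact ⟨y, hy, by simp⟩
  | insert i s hi ih =>
    intro U hU hne
    have hn : (U ∩ {y | dt (l i) y ≠ c i}).Nonempty := by
      obtain ⟨y, hy⟩ := hne
      by_cases h : dt (l i) y = c i
      · have hli := dt_self_pos (hl i (Finset.mem_insert_self _ _))
        have hc : Filter.Tendsto (fun s : ℝ => y + s • l i) (nhdsWithin 0 (Set.Ioi 0)) (nhds y) := by
          have : Continuous (fun s : ℝ => y + s • l i) := by fun_prop
          have h0 := this.tendsto 0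
          simp only [zero_smul, add_zero] at h0
          exact h0.mono_left nhdsWithin_le_nhds
        obtain ⟨s, hs1, hs2⟩ := ((hc.eventually (hU.mem_nhds hy)).and self_mem_nhdsWithin).exists
        refine ⟨_, hs1, ?_⟩
        simp only [Set.mem_setOf_eq, dt_add, dt_smul, h]
        have : 0 < s * dt (l i) (l i) := mul_pos hs2 hli
        linarith
      · exact ⟨y, hy, h⟩
    obtain ⟨y, hy, h⟩ := ih (fun j hj => hl j (Finset.mem_insert_of_mem hj)) (U ∩ {y | dt (l i) y ≠ c i})
      (hU.inter (isOpen_ne_fun (dt_cont _) continuous_const)) hn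
    refine ⟨y, hy.1, ?_⟩
    intro j hj
    rcases Finset.mem_insert.1 hj with rfl | hj
    · exact hy.2
    · exact h j hj

variable {ι : Type} [Fintype ι] [DecidableEq ι]
variable {D : TriDisk ι} {f : ℝ × ℝ → ℝ × ℝ} {C : Set (ℝ × ℝ)} {lam : ι → ι → ℝ} {h : ι → ℝ × ℝ}

/-- generic point -/
def gen (h : ι → ℝ × ℝ) (y : ℝ × ℝ) : Prop :=
  (∀ v, (h v).1 ≠ y.1) ∧ ∀ a b, h a ≠ h b → orn (h a) (h b) y ≠ 0

theorem exists_gen (h : ι → ℝ × ℝ) {U : Set (ℝ × ℝ)} (hU : IsOpen U) (hne : U.Nonempty) : ∃ y ∈ U, gen h y := by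
  classical
  obtain ⟨y, hy, h1⟩ := exists_avoid (Finset.univ : Finset ι) (fun _ => ((1, 0) : ℝ × ℝ)) (fun v => (h v).1)
    (fun _ _ => by simp) U hU hne
  have hU2 : IsOpen (U ∩ ⋂ v : ι, {y : ℝ × ℝ | dt (1, 0) y ≠ (h v).1}) :=
    hU.inter (isOpen_iInter_of_finite fun v => isOpen_ne_fun (dt_cont _) continuous_const)
  obtain ⟨z, ⟨hz1, hz2⟩, hz3⟩ := exists_avoid ((Finset.univ : Finset (ι × ι)).filter (fun p => h p.1 ≠ h p.2))
    (fun p => prp (h p.1) (h p.2)) (fun p => dt (prp (h p.1) (h p.2)) (h p.1))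
    (fun p hp => prp_ne (by simpa using hp)) _ hU2 ⟨y, hy, by simpa using h1⟩
  refine ⟨z, hz1, ?_, ?_⟩
  · intro v hv
    have := Set.mem_iInter.1 hz2 v
    simp only [Set.mem_setOf_eq, dt] at this
    apply this; rw [hv]; ring
  · intro a b hab
    have := hz3 (a, b) (by simpa using hab)
    rw [← dt_prp]
    exact sub_ne_zero.2 this

end EX

namespace EX

variable {ι : Type} [Fintype ι] [DecidableEq ι]
variable {D : TriDisk ι} {f : ℝ × ℝ → ℝ × ℝ} {C : Set (ℝ × ℝ)} {lam : ι → ι → ℝ} {h : ι → ℝ × ℝ}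

theorem two_sided {a b c : ι} (hc : T D a b c) (hb : ¬ D.IsBoundaryEdge a b) :
    ∃ d, T D a b d ∧ orn (D.pos a) (D.pos b) (D.pos c) * orn (D.pos a) (D.pos b) (D.pos d) < 0 := by
  by_contra hn
  push Not at hn
  exact hb (boundary_of_onesided hc fun d hd => not_lt.2 (hn d hd))

theorem h_ne (H : Hyp D f C) (hW : Wt D lam) (hs : Sol D lam f h) {a b : ι} (he : E D a b) : h a ≠ h b := by
  obtain ⟨c, hc⟩ := he
  intro h0
  apply nondeg H hW hs hc
  rw [h0, orn_self'']

open Classical in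
theorem edge_sum (H : Hyp D f C) (hW : Wt D lam) (hs : Sol D lam f h) (y : ℝ × ℝ) (a b : ι) :
    ∑ c, (if T D a b c then phi (h a) (h b) (h c) y else 0) ≤
      (if ∃ c, T D a b c ∧ D.IsBoundaryEdge a b ∧ good (h a) (h b) (h c) y then 1 else 0) +
      (if ∃ c, T D b a c ∧ D.IsBoundaryEdge b a ∧ good (h b) (h a) (h c) y then 1 else 0) := by
  have hnn : ∀ (p : Prop) [Decidable p], (0 : ℤ) ≤ if p then 1 else 0 := by intro p _; split_ifs <;> simp
  by_cases he : ∃ c, T D a b c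
  swap
  · rw [Finset.sum_eq_zero]
    · exact add_nonneg (hnn _) (hnn _)
    · intro c _
      rw [if_neg]
      exact fun hc => he ⟨c, hc⟩
  obtain ⟨c, hc⟩ := he
  by_cases hb : D.IsBoundaryEdge a b
  · rw [Finset.sum_eq_single c]
    · rw [if_pos hc]
      refine (phi_le (nondeg H hW hs hc)).trans ?_
      gcongr
      · split_ifs with h1 h2 h2
        · exact le_rfl
        · exact absurd ⟨c, hc, hb, h1⟩ h2
        · exact zero_le_one
        · exact le_rfl
      · split_ifs with h1 h2 h2
        · exact le_rfl
        · exact absurd ⟨c, hc.swap, be_symm hb, h1⟩ h2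
        · exact zero_le_one
        · exact le_rfl
    · intro d _ hdc
      rw [if_neg]
      intro hd
      rcases lt_or_gt_of_ne (mul_ne_zero (T_orn hc) (T_orn hd)) with h1 | h1
      · exact not_boundary_of_twosided hc hd h1 hb
      · exact hdc (unique_side hc hd h1).symm
    · simp
  · obtain ⟨d, hd, ho⟩ := two_sided hc hb
    have hcd : c ≠ d := by
      rintro rfl; nlinarith [mul_self_nonneg (orn (D.pos a) (D.pos b) (D.pos c))]
    rw [Finset.sum_eq_add c d hcd]
    · rw [if_pos hc, if_pos hd, phi_cancel (int_edge H hW hs hc hd ho)]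
      exact add_nonneg (hnn _) (hnn _)
    · rintro e _ ⟨hec, hed⟩
      rw [if_neg]
      intro het
      rcases lt_or_gt_of_ne (mul_ne_zero (T_orn hc) (T_orn het)) with h1 | h1
      · refine hed (unique_side hd het ?_).symm
        rcases mul_neg_iff.1 ho with h2 | h2 <;> rcases mul_neg_iff.1 h1 with h3 | h3
        · exact mul_pos_of_neg_of_neg h2.2 h3.2
        · linarith
        · linarith
        · exact mul_pos h2.2 h3.2
      · exact hec (unique_side hc het h1).symm
    · simp
    · simp

/-- the point of the segment over `x` -/
theorem exists_over {A B : ℝ × ℝ} {x : ℝ} (h1 : A.1 < x) (h2 : x < B.1) :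
    ∃ s t : ℝ, 0 < s ∧ 0 < t ∧ s + t = 1 ∧ (s • A + t • B).1 = x := by
  have hp : 0 < B.1 - A.1 := by linarith
  refine ⟨(B.1 - x) / (B.1 - A.1), (x - A.1) / (B.1 - A.1), div_pos (by linarith) hp, div_pos (by linarith) hp, ?_, ?_⟩
  · rw [← add_div, div_eq_one_iff_eq hp.ne']; ring
  · simp only [Prod.fst_add, Prod.smul_fst, smul_eq_mul]
    rw [div_mul_eq_mul_div, div_mul_eq_mul_div, ← add_div, div_eq_iff hp.ne']; ring

theorem seg_eq {a b a' b' : ι} (he : E D a b) (he' : E D a' b') {z : ℝ × ℝ}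
    (hz : z ∈ openSegment ℝ (D.pos a) (D.pos b)) (hz' : z ∈ segment ℝ (D.pos a') (D.pos b')) :
    (a = a' ∨ a = b') ∧ (b = a' ∨ b = b') := by
  have key : z ∈ hl D ({a, b} ∩ {a', b'}) := by
    rw [← he.fc.inter he'.fc, hl_pair, hl_pair]
    exact ⟨openSegment_subset_segment _ _ _ hz, hz'⟩
  have hab : D.pos a ≠ D.pos b := fun h => he.ne (D.inj h)
  have hza : z ≠ D.pos a := by
    rintro rfl; exact hab (left_mem_openSegment_iff.1 hz)
  have hzb : z ≠ D.pos b := by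
    rintro rfl; exact hab (right_mem_openSegment_iff.1 hz)
  have main : ∀ k, ({a, b} ∩ {a', b'} : Finset ι) ⊆ {k} → z = D.pos k := by
    intro k hk
    have : z ∈ hl D {k} := convexHull_mono (Set.image_mono (by exact_mod_cast hk)) key
    rwa [hl_single] at this
  constructor
  · by_contra hn
    push Not at hn
    refine hzb (main b ?_)
    intro x
    simp only [Finset.mem_inter, Finset.mem_insert, Finset.mem_singleton]
    rintro ⟨rfl | rfl, h2 | h2⟩
    · exact absurd h2 hn.1
    · exact absurd h2 hn.2
    · rfl
    · rfl
  · by_contra hn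
    push Not at hn
    refine hza (main a ?_)
    intro x
    simp only [Finset.mem_inter, Finset.mem_insert, Finset.mem_singleton]
    rintro ⟨rfl | rfl, h2 | h2⟩
    · rfl
    · rfl
    · exact absurd h2 hn.1
    · exact absurd h2 hn.2

theorem be_mem (H : Hyp D f C) {a b : ι} (hb : D.IsBoundaryEdge a b) {s t : ℝ} (hs : 0 ≤ s) (ht : 0 ≤ t)
    (hst : s + t = 1) : s • f (D.pos a) + t • f (D.pos b) ∈ C := by
  exact H.conv (H.mem (bdl hb)) (H.mem (bdr hb)) hs ht hst

theorem good_unique (H : Hyp D f C) (hW : Wt D lam) (hs : Sol D lam f h) {y : ℝ × ℝ} {a b c a' b' c' : ι}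
    (hc : T D a b c) (hb : D.IsBoundaryEdge a b) (hg : good (h a) (h b) (h c) y)
    (hc' : T D a' b' c') (hb' : D.IsBoundaryEdge a' b') (hg' : good (h a') (h b') (h c') y) :
    a = a' ∧ b = b' := by
  obtain ⟨g1, g2, _, g4⟩ := hg
  obtain ⟨g1', g2', _, g4'⟩ := hg'
  have B1 := (bdry_edge H hW hs hc hb).1
  have B2 := (bdry_edge H hW hs hc' hb').1
  obtain ⟨s, t, hs0, ht0, hst, hx⟩ := exists_over g1 g2
  obtain ⟨s', t', hs0', ht0', hst', hx'⟩ := exists_over g1' g2'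
  have e1 : s • h a + t • h b = s • f (D.pos a) + t • f (D.pos b) := by
    rw [hs.bdry a (bdl hb), hs.bdry b (bdr hb)]
  have e2 : s' • h a' + t' • h b' = s' • f (D.pos a') + t' • f (D.pos b') := by
    rw [hs.bdry a' (bdl hb'), hs.bdry b' (bdr hb')]
  set z := s • h a + t • h b with hz
  set z' := s' • h a' + t' • h b' with hz'
  have zC : z ∈ C := by rw [e1]; exact be_mem H hb hs0.le ht0.le hst
  have zC' : z' ∈ C := by rw [e2]; exact be_mem H hb' hs0'.le ht0'.le hst'
  have o1 : orn (h a) (h b) z' ≤ 0 := by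
    have := B1 _ zC'
    by_contra hn; push Not at hn; nlinarith
  have o2 : orn (h a') (h b') z ≤ 0 := by
    have := B2 _ zC
    by_contra hn; push Not at hn; nlinarith
  have i1 : orn (h a) (h b) z = 0 := by
    rw [hz, orn_combo2 _ _ _ _ _ _ hst, orn_self, orn_self']; ring
  have i2 : orn (h a') (h b') z' = 0 := by
    rw [hz', orn_combo2 _ _ _ _ _ _ hst', orn_self, orn_self']; ring
  have d1 : orn (h a) (h b) z' - orn (h a) (h b) z = ((h b).1 - (h a).1) * (z'.2 - z.2) := by
    unfold orn; rw [hx, hx']; ring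
  have d2 : orn (h a') (h b') z - orn (h a') (h b') z' = ((h b').1 - (h a').1) * (z.2 - z'.2) := by
    unfold orn; rw [hx, hx']; ring
  have l1 : z'.2 ≤ z.2 := by
    by_contra hn; push Not at hn
    have : 0 < ((h b).1 - (h a).1) * (z'.2 - z.2) := mul_pos (by linarith) (by linarith)
    linarith
  have l2 : z.2 ≤ z'.2 := by
    by_contra hn; push Not at hn
    have : 0 < ((h b').1 - (h a').1) * (z.2 - z'.2) := mul_pos (by linarith) (by linarith)
    linarith
  have hzz : z = z' := Prod.ext (hx.trans hx'.symm) (le_antisymm l2 l1)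
  have hf : f (s • D.pos a + t • D.pos b) = f (s' • D.pos a' + t' • D.pos b') := by
    rw [H.combo hb hs0.le ht0.le hst, H.combo hb' hs0'.le ht0'.le hst', ← e1, ← e2, hzz]
  have hpp := H.inj (hb.2 ⟨s, t, hs0.le, ht0.le, hst, rfl⟩) (hb'.2 ⟨s', t', hs0'.le, ht0'.le, hst', rfl⟩) hf
  have := seg_eq (be_E hb) (be_E hb') (z := s • D.pos a + t • D.pos b) ⟨s, t, hs0, ht0, hst, rfl⟩
    (by rw [hpp]; exact ⟨s', t', hs0'.le, ht0'.le, hst', rfl⟩)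
  obtain ⟨q1 | q1, q2 | q2⟩ := this
  · subst q1; subst q2; exact absurd rfl (be_E hb).ne
  · exact ⟨q1, q2⟩
  · subst q1; subst q2; linarith
  · subst q1; subst q2; exact absurd rfl (be_E hb).ne

open Classical in
theorem count_le (H : Hyp D f C) (hW : Wt D lam) (hs : Sol D lam f h) {y : ℝ × ℝ} (hy : gen h y) :
    ∑ a, ∑ b, ∑ c, (if T D a b c ∧ inT (h a) (h b) (h c) y then (1 : ℤ) else 0) ≤ 6 := by
  set F : ι → ι → ι → ℤ := fun a b c => if T D a b c then phi (h a) (h b) (h c) y else 0 with hF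
  have e1 : ∀ a b c, (if T D a b c ∧ inT (h a) (h b) (h c) y then (1 : ℤ) else 0) = F a b c + F b c a + F c a b := by
    intro a b c
    simp only [hF]
    by_cases ht : T D a b c
    · rw [if_pos ht, if_pos ht.rot, if_pos ht.rot.rot, tri_count (nondeg H hW hs ht) (hy.1 _) (hy.1 _) (hy.1 _)
        (hy.2 _ _ (h_ne H hW hs ht.e)) (hy.2 _ _ (h_ne H hW hs ht.rot.e)) (hy.2 _ _ (h_ne H hW hs ht.rot.rot.e))]
      simp [ht]
    · have h1 : ¬ T D b c a := fun h' => ht h'.rot.rot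
      have h2 : ¬ T D c a b := fun h' => ht h'.rot
      simp [ht, h1, h2]
  simp only [e1, Finset.sum_add_distrib]
  have rot3 : ∀ F : ι → ι → ι → ℤ, ∑ a, ∑ b, ∑ c, F b c a = ∑ a, ∑ b, ∑ c, F a b c := by
    intro F
    rw [Finset.sum_comm]
    refine Finset.sum_congr rfl fun b _ => ?_
    rw [Finset.sum_comm]
  have r1 := rot3 F
  have r2 : ∑ a, ∑ b, ∑ c, F c a b = ∑ a, ∑ b, ∑ c, F a b c := by
    have := rot3 (fun a b c => F c a b)
    exact this.symm
  rw [r1, r2]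
  set Q : ι → ι → Prop := fun a b => ∃ c, T D a b c ∧ D.IsBoundaryEdge a b ∧ good (h a) (h b) (h c) y with hQ
  have hle : ∑ a, ∑ b, ∑ c, F a b c ≤ ∑ a, ∑ b, ((if Q a b then 1 else 0) + (if Q b a then 1 else 0)) :=
    Finset.sum_le_sum fun a _ => Finset.sum_le_sum fun b _ => edge_sum H hW hs y a b
  have h1 : ∑ a, ∑ b, (if Q a b then (1 : ℤ) else 0) ≤ 1 := by
    rw [← Finset.sum_product', Finset.univ_product_univ, Finset.sum_boole]
    norm_cast
    rw [Finset.card_le_one]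
    rintro ⟨a, b⟩ h1 ⟨a', b'⟩ h2
    simp only [Finset.mem_filter, Finset.mem_univ, true_and] at h1 h2
    obtain ⟨c, hc, hb, hg⟩ := h1
    obtain ⟨c', hc', hb', hg'⟩ := h2
    obtain ⟨rfl, rfl⟩ := good_unique H hW hs hc hb hg hc' hb' hg'
    rfl
  have h2 : ∑ a, ∑ b, (if Q b a then (1 : ℤ) else 0) ≤ 1 := by
    rw [Finset.sum_comm]; exact h1
  simp only [Finset.sum_add_distrib] at hle
  linarith

theorem inT_rot {A B C y : ℝ × ℝ} (h : inT A B C y) : inT B C A y := by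
  unfold inT at *; rw [orn_rot A B C]; exact ⟨h.2.1, h.2.2, h.1⟩

theorem inT_swap {A B C y : ℝ × ℝ} (h : inT A B C y) : inT B A C y := by
  unfold inT at *; rw [orn_swap A B C, orn_swap A B, orn_swap C A, orn_swap B C]
  refine ⟨by linarith [h.1], by linarith [h.2.2], by linarith [h.2.1]⟩

def six (a b c : ι) : Finset (ι × ι × ι) := {(a, b, c), (b, c, a), (c, a, b), (b, a, c), (a, c, b), (c, b, a)}

theorem six_card {a b c : ι} (h1 : a ≠ b) (h2 : b ≠ c) (h3 : a ≠ c) : (six a b c).card = 6 := by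
  unfold six
  rw [Finset.card_insert_of_notMem, Finset.card_insert_of_notMem, Finset.card_insert_of_notMem,
    Finset.card_insert_of_notMem, Finset.card_insert_of_notMem, Finset.card_singleton] <;>
  simp [h1, h2, h3, h1.symm, h2.symm, h3.symm]

theorem six_vset {a b c : ι} {t : ι × ι × ι} (h : t ∈ six a b c) : vset t = {a, b, c} := by
  simp only [six, Finset.mem_insert, Finset.mem_singleton] at h
  rcases h with rfl | rfl | rfl | rfl | rfl | rfl <;> (ext z; simp only [vset, Finset.mem_insert, Finset.mem_singleton] <;> tauto)

theorem same_vset (H : Hyp D f C) (hW : Wt D lam) (hs : Sol D lam f h) {y : ℝ × ℝ} (hy : gen h y)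
    {a b c a' b' c' : ι} (ht : T D a b c) (ht' : T D a' b' c') (hi : inT (h a) (h b) (h c) y)
    (hi' : inT (h a') (h b') (h c') y) : ({a, b, c} : Finset ι) = {a', b', c'} := by
  classical
  by_contra hne
  have hcount := count_le H hW hs hy
  have e : ∑ a, ∑ b, ∑ c, (if T D a b c ∧ inT (h a) (h b) (h c) y then (1 : ℤ) else 0) =
      ∑ t : ι × ι × ι, if T D t.1 t.2.1 t.2.2 ∧ inT (h t.1) (h t.2.1) (h t.2.2) y then (1 : ℤ) else 0 := by
    rw [Fintype.sum_prod_type]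
    refine Finset.sum_congr rfl fun a _ => ?_
    rw [Fintype.sum_prod_type]
  rw [e, Finset.sum_boole] at hcount
  have key : ∀ a b c, T D a b c → inT (h a) (h b) (h c) y → six a b c ⊆
      Finset.univ.filter (fun t : ι × ι × ι => T D t.1 t.2.1 t.2.2 ∧ inT (h t.1) (h t.2.1) (h t.2.2) y) := by
    intro a b c ht hi t hm
    simp only [Finset.mem_filter, Finset.mem_univ, true_and]
    simp only [six, Finset.mem_insert, Finset.mem_singleton] at hm
    rcases hm with rfl | rfl | rfl | rfl | rfl | rfl
    · exact ⟨ht, hi⟩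
    · exact ⟨ht.rot, inT_rot hi⟩
    · exact ⟨ht.rot.rot, inT_rot (inT_rot hi)⟩
    · exact ⟨ht.swap, inT_swap hi⟩
    · exact ⟨ht.rot.rot.swap, inT_swap (inT_rot (inT_rot hi))⟩
    · exact ⟨ht.rot.swap, inT_swap (inT_rot hi)⟩
  have hd : Disjoint (six a b c) (six a' b' c') := by
    rw [Finset.disjoint_left]
    intro t h1 h2
    exact hne ((six_vset h1).symm.trans (six_vset h2))
  have hc := Finset.card_le_card (Finset.union_subset (key a b c ht hi) (key a' b' c' ht' hi'))
  rw [Finset.card_union_of_disjoint hd, six_card ht.ne ht.rot.ne ht.rot.rot.ne.symm,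
    six_card ht'.ne ht'.rot.ne ht'.rot.rot.ne.symm] at hc
  have : (12 : ℤ) ≤ 6 := le_trans (by exact_mod_cast hc) hcount
  norm_num at this

end EX

namespace EX

theorem exists_aff {A B C : ℝ × ℝ} (ho : orn A B C ≠ 0) (P Q R : ℝ × ℝ) :
    ∃ g : (ℝ × ℝ) →ᵃ[ℝ] (ℝ × ℝ), g A = P ∧ g B = Q ∧ g C = R := by
  have hdet : (B - A).1 * (C - A).2 - (B - A).2 * (C - A).1 ≠ 0 := ho
  obtain ⟨α, β, h1, h2⟩ := exists_lin hdet (Q - P).1 (R - P).1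
  obtain ⟨α', β', h1', h2'⟩ := exists_lin hdet (Q - P).2 (R - P).2
  let L : (ℝ × ℝ) →ₗ[ℝ] (ℝ × ℝ) := (LinearMap.fst ℝ ℝ ℝ).smulRight (α, α') + (LinearMap.snd ℝ ℝ ℝ).smulRight (β, β')
  have hL : ∀ x, L x = (α * x.1 + β * x.2, α' * x.1 + β' * x.2) := by
    intro x; ext <;> simp [L] <;> ring
  refine ⟨L.toAffineMap + AffineMap.const ℝ _ (P - L A), ?_, ?_, ?_⟩
  · simp
  · have e : L B - L A = Q - P := by
      rw [← map_sub, hL]; exact Prod.ext h1 h1'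
    have : L B = L A + (Q - P) := by rw [← e]; abel
    simp only [AffineMap.coe_add, Pi.add_apply, LinearMap.coe_toAffineMap, AffineMap.const_apply, this]; abel
  · have e : L C - L A = R - P := by
      rw [← map_sub, hL]; exact Prod.ext h2 h2'
    have : L C = L A + (R - P) := by rw [← e]; abel
    simp only [AffineMap.coe_add, Pi.add_apply, LinearMap.coe_toAffineMap, AffineMap.const_apply, this]; abel

theorem aff_combo (g : (ℝ × ℝ) →ᵃ[ℝ] (ℝ × ℝ)) {A B C : ℝ × ℝ} {α β γ : ℝ} (hs : α + β + γ = 1) :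
    g (α • A + β • B + γ • C) = α • g A + β • g B + γ • g C := by
  have hd : ∀ x, g x = g.linear x + g 0 := fun x => congrFun g.decomp x
  rw [hd (α • A + β • B + γ • C), hd A, hd B, hd C]
  simp only [map_add, map_smul]
  have : α = 1 - β - γ := by linarith
  subst this
  module

variable {ι : Type} [Fintype ι] [DecidableEq ι]
variable {D : TriDisk ι} {f : ℝ × ℝ → ℝ × ℝ} {C : Set (ℝ × ℝ)} {lam : ι → ι → ℝ} {h : ι → ℝ × ℝ}

theorem exists_G (D : TriDisk ι) (h : ι → ℝ × ℝ) : ∃ G : ℝ × ℝ → ℝ × ℝ, D.SLOn G ∧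
    ∀ a b c, T D a b c → ∀ α β γ : ℝ, 0 ≤ α → 0 ≤ β → 0 ≤ γ → α + β + γ = 1 →
      G (α • D.pos a + β • D.pos b + γ • D.pos c) = α • h a + β • h b + γ • h c := by
  classical
  have hg : ∀ t : ι × ι × ι, ∃ g : (ℝ × ℝ) →ᵃ[ℝ] (ℝ × ℝ), t ∈ D.tris → ∀ i ∈ vset t, g (D.pos i) = h i := by
    intro t
    by_cases ht : t ∈ D.tris
    · obtain ⟨g, h1, h2, h3⟩ := exists_aff (T_orn (T_of_mem ht)) (h t.1) (h t.2.1) (h t.2.2)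
      refine ⟨g, fun _ i hi => ?_⟩
      simp only [vset, Finset.mem_insert, Finset.mem_singleton] at hi
      rcases hi with rfl | rfl | rfl <;> assumption
    · exact ⟨AffineMap.const ℝ _ 0, fun h => absurd h ht⟩
  choose g hg using hg
  have key : ∀ s ∈ D.tris, ∀ t ∈ D.tris, ∀ x, x ∈ triSet D.pos s → x ∈ triSet D.pos t → g s x = g t x := by
    intro s hs t ht x hxs hxt
    have hx : x ∈ convexHull ℝ (D.pos '' ((vset s ∩ vset t : Finset ι) : Set ι)) := by
      rw [← D.glue s hs t ht]; exact ⟨hxs, hxt⟩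
    have hsub : convexHull ℝ (D.pos '' ((vset s ∩ vset t : Finset ι) : Set ι)) ⊆ {x | g s x = g t x} := by
      refine convexHull_min ?_ ?_
      · rintro _ ⟨i, hi, rfl⟩
        have hi' := Finset.mem_inter.1 (Finset.mem_coe.1 hi)
        simp only [Set.mem_setOf_eq]
        rw [hg s hs i hi'.1, hg t ht i hi'.2]
      · intro p hp q hq a b _ _ hab
        simp only [Set.mem_setOf_eq] at *
        rw [Convex.combo_affine_apply hab, Convex.combo_affine_apply hab, hp, hq]
    exact hsub hx
  let G : ℝ × ℝ → ℝ × ℝ := fun x => if hx : ∃ t, t ∈ D.tris ∧ x ∈ triSet D.pos t then g hx.choose x else 0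
  have hG : ∀ t ∈ D.tris, ∀ x ∈ triSet D.pos t, G x = g t x := by
    intro t ht x hx
    have hex : ∃ t, t ∈ D.tris ∧ x ∈ triSet D.pos t := ⟨t, ht, hx⟩
    simp only [G, dif_pos hex]
    exact key _ hex.choose_spec.1 t ht x hex.choose_spec.2 hx
  refine ⟨G, fun t ht => ⟨g t, fun x hx => hG t ht x hx⟩, ?_⟩
  rintro a b c ⟨t, ht, hv⟩ α β γ hα hβ hγ hs
  rw [hG t ht _ (by rw [triSet_eq, hv, hl_triple]; exact mem_tri.2 ⟨α, β, γ, hα, hβ, hγ, hs, rfl⟩), aff_combo _ hs,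
    hg t ht a (by simp [hv]), hg t ht b (by simp [hv]), hg t ht c (by simp [hv])]

/-- affine on triangles with vertex values `h` -/
def Gp (D : TriDisk ι) (h : ι → ℝ × ℝ) (G : ℝ × ℝ → ℝ × ℝ) : Prop :=
    ∀ a b c, T D a b c → ∀ α β γ : ℝ, 0 ≤ α → 0 ≤ β → 0 ≤ γ → α + β + γ = 1 →
      G (α • D.pos a + β • D.pos b + γ • D.pos c) = α • h a + β • h b + γ • h c

theorem Gp.two {G : ℝ × ℝ → ℝ × ℝ} (hG : Gp D h G) {a b : ι} (he : E D a b) {s t : ℝ} (hs : 0 ≤ s) (ht : 0 ≤ t)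
    (hst : s + t = 1) : G (s • D.pos a + t • D.pos b) = s • h a + t • h b := by
  obtain ⟨c, hc⟩ := he
  have := hG a b c hc s t 0 hs ht le_rfl (by linarith)
  simpa using this

theorem Gp.one {G : ℝ × ℝ → ℝ × ℝ} (hG : Gp D h G) {a : ι} (hu : usd D a) : G (D.pos a) = h a := by
  obtain ⟨b, hb⟩ := hu
  have := hG.two hb (s := 1) (t := 0) zero_le_one le_rfl (by norm_num)
  simpa using this

theorem eqOn_frontier (H : Hyp D f C) (hs : Sol D lam f h) {G : ℝ × ℝ → ℝ × ℝ} (hG : Gp D h G) :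
    Set.EqOn G f (frontier D.space) := by
  intro x hx
  rcases frontier_cases hx with ⟨v, rfl, hv⟩ | ⟨a, b, hb, s, t, hs0, ht0, hst, rfl⟩
  · rw [hG.one hv, hs.bdry v hx]
  · rw [hG.two (be_E hb) hs0.le ht0.le hst, H.combo hb hs0.le ht0.le hst, hs.bdry a (bdl hb), hs.bdry b (bdr hb)]

/-- shape of the points of the space -/
theorem space_cases {x : ℝ × ℝ} (hx : x ∈ D.space) :
    (∃ a b c, T D a b c ∧ ∃ α β γ : ℝ, 0 < α ∧ 0 < β ∧ 0 < γ ∧ α + β + γ = 1 ∧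
      x = α • D.pos a + β • D.pos b + γ • D.pos c) ∨
    (∃ a b, E D a b ∧ ∃ s t : ℝ, 0 < s ∧ 0 < t ∧ s + t = 1 ∧ x = s • D.pos a + t • D.pos b) ∨
    ∃ a, usd D a ∧ x = D.pos a := by
  obtain ⟨a, b, c, ht, hx⟩ := mem_space.1 hx
  rw [hl_triple] at hx
  obtain ⟨α, β, γ, hα, hβ, hγ, hs, rfl⟩ := mem_tri.1 hx
  rcases hα.eq_or_lt with rfl | hα' <;> rcases hβ.eq_or_lt with rfl | hβ' <;> rcases hγ.eq_or_lt with rfl | hγ'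
  · norm_num at hs
  · right; right
    refine ⟨c, ht.rot.e.usdr, ?_⟩
    have : γ = 1 := by linarith
    subst this; simp
  · right; right
    refine ⟨b, ht.e.usdr, ?_⟩
    have : β = 1 := by linarith
    subst this; simp
  · right; left
    exact ⟨b, c, ht.rot.e, β, γ, hβ', hγ', by linarith, by simp⟩
  · right; right
    refine ⟨a, ht.e.usdl, ?_⟩
    have : α = 1 := by linarith
    subst this; simp
  · right; left
    exact ⟨a, c, ht.rot.rot.e.symm, α, γ, hα', hγ', by linarith, by simp⟩
  · right; left
    exact ⟨a, b, ht.e, α, β, hα', hβ', by linarith, by simp⟩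
  · left
    exact ⟨a, b, c, ht, α, β, γ, hα', hβ', hγ', hs, rfl⟩

theorem not_bd_edge {a b : ι} {s t : ℝ} (hs : 0 < s) (ht : 0 < t) (hst : s + t = 1)
    (hx : s • D.pos a + t • D.pos b ∉ frontier D.space) : ¬ D.IsBoundaryEdge a b :=
  fun hb => hx (hb.2 ⟨s, t, hs.le, ht.le, hst, rfl⟩)

theorem maps_int (H : Hyp D f C) (hW : Wt D lam) (hs : Sol D lam f h) {G : ℝ × ℝ → ℝ × ℝ} (hG : Gp D h G)
    {x : ℝ × ℝ} (hx : x ∈ D.space) (hxf : x ∉ frontier D.space) : G x ∈ interior C := by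
  by_contra hn
  obtain ⟨l, hl, hmin⟩ := support H.conv H.int hn
  have hge : ∀ v, usd D v → dt l (G x) ≤ dt l (h v) := fun v hv => mpc H hW hs hmin hv
  have hbd : ∀ v, usd D v → dt l (h v) = dt l (G x) → bd D v := by
    intro v hv he
    by_contra hb
    have := mpc_strict H hW hs hl hmin hv hb
    linarith
  rcases space_cases hx with ⟨a, b, c, ht, α, β, γ, hα, hβ, hγ, hsum, hxe⟩ | ⟨a, b, he, s, t, hs0, ht0, hst, hxe⟩ |
    ⟨a, hu, hxe⟩
  · have e := hG a b c ht α β γ hα.le hβ.le hγ.le hsum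
    rw [← hxe] at e
    have e2 : dt l (G x) = α * dt l (h a) + β * dt l (h b) + γ * dt l (h c) := by
      conv_lhs => rw [e]
      simp only [dt_add, dt_smul]
    have g1 := hge a ht.e.usdl
    have g2 := hge b ht.e.usdr
    have g3 := hge c ht.rot.e.usdr
    have m1 := mul_nonneg hα.le (sub_nonneg.2 g1)
    have m2 := mul_nonneg hβ.le (sub_nonneg.2 g2)
    have m3 := mul_nonneg hγ.le (sub_nonneg.2 g3)
    have hz : α * (dt l (h a) - dt l (G x)) + β * (dt l (h b) - dt l (G x)) + γ * (dt l (h c) - dt l (G x)) = 0 := by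
      linear_combination -e2 - dt l (G x) * hsum
    refine no_face H hW hs hl hmin ht ?_ ?_ ?_
    · have : α * (dt l (h a) - dt l (G x)) = 0 := by linarith
      have := (mul_eq_zero.1 this).resolve_left hα.ne'
      linarith
    · have : β * (dt l (h b) - dt l (G x)) = 0 := by linarith
      have := (mul_eq_zero.1 this).resolve_left hβ.ne'
      linarith
    · have : γ * (dt l (h c) - dt l (G x)) = 0 := by linarith
      have := (mul_eq_zero.1 this).resolve_left hγ.ne'
      linarith
  · have e := hG.two he hs0.le ht0.le hst
    rw [← hxe] at e
    have e2 : dt l (G x) = s * dt l (h a) + t * dt l (h b) := by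
      conv_lhs => rw [e]
      simp only [dt_add, dt_smul]
    have g1 := hge a he.usdl
    have g2 := hge b he.usdr
    have m1 := mul_nonneg hs0.le (sub_nonneg.2 g1)
    have m2 := mul_nonneg ht0.le (sub_nonneg.2 g2)
    have hz : s * (dt l (h a) - dt l (G x)) + t * (dt l (h b) - dt l (G x)) = 0 := by
      linear_combination -e2 - dt l (G x) * hst
    have ea : dt l (h a) = dt l (G x) := by
      have : s * (dt l (h a) - dt l (G x)) = 0 := by linarith
      have := (mul_eq_zero.1 this).resolve_left hs0.ne'
      linarith
    have eb : dt l (h b) = dt l (G x) := by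
      have : t * (dt l (h b) - dt l (G x)) = 0 := by linarith
      have := (mul_eq_zero.1 this).resolve_left ht0.ne'
      linarith
    have ba := hbd a he.usdl ea
    have bb := hbd b he.usdr eb
    rw [hs.bdry a ba] at ea
    rw [hs.bdry b bb] at eb
    refine not_bd_edge hs0 ht0 hst (by rw [← hxe]; exact hxf) (H.face_edge ba bb he.ne hl ?_ ?_)
    · rw [ea]; exact hmin
    · rw [eb]; exact hmin
  · subst hxe
    exact hxf (hbd a hu (by rw [hG.one hu]))

theorem punct (q : ℝ × ℝ) {r : ℝ} (hr : 0 < r) : IsPreconnected (Metric.ball q r \ {q}) := by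
  have hrank : 1 < Module.rank ℝ (ℝ × ℝ) := by
    apply Module.one_lt_rank_of_one_lt_finrank; simp
  have h0 := (isConnected_compl_singleton_of_one_lt_rank hrank 0).isPreconnected
  have hc : Continuous (fun p : ℝ × ℝ => q + (r / (1 + ‖p‖)) • p) := by
    have hd : Continuous (fun p : ℝ × ℝ => r / (1 + ‖p‖)) :=
      continuous_const.div (continuous_const.add continuous_norm) (fun p => by positivity)
    exact continuous_const.add (hd.smul continuous_id)
  convert h0.image _ hc.continuousOn using 1
  ext y
  simp only [Set.mem_diff, Metric.mem_ball, Set.mem_singleton_iff, Set.mem_image, Set.mem_compl_iff]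
  constructor
  · rintro ⟨h1, h2⟩
    rw [dist_eq_norm] at h1
    have hp : 0 < r - ‖y - q‖ := by linarith
    refine ⟨(1 / (r - ‖y - q‖)) • (y - q), ?_, ?_⟩
    · rw [smul_eq_zero]; push Not
      exact ⟨by positivity, sub_ne_zero.2 h2⟩
    · rw [norm_smul, smul_smul, Real.norm_of_nonneg (by positivity)]
      have : r / (1 + 1 / (r - ‖y - q‖) * ‖y - q‖) * (1 / (r - ‖y - q‖)) = 1 := by
        have e : 1 + 1 / (r - ‖y - q‖) * ‖y - q‖ = r / (r - ‖y - q‖) := by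
          field_simp; ring
        rw [e]; field_simp
      rw [this]; simp
  · rintro ⟨p, hp, rfl⟩
    have hn : 0 < ‖p‖ := norm_pos_iff.2 hp
    constructor
    · rw [dist_eq_norm, add_sub_cancel_left, norm_smul, Real.norm_of_nonneg (by positivity),
        div_mul_eq_mul_div, div_lt_iff₀ (by positivity)]
      nlinarith
    · rw [add_eq_left, smul_eq_zero]
      push Not
      exact ⟨by positivity, hp⟩

theorem combo_nhds {A B C : ℝ × ℝ} (ho : orn A B C ≠ 0) {α β γ : ℝ} (hα : 0 < α) (hβ : 0 < β) (hγ : 0 < γ)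
    (hs : α + β + γ = 1) : (convexHull ℝ {A, B, C} : Set (ℝ × ℝ)) ∈ nhds (α • A + β • B + γ • C) := by
  have h1 : orn B C A ≠ 0 := by rwa [orn_rot]
  have h2 : orn C A B ≠ 0 := by rwa [orn_rot, orn_rot]
  refine tri_nhds ho ?_ ?_ ?_
  · rw [show α • A + β • B + γ • C = β • B + γ • C + α • A by abel, bc_combo h1 (by linarith)]; exact hα
  · rw [show α • A + β • B + γ • C = γ • C + α • A + β • B by abel, bc_combo h2 (by linarith)]; exact hβ
  · rw [bc_combo ho hs]; exact hγ

theorem combo_inj {A B C : ℝ × ℝ} (ho : orn A B C ≠ 0) {α β γ α' β' γ' : ℝ} (hs : α + β + γ = 1)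
    (hs' : α' + β' + γ' = 1) (he : α • A + β • B + γ • C = α' • A + β' • B + γ' • C) :
    α = α' ∧ β = β' ∧ γ = γ' := by
  have h1 : orn B C A ≠ 0 := by rwa [orn_rot]
  have e3 : γ = γ' := by rw [← bc_combo ho hs, he, bc_combo ho hs']
  have e1 : α = α' := by
    rw [← bc_combo h1 (show β + γ + α = 1 by linarith),
      show β • B + γ • C + α • A = α • A + β • B + γ • C by abel, he,
      show α' • A + β' • B + γ' • C = β' • B + γ' • C + α' • A by abel, bc_combo h1 (by linarith)]
  exact ⟨e1, by linarith, e3⟩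

/-- the image of the star of an interior vertex is a neighbourhood -/
theorem star_nhds (H : Hyp D f C) (hW : Wt D lam) (hs : Sol D lam f h) {v : ι} (hu : usd D v) (hv : ¬ bd D v) :
    ∀ᶠ y in nhds (h v), ∃ b c, T D v b c ∧ y ∈ convexHull ℝ {h v, h b, h c} := by
  set S : Set (ℝ × ℝ) := ⋃ (b : ι) (c : ι) (_ : T D v b c), convexHull ℝ {h v, h b, h c} with hS
  have memS : ∀ y, y ∈ S ↔ ∃ b c, T D v b c ∧ y ∈ convexHull ℝ {h v, h b, h c} := by
    intro y; simp only [hS, Set.mem_iUnion, exists_prop]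
  have hSc : IsClosed S := isClosed_iUnion_of_finite fun b => isClosed_iUnion_of_finite fun c =>
    isClosed_iUnion_of_finite fun _ => isClosed_tri _ _ _
  have hopp : ∀ᶠ y in nhds (h v), ∀ b c, T D v b c → y ∉ segment ℝ (h b) (h c) := by
    rw [Filter.eventually_all]; intro b
    rw [Filter.eventually_all]; intro c
    by_cases ht : T D v b c
    · have hcl : IsClosed (segment ℝ (h b) (h c)) := by
        rw [← convexHull_pair]; exact ((Set.toFinite _).isCompact_convexHull (𝕜 := ℝ)).isClosed
      have hno : h v ∉ segment ℝ (h b) (h c) := by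
        intro hm
        have := orn_seg_zero hm
        rw [orn_rot] at this
        exact nondeg H hW hs ht this
      filter_upwards [hcl.isOpen_compl.mem_nhds hno] with y hy _ using hy
    · exact Filter.Eventually.of_forall fun y h' => absurd h' ht
  obtain ⟨r, hr, hball⟩ := Metric.eventually_nhds_iff_ball.1 hopp
  have hne_edge : ∀ b, E D v b → ¬ D.IsBoundaryEdge v b := fun b _ hb => hv (bdl hb)
  have hsub : Metric.ball (h v) r \ {h v} ⊆ S := by
    refine sub_of_avoid (punct _ hr) hSc ?_ ?_
    · rintro y ⟨hy1, hy2⟩ hyf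
      rw [hSc.frontier_eq] at hyf
      obtain ⟨b, c, ht, hm⟩ := (memS y).1 hyf.1
      obtain ⟨α, β, γ, hα, hβ, hγ, hsum, hye⟩ := mem_tri.1 hm
      apply hyf.2
      rw [mem_interior_iff_mem_nhds]
      have edge : ∀ b c, T D v b c → ∀ α β : ℝ, 0 < α → 0 < β → α + β = 1 → y = α • h v + β • h b → S ∈ nhds y := by
        intro b c ht α β hα hβ hsum hye
        obtain ⟨d, hd, ho⟩ := two_sided ht (hne_edge b ht.e)
        have := edge_nhds (int_edge H hW hs ht hd ho) (x := y) ⟨α, β, hα, hβ, hsum, hye.symm⟩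
        filter_upwards [this] with z hz
        rw [memS]
        rcases hz with hz | hz
        · exact ⟨b, c, ht, hz⟩
        · exact ⟨b, d, hd, hz⟩
      rcases hα.eq_or_lt with rfl | hα
      · exfalso
        refine hball y hy1 b c ht ⟨β, γ, hβ, hγ, by linarith, ?_⟩
        rw [hye]; simp
      rcases hβ.eq_or_lt with rfl | hβ <;> rcases hγ.eq_or_lt with rfl | hγ
      · exfalso
        have : α = 1 := by linarith
        subst this
        apply hy2; rw [hye]; simp
      · exact edge c b ht.rot.rot.swap α γ hα hγ (by linarith) (by rw [hye]; simp)
      · exact edge b c ht α β hα hβ (by linarith) (by rw [hye]; simp)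
      · have := combo_nhds (nondeg H hW hs ht) hα hβ hγ hsum
        rw [← hye] at this
        filter_upwards [this] with z hz
        rw [memS]; exact ⟨b, c, ht, hz⟩
    · obtain ⟨b, c, ht⟩ := hu
      have hc : Filter.Tendsto (fun s : ℝ => (1 - s) • h v + s • h b + (0 : ℝ) • h c)
          (nhdsWithin 0 (Set.Ioi 0)) (nhds (h v)) := by
        have : Continuous (fun s : ℝ => (1 - s) • h v + s • h b + (0 : ℝ) • h c) := by fun_prop
        have h0 := this.tendsto 0
        simp only [sub_zero, one_smul, zero_smul, add_zero] at h0
        simp only [zero_smul, add_zero]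
        exact h0.mono_left nhdsWithin_le_nhds
      have h1 : ∀ᶠ s : ℝ in nhdsWithin 0 (Set.Ioi 0), s < 1 :=
        (gt_mem_nhds (show (0 : ℝ) < 1 by norm_num)).filter_mono nhdsWithin_le_nhds
      obtain ⟨s, ⟨hs1, hs2⟩, hs3⟩ := (((hc.eventually (Metric.ball_mem_nhds _ hr)).and self_mem_nhdsWithin).and h1).exists
      have hs2' : 0 < s := hs2
      refine ⟨_, ⟨hs1, ?_⟩, (memS _).2 ⟨b, c, ht, mem_tri.2 ⟨1 - s, s, 0, by linarith, hs2'.le, le_rfl, by ring, rfl⟩⟩⟩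
      intro he
      have he' : (1 - s) • h v + s • h b + (0 : ℝ) • h c = (1 : ℝ) • h v + (0 : ℝ) • h b + (0 : ℝ) • h c := by
        rw [Set.mem_singleton_iff.1 he]; simp
      have := combo_inj (nondeg H hW hs ht) (by ring) (by norm_num) he'
      linarith [this.2.1]
  filter_upwards [Metric.ball_mem_nhds (h v) hr] with y hy
  rw [← memS]
  by_cases he : y = h v
  · obtain ⟨b, c, ht⟩ := hu
    rw [he, memS]
    exact ⟨b, c, ht, subset_convexHull ℝ _ (by simp)⟩
  · exact hsub ⟨hy, he⟩

theorem local_cover (H : Hyp D f C) (hW : Wt D lam) (hs : Sol D lam f h) {G : ℝ × ℝ → ℝ × ℝ} (hG : Gp D h G)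
    {x : ℝ × ℝ} (hx : x ∈ D.space) (hxf : x ∉ frontier D.space) :
    ∀ᶠ y in nhds (G x), ∃ a b c, T D a b c ∧ x ∈ hl D {a, b, c} ∧ y ∈ convexHull ℝ {h a, h b, h c} := by
  rcases space_cases hx with ⟨a, b, c, ht, α, β, γ, hα, hβ, hγ, hsum, hxe⟩ | ⟨a, b, he, s, t, hs0, ht0, hst, hxe⟩ |
    ⟨a, hu, hxe⟩
  · have e := hG a b c ht α β γ hα.le hβ.le hγ.le hsum
    rw [← hxe] at e
    rw [e]
    filter_upwards [combo_nhds (nondeg H hW hs ht) hα hβ hγ hsum] with y hy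
    refine ⟨a, b, c, ht, ?_, hy⟩
    rw [hl_triple]; exact mem_tri.2 ⟨α, β, γ, hα.le, hβ.le, hγ.le, hsum, hxe⟩
  · have e := hG.two he hs0.le ht0.le hst
    rw [← hxe] at e
    obtain ⟨c, hc⟩ := he
    obtain ⟨d, hd, ho⟩ := two_sided hc (not_bd_edge hs0 ht0 hst (by rw [← hxe]; exact hxf))
    have hseg : x ∈ segment ℝ (D.pos a) (D.pos b) := ⟨s, t, hs0.le, ht0.le, hst, hxe.symm⟩
    filter_upwards [edge_nhds (int_edge H hW hs hc hd ho) (x := G x) ⟨s, t, hs0, ht0, hst, e.symm⟩] with y hy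
    rcases hy with hy | hy
    · exact ⟨a, b, c, hc, seg_sub_hl _ _ _ hseg, hy⟩
    · exact ⟨a, b, d, hd, seg_sub_hl _ _ _ hseg, hy⟩
  · subst hxe
    rw [hG.one hu]
    filter_upwards [star_nhds H hW hs hu hxf] with y hy
    obtain ⟨b, c, ht, hy⟩ := hy
    exact ⟨a, b, c, ht, pos_mem_hl (by simp), hy⟩

theorem inT_of_mem {A B C y : ℝ × ℝ} (ho : orn A B C ≠ 0) (hy : y ∈ convexHull ℝ {A, B, C}) (h1 : orn A B y ≠ 0)
    (h2 : orn B C y ≠ 0) (h3 : orn C A y ≠ 0) : inT A B C y := by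
  obtain ⟨q1, q2, q3⟩ := (mem_tri_iff ho).1 hy
  unfold bc at q1 q2 q3
  have e1 : orn B C A = orn A B C := orn_rot _ _ _
  have e2 : orn C A B = orn A B C := by rw [orn_rot, orn_rot]
  rw [e1] at q1
  rw [e2] at q2
  have key : ∀ o : ℝ, o ≠ 0 → 0 ≤ o / orn A B C → 0 < o * orn A B C := by
    intro o h0 hq
    have hpos : 0 < orn A B C * orn A B C := mul_self_pos.2 ho
    have hq' : 0 < o / orn A B C := lt_of_le_of_ne hq (div_ne_zero h0 ho).symm
    have : o * orn A B C = o / orn A B C * (orn A B C * orn A B C) := by field_simp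
    rw [this]; exact mul_pos hq' hpos
  exact ⟨key _ h1 q3, key _ h2 q1, key _ h3 q2⟩

theorem inj_int (H : Hyp D f C) (hW : Wt D lam) (hs : Sol D lam f h) {G : ℝ × ℝ → ℝ × ℝ} (hG : Gp D h G)
    {x x' : ℝ × ℝ} (hx : x ∈ D.space) (hxf : x ∉ frontier D.space) (hx' : x' ∈ D.space)
    (hxf' : x' ∉ frontier D.space) (he : G x = G x') : x = x' := by
  have c1 := local_cover H hW hs hG hx hxf
  have c2 := local_cover H hW hs hG hx' hxf'
  rw [← he] at c2
  obtain ⟨U, hU, hUo, hUm⟩ := mem_nhds_iff.1 (c1.and c2)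
  obtain ⟨y, hy, hgen⟩ := exists_gen h hUo ⟨_, hUm⟩
  obtain ⟨⟨a, b, c, ht, hxm, hym⟩, ⟨a', b', c', ht', hxm', hym'⟩⟩ := hU hy
  have i1 := inT_of_mem (nondeg H hW hs ht) hym (hgen.2 _ _ (h_ne H hW hs ht.e))
    (hgen.2 _ _ (h_ne H hW hs ht.rot.e)) (hgen.2 _ _ (h_ne H hW hs ht.rot.rot.e))
  have i2 := inT_of_mem (nondeg H hW hs ht') hym' (hgen.2 _ _ (h_ne H hW hs ht'.e))
    (hgen.2 _ _ (h_ne H hW hs ht'.rot.e)) (hgen.2 _ _ (h_ne H hW hs ht'.rot.rot.e))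
  have hv := same_vset H hW hs hgen ht ht' i1 i2
  rw [← hv] at hxm'
  rw [hl_triple] at hxm hxm'
  obtain ⟨α, β, γ, hα, hβ, hγ, hsum, rfl⟩ := mem_tri.1 hxm
  obtain ⟨α', β', γ', hα', hβ', hγ', hsum', rfl⟩ := mem_tri.1 hxm'
  rw [hG a b c ht α β γ hα hβ hγ hsum, hG a b c ht α' β' γ' hα' hβ' hγ' hsum'] at he
  obtain ⟨rfl, rfl, rfl⟩ := combo_inj (nondeg H hW hs ht) hsum hsum' he
  rfl

theorem inj_all (H : Hyp D f C) (hW : Wt D lam) (hs : Sol D lam f h) {G : ℝ × ℝ → ℝ × ℝ} (hG : Gp D h G) :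
    Set.InjOn G D.space := by
  have hf := eqOn_frontier H hs hG
  have mixed : ∀ x x', x ∈ frontier D.space → x' ∈ D.space → x' ∉ frontier D.space → G x ≠ G x' := by
    intro x x' hx hx' hxf' he
    have h1 := maps_int H hW hs hG hx' hxf'
    have h2 : f x ∈ frontier C := by rw [← H.img]; exact ⟨x, hx, rfl⟩
    rw [← he, hf hx] at h1
    exact h2.2 h1
  intro x hx x' hx' he
  by_cases h1 : x ∈ frontier D.space <;> by_cases h2 : x' ∈ frontier D.space
  · rw [hf h1, hf h2] at he
    exact H.inj h1 h2 he
  · exact absurd he (mixed x x' h1 hx' h2)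
  · exact absurd he.symm (mixed x' x h2 hx h1)
  · exact inj_int H hW hs hG hx h1 hx' h2 he

theorem main_ext (H : Hyp D f C) : ∃ G : ℝ × ℝ → ℝ × ℝ,
      D.SLOn G ∧ Set.InjOn G D.space ∧ Set.EqOn G f (frontier D.space) := by
  obtain ⟨lam, hlam⟩ := exists_weights D
  have hW : Wt D lam := hlam
  obtain ⟨h, hs⟩ := exists_sol hW f
  obtain ⟨G, hG1, hG2⟩ := exists_G D h
  exact ⟨G, hG1, inj_all H hW hs hG2, eqOn_frontier H hs hG2⟩

end EX

/-- **Theorem 1, strictly convex case.** Let `K` be a triangulated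
2-disk in the plane and `f` a simplexwise linear embedding of `∂K` whose image is a
strictly convex polygon (the image of every boundary vertex is an extreme point of
the convex disk it bounds). Then `f` extends to a simplexwise linear embedding of
`K`. -/
theorem extension_strictly_convex
    {ι : Type} [Fintype ι] [DecidableEq ι]
    (D : TriDisk ι)
    (f : ℝ × ℝ → ℝ × ℝ)
    (hSL : D.SLOnBoundary f)
    (hinj : Set.InjOn f (frontier D.space))
    (C : Set (ℝ × ℝ)) (hCconv : Convex ℝ C) (hCc : IsCompact C)
    (hCint : (interior C).Nonempty)
    (himg : f '' frontier D.space = frontier C)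
    (hstrict : ∀ i : ι, D.pos i ∈ frontier D.space →
      f (D.pos i) ∈ Set.extremePoints ℝ C) :
    ∃ G : ℝ × ℝ → ℝ × ℝ,
      D.SLOn G ∧ Set.InjOn G D.space ∧ Set.EqOn G f (frontier D.space) := by
  exact EX.main_ext ⟨hSL, hinj, hCconv, hCc, hCint, himg, hstrict⟩
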